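/- arXiv:1706.06766 — 3 statements merged into one kernel-verified Lean document; each statement's English description precedes it below -/
import Mathlib

section
/- For every λ with 4 < λ ≤ 8 and λ ≠ 6, there exists a solution u of the mean field equation Δu = λ(1−e^u) on S² such that u is not identically zero and u depends only on the coordinate x₃ (i.e. u(x) = u(x') for all x, x' ∈ S² with x₃ = x'₃). -/
open Real MeasureTheory

noncomputable section

/-- Euclidean Laplacian on ℝ² via the second iterated derivative. -/
def lap (w : ℝ × ℝ → ℝ) (y : ℝ × ℝ) : ℝ :=
  iteratedFDeriv ℝ 2 w y ![(1, 0), (1, 0)] + iteratedFDeriv ℝ 2 w y ![(0, 1), (0, 1)]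

/-- The unit sphere S² ⊂ ℝ³ (vectors encoded as functions `Fin 3 → ℝ`). -/
def sphere3 : Set (Fin 3 → ℝ) := {x | x 0 ^ 2 + x 1 ^ 2 + x 2 ^ 2 = 1}

/-- Inverse stereographic projection from the north pole. -/
def stereoN (y : ℝ × ℝ) : Fin 3 → ℝ :=
  ![2 * y.1 / (1 + y.1 ^ 2 + y.2 ^ 2), 2 * y.2 / (1 + y.1 ^ 2 + y.2 ^ 2),
    (y.1 ^ 2 + y.2 ^ 2 - 1) / (1 + y.1 ^ 2 + y.2 ^ 2)]

/-- South-pole parametrization of the sphere. -/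
def stereoS (y : ℝ × ℝ) : Fin 3 → ℝ :=
  ![2 * y.1 / (1 + y.1 ^ 2 + y.2 ^ 2), 2 * y.2 / (1 + y.1 ^ 2 + y.2 ^ 2),
    (1 - y.1 ^ 2 - y.2 ^ 2) / (1 + y.1 ^ 2 + y.2 ^ 2)]

/-- `u` is a solution of the mean field equation `Δu = lam (1 - e^u)` on `S²`,
expressed in the two stereographic charts. -/
def IsMFSolution (lam : ℝ) (u : (Fin 3 → ℝ) → ℝ) : Prop :=
  ContinuousOn u sphere3 ∧
  ContDiff ℝ 2 (fun y => u (stereoN y)) ∧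
  ContDiff ℝ 2 (fun y => u (stereoS y)) ∧
  (∀ y : ℝ × ℝ, lap (fun z => u (stereoN z)) y =
    4 * lam * (1 - Real.exp (u (stereoN y))) / (1 + y.1 ^ 2 + y.2 ^ 2) ^ 2) ∧
  (∀ y : ℝ × ℝ, lap (fun z => u (stereoS z)) y =
    4 * lam * (1 - Real.exp (u (stereoS y))) / (1 + y.1 ^ 2 + y.2 ^ 2) ^ 2)

/-- `u` is axially symmetric on `S²`: constant on the level sets of `⟨·, e⟩`
for some unit vector `e`. -/
def AxiallySymmetric (u : (Fin 3 → ℝ) → ℝ) : Prop :=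
  ∃ e : Fin 3 → ℝ, e 0 ^ 2 + e 1 ^ 2 + e 2 ^ 2 = 1 ∧
    ∀ x ∈ sphere3, ∀ x' ∈ sphere3,
      x 0 * e 0 + x 1 * e 1 + x 2 * e 2 = x' 0 * e 0 + x' 1 * e 1 + x' 2 * e 2 →
      u x = u x'

/-- Surface integral over `S²`, written in the north-pole stereographic chart. -/
def sphereIntegral (f : (Fin 3 → ℝ) → ℝ) : ℝ :=
  ∫ y : ℝ × ℝ, f (stereoN y) * (4 / (1 + y.1 ^ 2 + y.2 ^ 2) ^ 2)

/-- The average of `g` over the segment from `0` to `t`. -/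
def av (g : ℝ → ℝ) (t : ℝ) : ℝ := ∫ θ in (0:ℝ)..1, g (θ * t)

/-- The radial inverse Laplacian, with truncated coefficient. -/
def kop (T : ℝ) (g : ℝ → ℝ) (t : ℝ) : ℝ := ∫ s in (0:ℝ)..t, av g s / max (1 - s) (1 - T)

lemma av_cont {g : ℝ → ℝ} (hg : Continuous g) : Continuous (av g) := by
  unfold av
  apply intervalIntegral.continuous_parametric_intervalIntegral_of_continuous'
  simp only [Function.uncurry_def]
  fun_prop

lemma mul_av (g : ℝ → ℝ) (t : ℝ) : t * av g t = ∫ s in (0:ℝ)..t, g s := by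
  unfold av
  have := intervalIntegral.mul_integral_comp_mul_right (a := 0) (b := 1) (f := g) t
  simpa using this

lemma av_congr {g h : ℝ → ℝ} {t : ℝ} (ht : 0 ≤ t) (H : ∀ s, 0 ≤ s → s ≤ t → g s = h s) :
    av g t = av h t := by
  unfold av
  apply intervalIntegral.integral_congr
  intro θ hθ
  rw [Set.uIcc_of_le zero_le_one] at hθ
  exact H _ (mul_nonneg hθ.1 ht) (by nlinarith [hθ.1, hθ.2])

lemma av_abs_le {g : ℝ → ℝ} {t e : ℝ} (ht : 0 ≤ t) (H : ∀ s, 0 ≤ s → s ≤ t → |g s| ≤ e) :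
    |av g t| ≤ e := by
  unfold av
  have := intervalIntegral.norm_integral_le_of_norm_le_const (a := 0) (b := 1) (C := e)
    (f := fun θ => g (θ * t)) ?_
  · simpa using this
  · intro θ hθ
    rw [Set.uIoc_of_le zero_le_one] at hθ
    exact H _ (mul_nonneg hθ.1.le ht) (by nlinarith [hθ.1, hθ.2])

lemma av_sub {g h : ℝ → ℝ} (hg : Continuous g) (hh : Continuous h) (t : ℝ) :
    av (fun s => g s - h s) t = av g t - av h t := by
  unfold av
  rw [intervalIntegral.integral_sub]
  · exact Continuous.intervalIntegrable (by fun_prop) _ _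
  · exact Continuous.intervalIntegrable (by fun_prop) _ _

lemma av_mul_const {g : ℝ → ℝ} (c t : ℝ) :
    av (fun s => c * g s) t = c * av g t := by
  unfold av
  rw [intervalIntegral.integral_const_mul]

lemma av_const (c t : ℝ) : av (fun _ => c) t = c := by
  unfold av; simp

lemma av_zero (g : ℝ → ℝ) : av g 0 = g 0 := by
  unfold av; simp

lemma av_mono {g h : ℝ → ℝ} (hg : Continuous g) (hh : Continuous h) {t : ℝ} (ht : 0 ≤ t)
    (H : ∀ s, 0 ≤ s → s ≤ t → g s ≤ h s) : av g t ≤ av h t := by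
  unfold av
  apply intervalIntegral.integral_mono_on zero_le_one
  · exact Continuous.intervalIntegrable (by fun_prop) _ _
  · exact Continuous.intervalIntegrable (by fun_prop) _ _
  · intro θ hθ
    exact H _ (mul_nonneg hθ.1 ht) (by nlinarith [hθ.1, hθ.2])

lemma den_pos {T : ℝ} (hT : T < 1) (s : ℝ) : 0 < max (1 - s) (1 - T) :=
  lt_of_lt_of_le (by linarith) (le_max_right _ _)

lemma kop_integrand_cont {T : ℝ} (hT : T < 1) {g : ℝ → ℝ} (hg : Continuous g) :
    Continuous (fun s => av g s / max (1 - s) (1 - T)) :=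
  (av_cont hg).div (by fun_prop) (fun s => (den_pos hT s).ne')

lemma kop_hasDerivAt {T : ℝ} (hT : T < 1) {g : ℝ → ℝ} (hg : Continuous g) (t : ℝ) :
    HasDerivAt (kop T g) (av g t / max (1 - t) (1 - T)) t := by
  have hc := kop_integrand_cont hT hg
  exact intervalIntegral.integral_hasDerivAt_right (hc.intervalIntegrable _ _)
    hc.stronglyMeasurable.stronglyMeasurableAtFilter hc.continuousAt

lemma kop_cont {T : ℝ} (hT : T < 1) {g : ℝ → ℝ} (hg : Continuous g) : Continuous (kop T g) :=
  continuous_iff_continuousAt.2 fun t => (kop_hasDerivAt hT hg t).continuousAt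

lemma kop_zero (T : ℝ) (g : ℝ → ℝ) : kop T g 0 = 0 := by simp [kop]

lemma kop_congr {T : ℝ} {g h : ℝ → ℝ} {t : ℝ} (ht : 0 ≤ t)
    (H : ∀ s, 0 ≤ s → s ≤ t → g s = h s) : kop T g t = kop T h t := by
  unfold kop
  apply intervalIntegral.integral_congr
  intro s hs
  rw [Set.uIcc_of_le ht] at hs
  simp only
  rw [av_congr hs.1 (fun r hr hr' => H r hr (hr'.trans hs.2))]

lemma kop_T_congr {T T' : ℝ} {g : ℝ → ℝ} {t : ℝ} (ht : 0 ≤ t) (h1 : t ≤ T) (h2 : t ≤ T') :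
    kop T g t = kop T' g t := by
  unfold kop
  apply intervalIntegral.integral_congr
  intro s hs
  rw [Set.uIcc_of_le ht] at hs
  simp only
  rw [max_eq_left (by linarith [hs.2]), max_eq_left (by linarith [hs.2])]

lemma kop_sub {T : ℝ} (hT : T < 1) {g h : ℝ → ℝ} (hg : Continuous g) (hh : Continuous h) (t : ℝ) :
    kop T (fun s => g s - h s) t = kop T g t - kop T h t := by
  unfold kop
  rw [← intervalIntegral.integral_sub ((kop_integrand_cont hT hg).intervalIntegrable _ _)
    ((kop_integrand_cont hT hh).intervalIntegrable _ _)]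
  congr 1; ext s; rw [av_sub hg hh, sub_div]

lemma kop_mul_const {T : ℝ} {g : ℝ → ℝ} (c t : ℝ) :
    kop T (fun s => c * g s) t = c * kop T g t := by
  unfold kop
  rw [← intervalIntegral.integral_const_mul]
  congr 1; ext s; rw [av_mul_const, mul_div_assoc]

/-- weighted bound for the half-interval operator -/
lemma kop_weighted {g : ℝ → ℝ} (hg : Continuous g) {k e t : ℝ} (hk : 0 < k) (he : 0 ≤ e)
    (ht : 0 ≤ t) (H : ∀ s, 0 ≤ s → s ≤ t → |g s| ≤ e * exp (k * s)) :
    |kop (1/2) g t| ≤ 2 * e / k * exp (k * t) := by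
  have h1 : ∀ s ∈ Set.Icc 0 t, ‖av g s / max (1 - s) (1 - 1/2)‖ ≤ 2 * e * exp (k * s) := by
    intro s hs
    have h2 : |av g s| ≤ e * exp (k * s) := by
      apply av_abs_le hs.1
      intro r hr hr'
      refine (H r hr (hr'.trans hs.2)).trans ?_
      gcongr
    have h3 : (1:ℝ)/2 ≤ max (1 - s) (1 - 1/2) := le_trans (by norm_num) (le_max_right _ _)
    rw [Real.norm_eq_abs, abs_div, abs_of_pos (den_pos (by norm_num) s), div_le_iff₀ (by linarith)]
    have : 0 ≤ e * exp (k * s) := by positivity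
    nlinarith
  have h2 := intervalIntegral.norm_integral_le_of_norm_le (μ := volume) ht
    (Filter.Eventually.of_forall fun s hs => h1 s ⟨hs.1.le, hs.2⟩)
    (Continuous.intervalIntegrable (by fun_prop) _ _)
  have h3 : ∫ s in (0:ℝ)..t, 2 * e * exp (k * s) = 2 * e / k * (exp (k * t) - 1) := by
    rw [intervalIntegral.integral_const_mul, intervalIntegral.integral_comp_mul_left _ hk.ne']
    simp only [mul_zero, integral_exp, exp_zero, smul_eq_mul]
    field_simp
  rw [h3] at h2
  refine h2.trans ?_
  have : 0 ≤ 2 * e / k := by positivity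
  nlinarith

/-- Upper bound: if `g ≤ c` then `kop g ≤ 2 c t`. -/
lemma kop_le {g : ℝ → ℝ} (hg : Continuous g) {c t : ℝ} (hc : 0 ≤ c) (ht : 0 ≤ t)
    (H : ∀ s, 0 ≤ s → s ≤ t → g s ≤ c) : kop (1/2) g t ≤ 2 * c * t := by
  unfold kop
  have : ∫ s in (0:ℝ)..t, av g s / max (1 - s) (1 - 1/2) ≤ ∫ s in (0:ℝ)..t, 2 * c := by
    apply intervalIntegral.integral_mono_on ht
      ((kop_integrand_cont (by norm_num) hg).intervalIntegrable _ _) (by simp)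
    intro s hs
    have h2 : av g s ≤ c := by
      rw [← av_const c s]
      exact av_mono hg continuous_const hs.1 (fun r hr hr' => H r hr (hr'.trans hs.2))
    have h3 : (1:ℝ)/2 ≤ max (1 - s) (1 - 1/2) := le_trans (by norm_num) (le_max_right _ _)
    rw [div_le_iff₀ (by linarith)]
    nlinarith
  refine this.trans ?_
  simp; linarith

/-- Existence and stability for the singular initial value problem with globally Lipschitz
nonlinearity. -/
lemma exists_flow {f : ℝ → ℝ} {L : ℝ} (hL : 0 < L) (hf : ∀ x y, |f x - f y| ≤ L * |x - y|) :
    ∃ (v : ℝ → ℝ → ℝ) (C : ℝ), 0 < C ∧ (∀ α, Continuous (v α)) ∧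
      (∀ α t, 0 ≤ t → t ≤ 1/2 → v α t = α + kop (1/2) (fun s => f (v α s)) t) ∧
      (∀ α (z : ℝ → ℝ) (e : ℝ), Continuous z → 
        (∀ t, 0 ≤ t → t ≤ 1/2 → |z t - (α + kop (1/2) (fun s => f (z s)) t)| ≤ e) →
        ∀ t, 0 ≤ t → t ≤ 1/2 → |z t - v α t| ≤ C * e) := by
  have hfc : Continuous f := by
    have : LipschitzWith ⟨L, hL.le⟩ f := LipschitzWith.of_dist_le_mul fun x y => by
      rw [Real.dist_eq, Real.dist_eq]; exact hf x y
    exact this.continuous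
  set k : ℝ := 4 * L with hk
  have hk0 : 0 < k := by positivity
  have h01 : (0:ℝ) ≤ 1/2 := by norm_num
  -- reconstruct the function from the weighted one
  let R : C(Set.Icc (0:ℝ) (1/2), ℝ) → ℝ → ℝ := fun w t =>
    exp (k * (Set.projIcc 0 (1/2) h01 t : ℝ)) * w (Set.projIcc 0 (1/2) h01 t)
  have hRc : ∀ w, Continuous (R w) := by
    intro w
    have := continuous_projIcc (h := h01)
    simp only [R]; fun_prop
  have hRe : ∀ w t (h0 : 0 ≤ t) (h1 : t ≤ 1/2), R w t = exp (k * t) * w ⟨t, h0, h1⟩ := by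
    intro w t h0 h1
    simp only [R]
    rw [Set.projIcc_of_mem h01 ⟨h0, h1⟩]
  let Φ : ℝ → C(Set.Icc (0:ℝ) (1/2), ℝ) → C(Set.Icc (0:ℝ) (1/2), ℝ) := fun α w =>
    ⟨fun t => exp (-(k * t)) * (α + kop (1/2) (fun s => f (R w s)) t), by
      have := kop_cont (T := 1/2) (by norm_num) (hfc.comp (hRc w))
      simp only [Function.comp_def] at this
      fun_prop⟩
  have hΦ : ∀ α, ContractingWith (1/2) (Φ α) := by
    intro α
    refine ⟨by rw [← NNReal.coe_lt_coe]; norm_num, LipschitzWith.of_dist_le_mul fun w w' => ?_⟩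
    have hd : (0:ℝ) ≤ dist w w' := dist_nonneg
    rw [ContinuousMap.dist_le (by positivity)]
    rintro ⟨t, ht0, ht1⟩
    simp only [Φ, ContinuousMap.coe_mk, Real.dist_eq]
    have hsub := kop_sub (T := 1/2) (by norm_num) (hfc.comp (hRc w)) (hfc.comp (hRc w')) t
    simp only [Function.comp_apply, Function.comp_def] at hsub
    rw [← mul_sub, add_sub_add_left_eq_sub, ← hsub, abs_mul, abs_of_pos (exp_pos _)]
    have := kop_weighted (g := fun s => f (R w s) - f (R w' s)) 
      ((hfc.comp (hRc w)).sub (hfc.comp (hRc w'))) (k := k) (e := L * dist w w') hk0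
      (by positivity) ht0 (by
        intro s hs hs'
        refine (hf _ _).trans ?_
        rw [hRe w s hs (hs'.trans ht1), hRe w' s hs (hs'.trans ht1), ← mul_sub, abs_mul,
          abs_of_pos (exp_pos _), ← Real.dist_eq]
        have := ContinuousMap.dist_apply_le_dist (f := w) (g := w') ⟨s, hs, hs'.trans ht1⟩
        calc _ ≤ L * (exp (k * s) * dist w w') := by gcongr
          _ = _ := by ring)
    calc _ ≤ exp (-(k*t)) * (2 * (L * dist w w') / k * exp (k * t)) := by gcongr
      _ = 2 * (L * dist w w') / k * (exp (-(k*t)) * exp (k * t)) := by ring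
      _ = (1/2) * dist w w' := by
        rw [← exp_add]; simp only [neg_add_cancel, exp_zero, mul_one, hk]; field_simp; ring
      _ = _ := by norm_num
  refine ⟨fun α => R ((hΦ α).fixedPoint (Φ α)), 2 * exp (k * (1/2)), by positivity,
    fun α => hRc _, ?_, ?_⟩
  · intro α t h0 h1
    have h := (hΦ α).fixedPoint_isFixedPt
    show R ((hΦ α).fixedPoint (Φ α)) t = α + kop (1/2) (fun s => f (R ((hΦ α).fixedPoint (Φ α)) s)) t
    generalize (hΦ α).fixedPoint (Φ α) = W at h
    have h2 : Φ α W ⟨t, h0, h1⟩ = W ⟨t, h0, h1⟩ := by rw [h.eq]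
    rw [hRe _ t h0 h1, ← h2]
    simp only [Φ, ContinuousMap.coe_mk]
    rw [← mul_assoc, ← exp_add]
    simp only [add_neg_cancel, exp_zero, one_mul]
  · intro α z e hz H t h0 h1
    let w : C(Set.Icc (0:ℝ) (1/2), ℝ) := ⟨fun t => exp (-(k * t)) * z t, by fun_prop⟩
    have hw : ∀ t, 0 ≤ t → t ≤ 1/2 → R w t = z t := by
      intro t h0 h1
      rw [hRe w t h0 h1]
      simp only [w, ContinuousMap.coe_mk]
      rw [← mul_assoc, ← exp_add]; simp
    have he : 0 ≤ e := (abs_nonneg _).trans (H 0 le_rfl h01)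
    have h2 : dist w (Φ α w) ≤ e := by
      rw [ContinuousMap.dist_le he]
      rintro ⟨t, h0, h1⟩
      simp only [Φ, w, ContinuousMap.coe_mk, Real.dist_eq]
      rw [← mul_sub, abs_mul, abs_of_pos (exp_pos _),
        kop_congr (h := fun s => f (z s)) h0
          (fun s hs hs' => congrArg f (hw s hs (hs'.trans h1)))]
      have h3 : exp (-(k*t)) ≤ 1 := exp_le_one_iff.2 (by nlinarith)
      have h4 := H t h0 h1
      have := abs_nonneg (z t - (α + kop (1/2) (fun s => f (z s)) t))
      nlinarith
    have h3 := (hΦ α).dist_fixedPoint_le w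
    have h4 : dist w ((hΦ α).fixedPoint (Φ α)) ≤ 2 * e := by
      refine h3.trans ?_
      rw [div_le_iff₀ (by norm_num)]
      norm_num; linarith
    have h5 := (ContinuousMap.dist_apply_le_dist (f := w) (g := (hΦ α).fixedPoint (Φ α))
      ⟨t, h0, h1⟩).trans h4
    show |z t - R ((hΦ α).fixedPoint (Φ α)) t| ≤ _
    rw [← hw t h0 h1, hRe w t h0 h1, hRe _ t h0 h1, ← mul_sub, abs_mul, abs_of_pos (exp_pos _), ← Real.dist_eq]
    calc _ ≤ exp (k * (1/2)) * (2 * e) := by gcongr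
      _ = _ := by ring

lemma ps_summable {b : ℕ → ℝ} {B : ℝ} (hb : ∀ n, |b n| ≤ B) {t : ℝ} (ht : |t| < 1) :
    Summable (fun n => b n * t ^ n) := by
  refine Summable.of_norm_bounded (g := fun n => B * |t| ^ n)
    ((summable_geometric_of_lt_one (abs_nonneg t) ht).mul_left B) fun n => ?_
  rw [Real.norm_eq_abs, abs_mul, abs_pow]
  gcongr
  exact hb n

lemma ps_hasDerivAt {b : ℕ → ℝ} {B : ℝ} (hb : ∀ n, |b n| ≤ B) {t : ℝ} (ht : |t| < 1) :
    HasDerivAt (fun t : ℝ => ∑' n : ℕ, b n / (n + 1) * t ^ (n + 1)) (∑' n, b n * t ^ n) t := by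
  obtain ⟨r, hr, hr1⟩ := exists_between ht
  have hr0 : 0 < r := (abs_nonneg t).trans_lt hr
  have hB : 0 ≤ B := (abs_nonneg _).trans (hb 0)
  refine hasDerivAt_tsum_of_isPreconnected (u := fun n => B * r ^ n) (t := Metric.ball 0 r)
    (y₀ := 0) ((summable_geometric_of_lt_one hr0.le hr1).mul_left B) Metric.isOpen_ball
    (convex_ball _ _).isPreconnected (g := fun n t => b n / (n + 1) * t ^ (n + 1))
    (g' := fun n t => b n * t ^ n) ?_ ?_ (Metric.mem_ball_self hr0) ?_ (by simpa using hr)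
  · intro n y _
    have h := (hasDerivAt_pow (n + 1) y).const_mul (b n / (n + 1))
    refine h.congr_deriv ?_
    have : (n : ℝ) + 1 ≠ 0 := by positivity
    push_cast
    field_simp
  · intro n y hy
    have hy' : |y| < r := by simpa using hy
    rw [Real.norm_eq_abs, abs_mul, abs_pow]
    gcongr
    exact hb n
  · simp

/-- Taylor coefficients of the derivative of the Legendre function. -/
def dco (lam : ℝ) : ℕ → ℝ
  | 0 => -lam
  | (n + 1) => dco lam n * (1 - lam / ((n + 1) * (n + 2)))

lemma dco_succ (lam : ℝ) (n : ℕ) :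
    dco lam (n + 1) = dco lam n * (1 - lam / ((n + 1) * (n + 2))) := rfl

lemma dco_fac {lam : ℝ} (h1 : 4 < lam) (h2 : lam ≤ 8) (n : ℕ) :
    0 ≤ 1 - lam / (((n + 2 : ℕ) + 1 : ℝ) * ((n + 2 : ℕ) + 2)) ∧
      1 - lam / (((n + 2 : ℕ) + 1 : ℝ) * ((n + 2 : ℕ) + 2)) ≤ 1 := by
  push_cast
  have hn : (0:ℝ) ≤ n := Nat.cast_nonneg n
  have hp : (0:ℝ) < (n + 2 + 1) * (n + 2 + 2) := by positivity
  constructor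
  · rw [sub_nonneg, div_le_one hp]; nlinarith
  · have : 0 ≤ lam / ((n + 2 + 1 : ℝ) * (n + 2 + 2)) := by
      apply div_nonneg <;> nlinarith
    linarith

lemma dco_two (lam : ℝ) : dco lam 2 = (6 - lam) * (lam * (lam - 2) / 12) := by
  simp only [dco]; push_cast; ring

lemma dco_three (lam : ℝ) : dco lam 3 = (6 - lam) * (lam * (lam - 2) / 12 * (1 - lam / 12)) := by
  rw [dco_succ, dco_two]; push_cast; ring

lemma dco_tail {lam : ℝ} (h1 : 4 < lam) (h2 : lam ≤ 8) (n : ℕ) :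
    ∃ β : ℝ, 0 ≤ β ∧ β ≤ lam * (lam - 2) / 12 * (1 - lam / 12) ∧
      dco lam (n + 3) = (6 - lam) * β := by
  induction n with
  | zero =>
    refine ⟨_, ?_, le_rfl, dco_three lam⟩
    apply mul_nonneg
    · nlinarith
    · linarith
  | succ n ih =>
    obtain ⟨β, hb0, hb1, hb2⟩ := ih
    have hf := dco_fac h1 h2 (n + 1)
    refine ⟨β * (1 - lam / (((n + 1 + 2 : ℕ) + 1 : ℝ) * ((n + 1 + 2 : ℕ) + 2))),
      mul_nonneg hb0 hf.1, ?_, ?_⟩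
    · exact (mul_le_of_le_one_right hb0 hf.2).trans hb1
    · rw [show n + 1 + 3 = (n + 3) + 1 by ring, dco_succ, hb2]
      ring

lemma dco_bdd {lam : ℝ} (h1 : 4 < lam) (h2 : lam ≤ 8) (n : ℕ) : |dco lam n| ≤ 24 := by
  rcases n with _ | _ | _ | n
  · simp only [dco]; rw [abs_le]; constructor <;> linarith
  · simp only [dco]; rw [abs_le]; push_cast; constructor <;> nlinarith
  · show |dco lam 2| ≤ 24
    have e1 : |6 - lam| ≤ 2 := by rw [abs_le]; constructor <;> linarith
    have e2 : |lam * (lam - 2) / 12| ≤ 4 := by rw [abs_le]; constructor <;> nlinarith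
    rw [dco_two, abs_mul]
    nlinarith [abs_nonneg (6 - lam), abs_nonneg (lam * (lam - 2) / 12)]
  · obtain ⟨β, hb0, hb1, hb2⟩ := dco_tail h1 h2 n
    rw [show n + 1 + 1 + 1 = n + 3 by ring, hb2, abs_mul, abs_of_nonneg hb0]
    have e1 : |6 - lam| ≤ 2 := by rw [abs_le]; constructor <;> linarith
    have e2 : β ≤ 4 := by
      have : lam * (lam - 2) / 12 ≤ 4 := by nlinarith
      have h3 : 0 ≤ lam * (lam - 2) / 12 := by nlinarith
      nlinarith
    nlinarith [abs_nonneg (6 - lam)]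

/-- The power series for the derivative does not vanish at the equator. -/
lemma dco_sum_ne {lam : ℝ} (h1 : 4 < lam) (h2 : lam ≤ 8) (h3 : lam ≠ 6) :
    ∑' n, dco lam n * (1/2) ^ n ≠ 0 := by
  have hs : Summable (fun n => dco lam n * (1/2:ℝ) ^ n) :=
    ps_summable (dco_bdd h1 h2) (by rw [abs_of_pos] <;> norm_num)
  rw [← hs.sum_add_tsum_nat_add 3]
  choose β hb0 hb1 hb2 using dco_tail h1 h2
  have hgs : Summable (fun n : ℕ => (1/2:ℝ) ^ n) := summable_geometric_of_lt_one (by norm_num) (by norm_num)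
  set S := lam * (lam - 2) / 12 * (1 - lam / 12) with hS
  have hsb : Summable (fun n => β n * (1/2:ℝ) ^ (n + 3)) := by
    refine Summable.of_nonneg_of_le (fun n => mul_nonneg (hb0 n) (by positivity)) 
      (fun n => ?_) (hgs.mul_left S)
    have hp : 0 < (1/2:ℝ)^n := by positivity
    have hm := mul_le_mul_of_nonneg_right (hb1 n) hp.le
    have hm2 := mul_nonneg (hb0 n) hp.le
    calc β n * (1/2:ℝ) ^ (n + 3) = (β n * (1/2:ℝ)^n) / 8 := by ring
      _ ≤ _ := by linarith
  have ht : ∑' n, dco lam (n + 3) * (1/2:ℝ) ^ (n + 3) = (6 - lam) * ∑' n, β n * (1/2:ℝ) ^ (n + 3) := by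
    rw [← tsum_mul_left]; congr 1; ext n; rw [hb2]; ring
  have hle : ∑' n, β n * (1/2:ℝ) ^ (n + 3) ≤ S / 4 := by
    have : ∑' n : ℕ, S / 8 * (1/2:ℝ) ^ n = S / 4 := by
      rw [tsum_mul_left, tsum_geometric_two]; ring
    rw [← this]
    refine hsb.tsum_le_tsum (fun n => ?_) (hgs.mul_left _)
    have hp : 0 < (1/2:ℝ)^n := by positivity
    have hm := mul_le_mul_of_nonneg_right (hb1 n) hp.le
    calc β n * (1/2:ℝ) ^ (n + 3) = (β n * (1/2:ℝ)^n) / 8 := by ring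
      _ ≤ (S * (1/2:ℝ)^n) / 8 := by linarith
      _ = _ := by ring
  rw [ht]
  set X := ∑' n, β n * (1/2:ℝ) ^ (n + 3)
  have e : ∑ i ∈ Finset.range 3, dco lam i * (1/2:ℝ) ^ i = 
      (6 - lam) * (lam * (lam - 2) / 48 - lam / 4) := by
    rw [Finset.sum_range_succ, Finset.sum_range_succ, Finset.sum_range_one, dco_two]
    simp only [dco]; push_cast; ring
  rw [e, ← mul_add]
  apply mul_ne_zero (sub_ne_zero.2 h3.symm)
  apply ne_of_lt
  have hS2 : S ≤ lam * (lam - 2) / 12 * (2/3) := by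
    rw [hS]
    apply mul_le_mul_of_nonneg_left
    · linarith
    · nlinarith
  nlinarith

/-- The linearised profile (a Legendre function). -/
lemma exists_legendre {lam : ℝ} (h1 : 4 < lam) (h2 : lam ≤ 8) (h3 : lam ≠ 6) :
    ∃ y : ℝ → ℝ, Continuous y ∧
      (∀ t, 0 ≤ t → t ≤ 1/2 → y t = 1 - lam * kop (1/2) y t) ∧
      ∫ s in (0:ℝ)..(1/2), y s ≠ 0 := by
  set D : ℝ → ℝ := fun t => ∑' n, dco lam n * t ^ n with hD
  set Y : ℝ → ℝ := fun t => 1 + ∑' n : ℕ, dco lam n / (n + 1) * t ^ (n + 1) with hY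
  set M : ℝ → ℝ := fun t => t * (1 - t) * D t with hM
  have hYd : ∀ t, |t| < 1 → HasDerivAt Y (D t) t := fun t ht =>
    (ps_hasDerivAt (dco_bdd h1 h2) ht).const_add 1
  -- second series
  let b : ℕ → ℝ := fun n => Nat.casesOn n 1 (fun n => dco lam n / (n + 1))
  have hb : ∀ n, |b n| ≤ 24 := by
    intro n
    rcases n with _ | n
    · simp only [b]; norm_num
    · simp only [b]
      have hp : (0:ℝ) < n + 1 := by positivity
      rw [abs_div, abs_of_pos hp, div_le_iff₀ hp]
      have := dco_bdd h1 h2 n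
      have : (0:ℝ) ≤ n := Nat.cast_nonneg n
      nlinarith
  have hbY : ∀ t, |t| < 1 → ∑' n, b n * t ^ n = Y t := by
    intro t ht
    rw [(ps_summable hb ht).tsum_eq_zero_add]
    simp [b, hY]
  have hbM : ∀ t, |t| < 1 → -lam * ∑' n : ℕ, b n / (n + 1) * t ^ (n + 1) = M t := by
    intro t ht
    have hsum := ps_summable (dco_bdd h1 h2) ht
    have hsb : Summable (fun n : ℕ => b n / (n + 1) * t ^ (n + 1)) := by
      have hb' : ∀ n : ℕ, |b n / (n + 1)| ≤ 24 := by
        intro n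
        have hp : (0:ℝ) < n + 1 := by positivity
        rw [abs_div, abs_of_pos hp, div_le_iff₀ hp]
        have := hb n
        have : (0:ℝ) ≤ n := Nat.cast_nonneg n
        nlinarith
      have := (ps_summable hb' ht).mul_left t
      refine this.congr fun n => ?_
      ring
    have hsum1 := (summable_nat_add_iff 1).2 hsum
    have e1 : D t = -lam + ∑' n, dco lam (n + 1) * t ^ (n + 1) := by
      rw [hD]; simp only; rw [hsum.tsum_eq_zero_add]; simp [dco]
    have e2 : M t = -lam * t + t * (∑' n, (dco lam (n + 1) * t ^ (n + 1) - t * (dco lam n * t ^ n))) := by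
      rw [hsum1.tsum_sub (hsum.mul_left t), tsum_mul_left]
      have e3 : ∑' n, dco lam n * t ^ n = D t := rfl
      rw [e3]
      simp only [hM]
      linear_combination t * e1
    rw [e2, hsb.tsum_eq_zero_add, mul_add, ← tsum_mul_left, ← tsum_mul_left]
    congr 1
    · simp [b]
    · congr 1; ext n
      rw [dco_succ]
      simp only [b]
      have hp : (n:ℝ) + 1 ≠ 0 := by positivity
      have hp2 : (n:ℝ) + 2 ≠ 0 := by positivity
      have hp3 : (n:ℝ) + 1 + 1 ≠ 0 := by positivity
      push_cast
      field_simp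
      ring
  have hMd : ∀ t, |t| < 1 → HasDerivAt M (-lam * Y t) t := by
    intro t ht
    have := (ps_hasDerivAt hb ht).const_mul (-lam)
    rw [hbY t ht] at this
    refine this.congr_of_eventuallyEq ?_
    have : ∀ᶠ s in nhds t, |s| < 1 := (continuous_abs.tendsto t).eventually (gt_mem_nhds ht)
    filter_upwards [this] with s hs using (hbM s hs).symm
  have h01 : (0:ℝ) ≤ 1/2 := by norm_num
  have hab : ∀ t : ℝ, 0 ≤ t → t ≤ 1/2 → |t| < 1 := fun t h0 h1 => by
    rw [abs_of_nonneg h0]; linarith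
  let y : ℝ → ℝ := fun t => Y (Set.projIcc 0 (1/2) h01 t)
  have hyY : ∀ t, 0 ≤ t → t ≤ 1/2 → y t = Y t := by
    intro t h0 h1
    simp only [y]; rw [Set.projIcc_of_mem h01 ⟨h0, h1⟩]
  have hyc : Continuous y := by
    have hYc : ContinuousOn Y (Set.Icc 0 (1/2)) := fun t ht =>
      (hYd t (hab t ht.1 ht.2)).continuousAt.continuousWithinAt
    exact hYc.comp_continuous (continuous_subtype_val.comp continuous_projIcc) 
      (fun t => (Set.projIcc 0 (1/2) h01 t).2)
  have hint : ∀ t, 0 ≤ t → t ≤ 1/2 → -lam * ∫ s in (0:ℝ)..t, y s = M t := by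
    intro t h0 h1
    have : ∫ s in (0:ℝ)..t, -lam * y s = M t - M 0 := by
      apply intervalIntegral.integral_eq_sub_of_hasDerivAt
      · intro s hs
        rw [Set.uIcc_of_le h0] at hs
        rw [hyY s hs.1 (hs.2.trans h1)]
        exact hMd s (hab s hs.1 (hs.2.trans h1))
      · exact Continuous.intervalIntegrable (by fun_prop) _ _
    rw [intervalIntegral.integral_const_mul] at this
    rw [this]; simp [hM]
  refine ⟨y, hyc, ?_, ?_⟩
  · intro t h0 h1
    have e : ∫ s in (0:ℝ)..t, -lam * (av y s / max (1 - s) (1 - 1/2)) = Y t - Y 0 := by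
      apply intervalIntegral.integral_eq_sub_of_hasDerivAt_of_le h0
      · exact fun s hs =>
          (hYd s (hab s hs.1 (hs.2.trans h1))).continuousAt.continuousWithinAt
      · intro s hs
        have hs1 : s ≤ 1/2 := hs.2.le.trans h1
        have := hYd s (hab s hs.1.le hs1)
        refine this.congr_deriv ?_
        rw [max_eq_left (by linarith)]
        have h7 := hint s hs.1.le hs1
        rw [← mul_av] at h7
        simp only [hM] at h7
        have : 0 < s := hs.1
        have : 0 < 1 - s := by linarith
        field_simp
        apply mul_left_cancel₀ hs.1.ne'
        linarith
      · exact (continuous_const.mul (kop_integrand_cont (by norm_num) hyc)).intervalIntegrable _ _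
    rw [intervalIntegral.integral_const_mul] at e
    rw [hyY t h0 h1]
    have hY0 : Y 0 = 1 := by simp [hY]
    unfold kop
    linarith
  · intro h
    have := hint (1/2) h01 le_rfl
    rw [h, hM] at this
    have h5 := dco_sum_ne h1 h2 h3
    simp only [hD] at this
    apply h5
    linarith

/-- Monotonicity from a derivative sign on the open interval. -/
lemma mono_half {F F' : ℝ → ℝ} (hc : ContinuousOn F (Set.Icc 0 (1/2)))
    (hd : ∀ t, 0 < t → t < 1/2 → HasDerivAt F (F' t) t)
    (hp : ∀ t, 0 < t → t < 1/2 → 0 ≤ F' t) {t : ℝ} (h0 : 0 ≤ t) (h1 : t ≤ 1/2) : F 0 ≤ F t := by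
  have : MonotoneOn F (Set.Icc 0 (1/2)) := by
    apply monotoneOn_of_deriv_nonneg (convex_Icc _ _) hc
    · intro x hx
      rw [interior_Icc] at hx
      exact (hd x hx.1 hx.2).differentiableAt.differentiableWithinAt
    · intro x hx
      rw [interior_Icc] at hx
      rw [(hd x hx.1 hx.2).deriv]
      exact hp x hx.1 hx.2
  exact this ⟨le_rfl, by norm_num⟩ ⟨h0, h1⟩ h0

/-- Key pointwise bound for a concentrating solution. -/
lemma bubble_bound {lam α : ℝ} (h1 : 4 < lam) {v : ℝ → ℝ} (hv : Continuous v)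
    (hα : 2 < lam * exp α)
    (H : ∀ t, 0 ≤ t → t ≤ 1/2 → v t = α + kop (1/2) (fun s => lam * (1 - exp (v s))) t)
    {t : ℝ} (h0 : 0 ≤ t) (ht : t ≤ 1/2) :
    exp (v t) * (1 + (lam * exp α / 2 - 1) * t) ^ 2 ≤ exp α * exp (2 * (lam - 2) * t) := by
  have h01 : (0:ℝ) ≤ 1/2 := by norm_num
  set g : ℝ → ℝ := fun s => lam * exp (v s) with hg
  have hgc : Continuous g := by fun_prop
  have hgp : ∀ s, 0 < g s := fun s => by simp only [hg]; have := exp_pos (v s); nlinarith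
  set a : ℝ → ℝ := av g with ha
  have hac : Continuous a := av_cont hgc
  have hfav : ∀ t, av (fun s => lam * (1 - exp (v s))) t = lam - a t := by
    intro t
    have := av_sub (g := fun _ => lam) (h := g) continuous_const hgc t
    rw [av_const] at this
    rw [← this]
    congr 1; ext s; simp only [hg]; ring
  have hvd : ∀ t, 0 < t → t < 1/2 → HasDerivAt v ((lam - a t) / (1 - t)) t := by
    intro t h0 ht
    have h2 := (kop_hasDerivAt (T := 1/2) (by norm_num)
      (g := fun s => lam * (1 - exp (v s))) (by fun_prop) t).const_add α
    rw [hfav, max_eq_left (by linarith)] at h2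
    refine h2.congr_of_eventuallyEq ?_
    filter_upwards [Ioo_mem_nhds h0 ht] with s hs using H s hs.1.le hs.2.le
  -- A
  set A : ℝ → ℝ := fun t => ∫ s in (0:ℝ)..t, g s with hA
  have hAa : ∀ t, t * a t = A t := fun t => mul_av g t
  have hAd : ∀ t, HasDerivAt A (g t) t := fun t =>
    intervalIntegral.integral_hasDerivAt_right (hgc.intervalIntegrable _ _)
      hgc.stronglyMeasurable.stronglyMeasurableAtFilter hgc.continuousAt
  have hAc : Continuous A := continuous_iff_continuousAt.2 fun t => (hAd t).continuousAt
  have hA0 : A 0 = 0 := by simp [hA]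
  have hgd : ∀ t, 0 < t → t < 1/2 → HasDerivAt g (g t * ((lam - a t) / (1 - t))) t := by
    intro t h0 ht
    have := ((hvd t h0 ht).exp).const_mul lam
    refine this.congr_deriv ?_
    simp only [hg]; ring
  have hapos : ∀ t, 0 ≤ t → 0 < a t := by
    intro t ht
    rcases ht.eq_or_lt with rfl | ht
    · rw [ha, av_zero]; exact hgp 0
    · have : 0 < A t := intervalIntegral.intervalIntegral_pos_of_pos (hgc.intervalIntegrable _ _) hgp ht
      rw [← hAa] at this
      exact (mul_pos_iff_of_pos_left ht).1 this
  -- logistic inequality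
  have hlog : ∀ t, 0 ≤ t → t ≤ 1/2 → 0 ≤ t * (1 - t) * g t - A t + A t ^ 2 / 2 := by
    intro t h0 ht
    have := mono_half (F := fun t => t * (1 - t) * g t - A t + A t ^ 2 / 2)
      (F' := fun t => g t * (lam - 2) * t) (by fun_prop) ?_ ?_ h0 ht
    · simpa [hA0] using this
    · intro t h0 ht
      have e1 : HasDerivAt (fun t : ℝ => t * (1 - t)) (1 * (1 - t) + t * (-1)) t :=
        (hasDerivAt_id t).mul ((hasDerivAt_id t).const_sub 1)
      have e2 := ((e1.mul (hgd t h0 ht)).sub (hAd t)).add (((hAd t).pow 2).div_const 2)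
      refine e2.congr_deriv ?_
      rw [← hAa]
      have : 1 - t ≠ 0 := by linarith
      push_cast
      field_simp
      ring
    · intro t h0 ht
      have := hgp t
      have : 0 < lam - 2 := by linarith
      positivity
  set c := lam * exp α / 2 with hc
  have hc1 : 1 < c := by rw [hc]; linarith
  have hv0 : v 0 = α := by rw [H 0 le_rfl h01, kop_zero, add_zero]
  have ha0 : a 0 = 2 * c := by rw [ha, av_zero, hg, hc]; simp only; rw [hv0]; ring
  -- lower bound for the average
  have hlow : ∀ t, 0 ≤ t → t ≤ 1/2 → 2 * c ≤ a t * (1 + (c - 1) * t) := by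
    intro t h0 ht
    have := mono_half (F := fun t => - ((1 / a t - t / 2) / (1 - t)))
      (F' := fun t => (t * (1 - t) * g t - A t + A t ^ 2 / 2) / (A t ^ 2 * (1 - t) ^ 2)) ?_ ?_ ?_ h0 ht
    · simp only [ha0] at this
      have hp := hapos t h0
      have h1t : 0 < 1 - t := by linarith
      have h5 : (1 / a t - t / 2) / (1 - t) ≤ 1 / (2 * c) := by
        have : -((1 / (2 * c) - 0 / 2) / (1 - 0)) = -(1 / (2 * c)) := by ring
        linarith
      rw [div_le_iff₀ h1t, sub_le_iff_le_add, div_le_iff₀ hp] at h5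
      have h6 : 2 * c * 1 ≤ 2 * c * ((1 / (2 * c) * (1 - t) + t / 2) * a t) :=
        mul_le_mul_of_nonneg_left h5 (by linarith)
      have h7 : 2 * c * ((1 / (2 * c) * (1 - t) + t / 2) * a t) = a t * (1 + (c - 1) * t) := by
        field_simp; ring
      linarith
    · apply ContinuousOn.neg
      apply ContinuousOn.div _ (by fun_prop) (fun s hs => by linarith [hs.2])
      apply ContinuousOn.sub _ (by fun_prop)
      exact continuousOn_const.div hac.continuousOn (fun s hs => (hapos s hs.1).ne')
    · intro t h0 ht
      have hAp : 0 < A t := by rw [← hAa]; exact mul_pos h0 (hapos t h0.le)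
      have h1t : 1 - t ≠ 0 := by linarith
      have e1 : HasDerivAt (fun t : ℝ => - ((t / A t - t / 2) / (1 - t)))
        (-((((1 * A t - t * g t) / A t ^ 2 - 1 / 2) * (1 - t) - (t / A t - t / 2) * (-1)) / (1 - t) ^ 2)) t :=
        ((((hasDerivAt_id t).div (hAd t) hAp.ne').sub ((hasDerivAt_id t).div_const 2)).div
          ((hasDerivAt_id t).const_sub 1) h1t).neg
      have e2 := e1.congr_of_eventuallyEq (f₁ := fun t => - ((1 / a t - t / 2) / (1 - t))) ?_
      · refine e2.congr_deriv ?_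
        have := hAp.ne'
        field_simp
        ring
      · filter_upwards [lt_mem_nhds h0] with s hs
        rw [← hAa]
        have := hapos s hs.le
        have : s / (s * a s) = 1 / a s := by field_simp
        rw [this]
    · intro t h0 ht
      have := hlog t h0.le ht.le
      positivity
  -- comparison
  have hfin := mono_half (F := fun t => α + 2 * (lam - 2) * t - 2 * log (1 + (c - 1) * t) - v t)
    (F' := fun t => 2 * (lam - 2) - 2 * ((c - 1) / (1 + (c - 1) * t)) - (lam - a t) / (1 - t))
    ?_ ?_ ?_ h0 ht
  · simp only [hv0, mul_zero, add_zero, log_one, sub_zero, sub_self] at hfin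
    have hp : 0 < 1 + (c - 1) * t := by nlinarith
    have e : exp (v t) ≤ exp (α + 2 * (lam - 2) * t - 2 * log (1 + (c - 1) * t)) :=
      exp_le_exp.2 (by linarith)
    have e3 : exp (2 * log (1 + (c - 1) * t)) = (1 + (c - 1) * t) ^ 2 := by
      rw [two_mul, exp_add, exp_log hp]; ring
    rw [exp_sub, exp_add, e3, le_div_iff₀ (by positivity)] at e
    exact e
  · refine ContinuousOn.sub (ContinuousOn.sub (by fun_prop) ?_) hv.continuousOn
    apply ContinuousOn.mul continuousOn_const
    apply ContinuousOn.log (by fun_prop)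
    intro s hs
    have : 0 < 1 + (c - 1) * s := by nlinarith [hs.1]
    exact this.ne'
  · intro t h0 ht
    have hp : 0 < 1 + (c - 1) * t := by nlinarith
    have e1 : HasDerivAt (fun t : ℝ => 1 + (c - 1) * t) ((c - 1) * 1) t :=
      ((hasDerivAt_id t).const_mul (c - 1)).const_add 1
    have e2 := (((((hasDerivAt_id t).const_mul (2 * (lam - 2))).const_add α).sub
      ((e1.log hp.ne').const_mul 2)).sub (hvd t h0 ht))
    refine e2.congr_deriv ?_
    simp
  · intro t h0 ht
    have hp : 0 < 1 + (c - 1) * t := by nlinarith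
    have h1t : 0 < 1 - t := by linarith
    have hl := hlow t h0.le ht.le
    have h5 : 2 * c / (1 + (c - 1) * t) ≤ a t := by
      rw [div_le_iff₀ hp]; exact hl
    have h6 : (lam - a t) / (1 - t) ≤ (lam - 2 * c / (1 + (c - 1) * t)) / (1 - t) := by
      gcongr
    have h7 : (lam - 2 * c / (1 + (c - 1) * t)) / (1 - t) =
        (lam - 2) / (1 - t) - 2 * ((c - 1) / (1 + (c - 1) * t)) := by
      field_simp; ring
    have h8 : (lam - 2) / (1 - t) ≤ 2 * (lam - 2) := by
      rw [div_le_iff₀ h1t]; nlinarith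
    linarith

lemma large_aux {x N : ℝ} (hx0 : 0 < x) (hx1 : x < 1) (hN : 0 < N) :
    2 * (1 + x ^ 2) * (1 + 2 * N * x) ≤ 2 * (1 + (1 + 4 * N) * x) := by
  have e7 : x ^ 2 ≤ x := by nlinarith
  have e9 : 0 ≤ (N * x) * (1 - x ^ 2) := mul_nonneg (by positivity) (by linarith)
  have : 2 * (1 + (1 + 4 * N) * x) - 2 * (1 + x ^ 2) * (1 + 2 * N * x) =
    2 * (x - x ^ 2) + 4 * ((N * x) * (1 - x ^ 2)) := by ring
  linarith


set_option maxHeartbeats 1600000 in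
/-- For suitable large initial height the first integral condition has positive sign. -/
lemma exists_large {lam : ℝ} (h1 : 4 < lam) (h2 : lam ≤ 8) :
    ∃ α : ℝ, 0 < α ∧ ∀ v : ℝ → ℝ, Continuous v →
      (∀ t, 0 ≤ t → t ≤ 1/2 → v t = α + kop (1/2) (fun s => lam * (1 - exp (v s))) t) →
      0 < ∫ s in (0:ℝ)..(1/2), lam * (1 - exp (v s)) := by
  have h01 : (0:ℝ) ≤ 1/2 := by norm_num
  set μ := 2 * (lam - 2) with hμ
  have hμ0 : 0 < μ := by rw [hμ]; linarith
  set N := μ * exp μ with hN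
  have hN0 : 0 < N := by positivity
  set β := 2 + 4 * (1 + 4 * N) / (lam - 4) with hβ
  have hl4 : 0 < lam - 4 := by linarith
  have hβ2 : 2 < β := by
    have : 0 < 4 * (1 + 4 * N) / (lam - 4) := by positivity
    linarith
  set b := β ^ 2 with hb
  have hb4 : 4 < b := by rw [hb]; nlinarith
  set c := b + 1 with hc
  set α := log (2 * c / lam) with hα
  have hcl : 1 < 2 * c / lam := by rw [lt_div_iff₀ (by linarith)]; linarith
  have hea : lam * exp α = 2 * c := by
    rw [hα, exp_log (by linarith)]; field_simp
  refine ⟨α, log_pos hcl, fun v hv H => ?_⟩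
  set g : ℝ → ℝ := fun s => lam * exp (v s) with hg
  have hgc : Continuous g := by fun_prop
  set A : ℝ → ℝ := fun t => ∫ s in (0:ℝ)..t, g s with hA
  have hAd : ∀ t, HasDerivAt A (g t) t := fun t =>
    intervalIntegral.integral_hasDerivAt_right (hgc.intervalIntegrable _ _)
      hgc.stronglyMeasurable.stronglyMeasurableAtFilter hgc.continuousAt
  have hAc : Continuous A := continuous_iff_continuousAt.2 fun t => (hAd t).continuousAt
  have hA0 : A 0 = 0 := by simp [hA]
  have hgle : ∀ t, 0 ≤ t → t ≤ 1/2 → g t ≤ 2 * c * (1 + N * t) / (1 + b * t) ^ 2 := by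
    intro t h0 ht
    have e := bubble_bound h1 hv (by rw [hea]; linarith) H h0 ht
    have e0 : lam * exp α / 2 - 1 = b := by rw [hea, hc]; ring
    rw [e0, ← hμ] at e
    have hp : 0 < 1 + b * t := by nlinarith
    rw [le_div_iff₀ (by positivity)]
    have e2 : exp (μ * t) ≤ 1 + N * t := by
      have e3 : 1 - μ * t ≤ exp (-(μ * t)) := by
        have := add_one_le_exp (-(μ * t)); linarith
      have e4 : (1 - μ * t) * exp (μ * t) ≤ 1 := by
        calc _ ≤ exp (-(μ * t)) * exp (μ * t) := by gcongr
          _ = 1 := by rw [← exp_add]; simp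
      have e5 : exp (μ * t) ≤ exp μ := exp_le_exp.2 (by nlinarith)
      have e6 : μ * t * exp (μ * t) ≤ μ * t * exp μ := by gcongr
      rw [hN]; nlinarith
    calc g t * (1 + b * t) ^ 2 = lam * (exp (v t) * (1 + b * t) ^ 2) := by simp only [hg]; ring
      _ ≤ lam * (exp α * exp (μ * t)) := by
        apply mul_le_mul_of_nonneg_left e; linarith
      _ = (2 * c) * exp (μ * t) := by rw [← hea]; ring
      _ ≤ _ := by apply mul_le_mul_of_nonneg_left e2; linarith
  have hfin := mono_half (F := fun t => 2 * c * (t / (1 + b * t) + N / b ^ 2 *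
      (log (1 + b * t) + 1 / (1 + b * t))) - A t)
    (F' := fun t => 2 * c * (1 + N * t) / (1 + b * t) ^ 2 - g t) ?_ ?_ ?_ h01 le_rfl
  · simp only [hA0, mul_zero, zero_div, add_zero, log_one, div_one, sub_zero, zero_add] at hfin
    have hAl : A (1/2) < lam / 2 := by
      have e1 : 1 / 2 / (1 + b * (1/2)) ≤ 1 / b := by
        rw [div_le_div_iff₀ (by linarith) (by linarith)]; linarith
      have e2 : 1 / (1 + b * (1/2)) ≤ 1 := by
        rw [div_le_one (by linarith)]; linarith
      have e3 : log (1 + b * (1/2)) ≤ 2 * β := by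
        have : log (1 + b * (1/2)) ≤ log (β ^ 2) := by
          apply log_le_log (by linarith); rw [← hb]; linarith
        rw [log_pow] at this
        have h3 := log_le_sub_one_of_pos (show 0 < β by linarith)
        push_cast at this
        linarith
      have e4 : A (1/2) ≤ 2 * c * (1 / b + N / b ^ 2 * (2 * β)) := by
        have : 2 * c * (1 / 2 / (1 + b * (1/2)) + N / b ^ 2 *
          (log (1 + b * (1/2)) + 1 / (1 + b * (1/2)))) ≤ 2 * c * (1 / b + N / b ^ 2 * (2 * β + 1)) := by
          gcongr
        have h5 : 2 * c * (1 / b + N / b ^ 2 * (2 * β + 1)) =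
          2 * c * (1 / b + N / b ^ 2 * (2 * β)) + 2 * c * (N / b ^ 2 * 1) := by ring
        linarith
      set x := 1 / β with hx
      have hx0 : 0 < x := by positivity
      have hx1 : x < 1 := by rw [hx, div_lt_one (by linarith)]; linarith
      have e5 : 2 * c * (1 / b + N / b ^ 2 * (2 * β)) = 2 * (1 + x ^ 2) * (1 + 2 * N * x) := by
        rw [hc, hb, hx]; field_simp
      have e6 : 4 * (1 + 4 * N) * x < lam - 4 := by
        have : 4 * (1 + 4 * N) < (lam - 4) * β := by
          have : (lam - 4) * β = (lam - 4) * 2 + 4 * (1 + 4 * N) := by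
            rw [hβ]; field_simp
          linarith
        rw [hx, mul_one_div, div_lt_iff₀ (by linarith)]; exact this
      have e7 : x ^ 2 ≤ x := by nlinarith
      have e8 := large_aux hx0 hx1 hN0
      linarith
    have : ∫ s in (0:ℝ)..(1/2), lam * (1 - exp (v s)) = lam / 2 - A (1/2) := by
      have e : ∀ s, lam * (1 - exp (v s)) = lam - g s := fun s => by simp only [hg]; ring
      simp only [e]
      rw [intervalIntegral.integral_sub (by simp) (hgc.intervalIntegrable _ _)]
      simp; ring
    rw [this]; linarith
  · refine ContinuousOn.sub ?_ hAc.continuousOn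
    have hne : ∀ s ∈ Set.Icc (0:ℝ) (1/2), 1 + b * s ≠ 0 := by
      intro s hs
      have : 0 < 1 + b * s := by nlinarith [hs.1]
      exact this.ne'
    apply ContinuousOn.mul continuousOn_const
    apply ContinuousOn.add
    · exact ContinuousOn.div (by fun_prop) (by fun_prop) hne
    · apply ContinuousOn.mul continuousOn_const
      apply ContinuousOn.add
      · exact ContinuousOn.log (by fun_prop) hne
      · exact ContinuousOn.div (by fun_prop) (by fun_prop) hne
  · intro t h0 ht
    have hp : 0 < 1 + b * t := by nlinarith
    have e1 : HasDerivAt (fun t : ℝ => 1 + b * t) (b * 1) t :=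
      ((hasDerivAt_id t).const_mul b).const_add 1
    have e2 := ((((hasDerivAt_id t).div e1 hp.ne').add (((e1.log hp.ne').add
      ((hasDerivAt_const t (1:ℝ)).div e1 hp.ne')).const_mul (N / b ^ 2))).const_mul (2 * c)).sub (hAd t)
    refine e2.congr_deriv ?_
    simp only [id]
    have : b ≠ 0 := by linarith
    field_simp
    ring
  · intro t h0 ht
    have := hgle t h0.le ht.le
    linarith
lemma kop_abs_le {g : ℝ → ℝ} (hg : Continuous g) {e t : ℝ} (he : 0 ≤ e) (ht : 0 ≤ t) (ht' : t ≤ 1/2)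
    (H : ∀ s, 0 ≤ s → s ≤ 1/2 → |g s| ≤ e) : |kop (1/2) g t| ≤ e := by
  have h1 := kop_le hg he ht (fun s h0 h1 => (le_abs_self _).trans (H s h0 (h1.trans ht')))
  have h2 := kop_le (g := fun s => (-1) * g s) (by fun_prop) he ht
    (fun s h0 h1 => by
      have := (neg_le_abs _).trans (H s h0 (h1.trans ht'))
      linarith)
  rw [kop_mul_const] at h2
  have : 2 * e * t ≤ e := by nlinarith
  rw [abs_le]; constructor <;> linarith

lemma exp_trunc_lip {lam M : ℝ} (hl : 0 < lam) (x y : ℝ) :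
    |lam * (1 - exp (min x M)) - lam * (1 - exp (min y M))| ≤ lam * exp M * |x - y| := by
  have key : ∀ a b : ℝ, a ≤ b → exp (min b M) - exp (min a M) ≤ exp M * (b - a) := by
    intro a b hab
    have h0 : min b M - min a M ≤ b - a := by
      rcases le_total b M with h | h <;> rcases le_total a M with h' | h' <;> simp [h, h'] <;> linarith
    have h1 : min a M ≤ min b M := min_le_min_right _ hab
    have h2 := add_one_le_exp (min a M - min b M)
    have h3 : exp (min a M) = exp (min b M) * exp (min a M - min b M) := by
      rw [← exp_add]; congr 1; ring
    have h4 : exp (min b M) ≤ exp M := exp_le_exp.2 (min_le_right _ _)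
    have h5 := exp_pos (min b M)
    have h6 : exp (min b M) * (min a M - min b M + 1) ≤ exp (min a M) := by
      rw [h3]; gcongr
    have h7 : exp (min b M) * (min b M - min a M) ≤ exp M * (b - a) := by
      apply mul_le_mul h4 h0 (by linarith) (exp_pos _).le
    linarith
  have mono : ∀ a b : ℝ, a ≤ b → 0 ≤ exp (min b M) - exp (min a M) := by
    intro a b hab
    have := exp_le_exp.2 (min_le_min_right M hab)
    linarith
  rw [show lam * (1 - exp (min x M)) - lam * (1 - exp (min y M)) =
    lam * (exp (min y M) - exp (min x M)) by ring, abs_mul, abs_of_pos hl, mul_assoc]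
  apply mul_le_mul_of_nonneg_left _ hl.le
  rcases le_total x y with h | h
  · rw [abs_of_nonneg (mono _ _ h), abs_sub_comm, abs_of_nonneg (by linarith : 0 ≤ y - x)]
    exact key _ _ h
  · rw [abs_sub_comm, abs_of_nonneg (mono _ _ h), abs_of_nonneg (by linarith : 0 ≤ x - y)]
    exact key _ _ h

lemma exp_quad {x : ℝ} (h : |x| ≤ 1) : |exp x - 1 - x| ≤ x ^ 2 :=
  Real.abs_exp_sub_one_sub_id_le h

lemma half_int_abs {g : ℝ → ℝ} {e : ℝ}
    (H : ∀ s, 0 ≤ s → s ≤ 1/2 → |g s| ≤ e) : |∫ s in (0:ℝ)..(1/2), g s| ≤ e / 2 := by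
  have := intervalIntegral.norm_integral_le_of_norm_le_const (a := 0) (b := 1/2) (C := e)
    (f := g) ?_
  · rw [Real.norm_eq_abs] at this
    refine this.trans (le_of_eq ?_)
    rw [abs_of_pos (by norm_num)]; ring
  · intro s hs
    rw [Set.uIoc_of_le (by norm_num)] at hs
    exact H s hs.1.le hs.2

set_option maxHeartbeats 1600000 in
lemma exists_shoot {lam : ℝ} (h1 : 4 < lam) (h2 : lam ≤ 8) (h3 : lam ≠ 6) :
    ∃ (α : ℝ) (v : ℝ → ℝ), α ≠ 0 ∧ Continuous v ∧
      (∀ t, 0 ≤ t → t ≤ 1/2 → v t = α + kop (1/2) (fun s => lam * (1 - exp (v s))) t) ∧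
      ∫ s in (0:ℝ)..(1/2), lam * (1 - exp (v s)) = 0 := by
  obtain ⟨A, hA, hAl⟩ := exists_large h1 h2
  obtain ⟨y, hyc, hy, hyi⟩ := exists_legendre h1 h2 h3
  have hl : 0 < lam := by linarith
  set M := A + lam with hM
  set f : ℝ → ℝ := fun x => lam * (1 - exp (min x M)) with hf
  have hfc : Continuous f := by rw [hf]; fun_prop
  have hfle : ∀ x, f x ≤ lam := fun x => by
    have := exp_pos (min x M)
    simp only [hf]; nlinarith
  have hL : 0 < lam * exp M := by positivity
  have hfL : ∀ x y, |f x - f y| ≤ lam * exp M * |x - y| := fun x y => exp_trunc_lip hl x y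
  obtain ⟨v, C, hC, hvc, hv, hst⟩ := exists_flow hL hfL
  have hub : ∀ α t, 0 ≤ t → t ≤ 1/2 → v α t ≤ α + lam := by
    intro α t h0 ht
    rw [hv α t h0 ht]
    have := kop_le (g := fun s => f (v α s)) (hfc.comp (hvc α)) hl.le h0 (fun s _ _ => hfle _)
    nlinarith
  have hft : ∀ α, α ≤ A → ∀ t, 0 ≤ t → t ≤ 1/2 → f (v α t) = lam * (1 - exp (v α t)) := by
    intro α hα t h0 ht
    simp only [hf]
    rw [min_eq_left (by have := hub α t h0 ht; linarith)]
  have hv' : ∀ α, α ≤ A → ∀ t, 0 ≤ t → t ≤ 1/2 →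
      v α t = α + kop (1/2) (fun s => lam * (1 - exp (v α s))) t := by
    intro α hα t h0 ht
    rw [hv α t h0 ht]
    congr 1
    apply kop_congr h0
    intro s hs0 hs
    exact hft α hα s hs0 (hs.trans ht)
  set F : ℝ → ℝ := fun α => ∫ s in (0:ℝ)..(1/2), f (v α s) with hF
  have hFi : ∀ α, α ≤ A → F α = ∫ s in (0:ℝ)..(1/2), lam * (1 - exp (v α s)) := by
    intro α hα
    apply intervalIntegral.integral_congr
    intro s hs
    rw [Set.uIcc_of_le (by norm_num)] at hs
    exact hft α hα s hs.1 hs.2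
  by_contra hcon
  have hne : ∀ α, α ≤ A → α ≠ 0 → F α ≠ 0 := by
    intro α hα h0 hF0
    exact hcon ⟨α, v α, h0, hvc α, hv' α hα, by rw [← hFi α hα]; exact hF0⟩
  have hFint : ∀ α, IntervalIntegrable (fun s => f (v α s)) volume 0 (1/2) := fun α =>
    (hfc.comp (hvc α)).intervalIntegrable _ _
  have hFc : Continuous F := by
    have hlip : ∀ α β, |F α - F β| ≤ lam * exp M * C * |α - β| := by
      intro α β
      have hs := hst β (v α) |α - β| (hvc α) (by
        intro t h0 ht
        rw [hv α t h0 ht]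
        have : ∀ k : ℝ, α + k - (β + k) = α - β := fun k => by ring
        rw [← hv α t h0 ht]
        have h5 := hv α t h0 ht
        have : v α t - (β + kop (1/2) (fun s => f (v α s)) t) = α - β := by linarith
        rw [this])
      simp only [hF]
      rw [← intervalIntegral.integral_sub (hFint α) (hFint β)]
      have := half_int_abs (g := fun s => f (v α s) - f (v β s)) (e := lam * exp M * (C * |α - β|)) (by
        intro s h0 h1
        exact (hfL _ _).trans (mul_le_mul_of_nonneg_left (hs s h0 h1) hL.le))
      have h9 : 0 ≤ lam * exp M * (C * |α - β|) := by positivity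
      linarith
    have : LipschitzWith (Real.toNNReal (lam * exp M * C)) F := by
      apply LipschitzWith.of_dist_le_mul
      intro a b
      rw [Real.dist_eq, Real.dist_eq, Real.coe_toNNReal _ (by positivity)]
      exact hlip a b
    exact this.continuous
  have hFA : 0 < F A := by rw [hFi A le_rfl]; exact hAl (v A) (hvc A) (hv' A le_rfl)
  have hFB : 0 < F (-(lam + 1)) := by
    simp only [hF]
    apply intervalIntegral.intervalIntegral_pos_of_pos_on (hFint _) _ (by norm_num)
    intro s hs
    have := hub (-(lam+1)) s hs.1.le hs.2.le
    simp only [hf]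
    have h5 : exp (min (v (-(lam + 1)) s) M) < 1 := by
      rw [exp_lt_one_iff]
      exact lt_of_le_of_lt (min_le_left _ _) (by linarith)
    nlinarith
  have hpos1 : ∀ α, 0 < α → α ≤ A → 0 < F α := by
    intro α h0 hα
    by_contra hn
    push Not at hn
    obtain ⟨β, hβ, hβ0⟩ := intermediate_value_Icc hα hFc.continuousOn ⟨hn, hFA.le⟩
    exact hne β hβ.2 (by linarith [hβ.1]) hβ0
  have hpos2 : ∀ α, α < 0 → -(lam + 1) ≤ α → 0 < F α := by
    intro α h0 hα
    by_contra hn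
    push Not at hn
    obtain ⟨β, hβ, hβ0⟩ := intermediate_value_Icc' hα hFc.continuousOn ⟨hn, hFB.le⟩
    exact hne β (by linarith [hβ.2]) (by linarith [hβ.2]) hβ0
  -- linearization
  obtain ⟨Y, hY1, hY⟩ : ∃ Y, 1 ≤ Y ∧ ∀ s, 0 ≤ s → s ≤ 1/2 → |y s| ≤ Y := by
    obtain ⟨Y, hY⟩ := isCompact_Icc.exists_bound_of_continuousOn (s := Set.Icc (0:ℝ) (1/2)) hyc.continuousOn
    exact ⟨max Y 1, le_max_right _ _, fun s h0 h1 => (hY s ⟨h0, h1⟩).trans (le_max_left _ _)⟩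
  set I := ∫ s in (0:ℝ)..(1/2), y s with hI
  set K := lam * Y ^ 2 with hK
  have hlin : ∀ α, |α| ≤ 1 / Y → |F α + lam * α * I| ≤ (lam * exp M * C + 1) * K * α ^ 2 := by
    intro α hα
    have hay : ∀ s, 0 ≤ s → s ≤ 1/2 → |α * y s| ≤ 1 := by
      intro s h0 h1
      rw [abs_mul]
      calc |α| * |y s| ≤ 1 / Y * Y := mul_le_mul hα (hY s h0 h1) (abs_nonneg _) (by positivity)
        _ = 1 := by field_simp
    have hq : ∀ s, 0 ≤ s → s ≤ 1/2 → |f (α * y s) + lam * (α * y s)| ≤ K * α ^ 2 := by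
      intro s h0 h1
      have h5 := hay s h0 h1
      have h6 : f (α * y s) = lam * (1 - exp (α * y s)) := by
        simp only [hf]
        rw [min_eq_left]
        have := (abs_le.1 h5).2
        linarith
      rw [h6, show lam * (1 - exp (α * y s)) + lam * (α * y s) = -(lam * (exp (α * y s) - 1 - α * y s)) by ring,
        abs_neg, abs_mul, abs_of_pos hl, hK, mul_assoc]
      apply mul_le_mul_of_nonneg_left _ hl.le
      refine (exp_quad h5).trans ?_
      rw [mul_pow, mul_comm]
      apply mul_le_mul_of_nonneg_right _ (sq_nonneg _)
      rw [← sq_abs]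
      exact pow_le_pow_left₀ (abs_nonneg _) (hY s h0 h1) 2
    have hKn : 0 ≤ K * α ^ 2 := by positivity
    have hcc : Continuous (fun s => f (α * y s)) := hfc.comp (by fun_prop)
    have hs := hst α (fun s => α * y s) (K * α ^ 2) (by fun_prop) (by
      intro t h0 ht
      have h7 := kop_abs_le (g := fun s => f (α * y s) - (-(lam * α)) * y s) (by fun_prop) hKn h0 ht (by
        intro s h0 h1
        have := hq s h0 h1
        rwa [show f (α * y s) - (-(lam * α)) * y s = f (α * y s) + lam * (α * y s) by ring])
      rw [kop_sub (by norm_num) hcc (by fun_prop), kop_mul_const (g := y)] at h7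
      have h8 : α * y t = α - lam * α * kop (1/2) y t := by
        conv_lhs => rw [hy t h0 ht]
        ring
      rw [h8, abs_sub_comm]
      convert h7 using 2
      ring)
    have e1 : |F α - ∫ s in (0:ℝ)..(1/2), f (α * y s)| ≤ lam * exp M * (C * (K * α ^ 2)) / 2 := by
      simp only [hF]
      rw [← intervalIntegral.integral_sub (hFint α) (hcc.intervalIntegrable _ _)]
      apply half_int_abs
      intro s h0 h1
      rw [abs_sub_comm]
      exact (hfL _ _).trans (mul_le_mul_of_nonneg_left (hs s h0 h1) hL.le)
    have e2 : |(∫ s in (0:ℝ)..(1/2), f (α * y s)) + lam * α * I| ≤ K * α ^ 2 / 2 := by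
      rw [hI, ← intervalIntegral.integral_const_mul, ← intervalIntegral.integral_add
        (hcc.intervalIntegrable _ _) (Continuous.intervalIntegrable (by fun_prop) _ _)]
      apply half_int_abs
      intro s h0 h1
      have := hq s h0 h1
      rwa [mul_assoc]
    have e3 := abs_add_le (F α - ∫ s in (0:ℝ)..(1/2), f (α * y s))
      ((∫ s in (0:ℝ)..(1/2), f (α * y s)) + lam * α * I)
    rw [← add_assoc, sub_add_cancel] at e3
    have e4 : 0 ≤ lam * exp M * (C * (K * α ^ 2)) := by positivity
    have e5 : (lam * exp M * C + 1) * K * α ^ 2 = lam * exp M * (C * (K * α ^ 2)) + K * α ^ 2 := by ring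
    linarith
  set Q := (lam * exp M * C + 1) * K with hQ
  have hQp : 0 < Q := by positivity
  have hIp : 0 < |I| := abs_pos.2 hyi
  set d := min (min (1 / Y) A) (min (lam * |I| / (2 * Q)) 1) with hd
  have hd0 : 0 < d := by positivity
  have hdY : d ≤ 1 / Y := (min_le_left _ _).trans (min_le_left _ _)
  have hdA : d ≤ A := (min_le_left _ _).trans (min_le_right _ _)
  have hdQ : d ≤ lam * |I| / (2 * Q) := (min_le_right _ _).trans (min_le_left _ _)
  have hd1 : d ≤ 1 := (min_le_right _ _).trans (min_le_right _ _)
  rw [le_div_iff₀ (by positivity)] at hdQ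
  have hfin : Q * d ^ 2 < lam * d * |I| := by nlinarith [mul_pos (mul_pos hl hIp) hd0]
  rcases lt_or_gt_of_ne hyi with hneg | hpos
  · have := hlin (-d) (by rw [abs_neg, abs_of_pos hd0]; exact hdY)
    have h5 := hpos2 (-d) (by linarith) (by linarith)
    rw [abs_of_neg hneg] at hfin
    have h6 := (abs_le.1 this).2
    nlinarith
  · have := hlin d (by rw [abs_of_pos hd0]; exact hdY)
    have h5 := hpos1 d hd0 hdA
    rw [abs_of_pos hpos] at hfin
    have h6 := (abs_le.1 this).2
    nlinarith
/-- Reflection of the half-interval solution. -/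
lemma reflect {lam α : ℝ} {v : ℝ → ℝ} (hvc : Continuous v)
    (hv : ∀ t, 0 ≤ t → t ≤ 1/2 → v t = α + kop (1/2) (fun s => lam * (1 - exp (v s))) t)
    (hint : ∫ s in (0:ℝ)..(1/2), lam * (1 - exp (v s)) = 0) :
    ∃ V : ℝ → ℝ, Continuous V ∧ (∀ t, V (1 - t) = V t) ∧
      ∀ T t, T < 1 → 0 ≤ t → t ≤ T → V t = α + kop T (fun s => lam * (1 - exp (V s))) t := by
  refine ⟨fun t => v (min t (1 - t)), by fun_prop, fun t => ?_, ?_⟩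
  · simp only [sub_sub_cancel, min_comm]
  set V : ℝ → ℝ := fun t => v (min t (1 - t)) with hV
  have hVc : Continuous V := by rw [hV]; fun_prop
  have hVs : ∀ t, V (1 - t) = V t := fun t => by simp only [hV, sub_sub_cancel, min_comm]
  have hVv : ∀ t, t ≤ 1/2 → V t = v t := fun t ht => by
    simp only [hV]; rw [min_eq_left (by linarith)]
  set g : ℝ → ℝ := fun s => lam * (1 - exp (V s)) with hg
  have hgc : Continuous g := by rw [hg]; fun_prop
  have hgs : ∀ t, g (1 - t) = g t := fun t => by simp only [hg, hVs]
  have hgi : ∀ a b, IntervalIntegrable g volume a b := fun a b => hgc.intervalIntegrable _ _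
  have hhalf : ∀ T t, 0 ≤ t → t ≤ T → t ≤ 1/2 → V t = α + kop T g t := by
    intro T t h0 hT ht
    rw [hVv t ht, hv t h0 ht, kop_T_congr h0 hT ht]
    congr 1
    apply kop_congr h0
    intro s hs0 hs
    simp only [hg]
    rw [hVv s (hs.trans ht)]
  intro T t hT h0 ht
  rcases le_or_gt t (1/2) with h | h
  · exact hhalf T t h0 ht h
  have hI : ∫ s in (0:ℝ)..(1/2), g s = 0 := by
    refine Eq.trans ?_ hint
    apply intervalIntegral.integral_congr
    intro s hs
    rw [Set.uIcc_of_le (by norm_num)] at hs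
    simp only [hg]
    rw [hVv s hs.2]
  have hrefl : ∀ a b, ∫ s in a..b, g s = ∫ s in (1 - b)..(1 - a), g s := by
    intro a b
    rw [← intervalIntegral.integral_comp_sub_left]
    simp only [hgs]
  have hI1 : ∫ s in (0:ℝ)..1, g s = 0 := by
    rw [← intervalIntegral.integral_add_adjacent_intervals (hgi 0 (1/2)) (hgi (1/2) 1), hI,
      hrefl (1/2) 1]
    norm_num
    norm_num at hI
    exact hI
  have hm : ∀ s, (1 - s) * av g (1 - s) = - (s * av g s) := by
    intro s
    rw [mul_av, mul_av]
    have e1 := hrefl 0 (1 - s)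
    rw [sub_sub_cancel, sub_zero] at e1
    have e2 := intervalIntegral.integral_add_adjacent_intervals (hgi 0 s) (hgi s 1)
    rw [hI1] at e2
    linarith
  set k : ℝ → ℝ := fun s => av g s / max (1 - s) (1 - T) with hk
  have hkc : Continuous k := kop_integrand_cont hT hgc
  have hks : ∀ s, 1 - t ≤ s → s ≤ t → k (1 - s) = - k s := by
    intro s hs1 hs2
    simp only [hk]
    rw [max_eq_left (by linarith), max_eq_left (by linarith), sub_sub_cancel]
    have := hm s
    have a1 : s ≠ 0 := by linarith
    have a2 : 1 - s ≠ 0 := by linarith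
    field_simp
    linarith
  have hz : ∫ s in (1 - t)..t, k s = 0 := by
    have e1 : ∫ s in (1 - t)..t, k (1 - s) = ∫ s in (1 - t)..t, k s := by
      rw [intervalIntegral.integral_comp_sub_left, sub_sub_cancel]
    have e2 : ∫ s in (1 - t)..t, k (1 - s) = ∫ s in (1 - t)..t, - k s := by
      apply intervalIntegral.integral_congr
      intro s hs
      rw [Set.uIcc_of_le (by linarith)] at hs
      exact hks s hs.1 hs.2
    rw [intervalIntegral.integral_neg] at e2
    linarith
  have e3 := hhalf T (1 - t) (by linarith) (by linarith) (by linarith)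
  rw [← hVs t, e3]
  congr 1
  unfold kop
  have := intervalIntegral.integral_add_adjacent_intervals (hkc.intervalIntegrable (μ := volume) 0 (1 - t))
    (hkc.intervalIntegrable (1 - t) t)
  rw [hz] at this
  simp only [hk] at this
  linarith

lemma av_hasDerivAt {g g' : ℝ → ℝ} (hg : ∀ t, HasDerivAt g (g' t) t) (hg' : Continuous g') (t : ℝ) :
    HasDerivAt (av g) (∫ θ in (0:ℝ)..1, g' (θ * t) * θ) t := by
  have hgc : Continuous g := continuous_iff_continuousAt.2 fun t => (hg t).continuousAt
  obtain ⟨B, hB⟩ := (isCompact_Icc (a := -(|t| + 1)) (b := |t| + 1)).exists_bound_of_continuousOn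
    hg'.continuousOn
  have := intervalIntegral.hasDerivAt_integral_of_dominated_loc_of_deriv_le (μ := volume)
    (a := 0) (b := 1) (F := fun x θ => g (θ * x)) (F' := fun x θ => g' (θ * x) * θ) (x₀ := t)
    (s := Metric.ball t 1) (bound := fun _ => B) (Metric.ball_mem_nhds t one_pos) ?_ ?_ ?_ ?_ ?_ ?_
  · exact this.2
  · exact Filter.Eventually.of_forall fun x => Continuous.aestronglyMeasurable (by fun_prop)
  · exact Continuous.intervalIntegrable (by fun_prop) _ _
  · exact Continuous.aestronglyMeasurable (by fun_prop)
  · refine Filter.Eventually.of_forall fun θ hθ x hx => ?_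
    rw [Set.uIoc_of_le zero_le_one] at hθ
    rw [Metric.mem_ball, Real.dist_eq] at hx
    have h1 : |x| ≤ |t| + 1 := by
      have := abs_sub_abs_le_abs_sub x t
      linarith
    have h2 : |θ * x| ≤ |t| + 1 := by
      rw [abs_mul, abs_of_pos hθ.1]
      nlinarith [abs_nonneg x, hθ.1, hθ.2]
    have h3 := hB (θ * x) (abs_le.1 h2)
    rw [norm_mul]
    have h4 : ‖θ‖ ≤ 1 := by rw [Real.norm_eq_abs, abs_of_pos hθ.1]; exact hθ.2
    nlinarith [norm_nonneg (g' (θ * x)), norm_nonneg θ]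
  · simp
  · refine Filter.Eventually.of_forall fun θ hθ x hx => ?_
    exact HasDerivAt.comp x (hg (θ * x)) (by simpa using (hasDerivAt_id x).const_mul θ)

lemma regularity {lam α T : ℝ} {V : ℝ → ℝ} (hVc : Continuous V) (hT : T < 1)
    (hV : ∀ t, 0 ≤ t → t ≤ T → V t = α + kop T (fun s => lam * (1 - exp (V s))) t) :
    ∃ W D D2 : ℝ → ℝ, (∀ t, 0 ≤ t → t ≤ T → W t = V t) ∧
      (∀ t, t < T → HasDerivAt W (D t) t) ∧ (∀ t, t < T → HasDerivAt D (D2 t) t) ∧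
      ContinuousOn D2 (Set.Iio T) ∧
      (∀ t, 0 ≤ t → t < T → t * (1 - t) * D2 t + (1 - 2 * t) * D t = lam * (1 - exp (V t))) := by
  set g0 : ℝ → ℝ := fun s => lam * (1 - exp (V s)) with hg0
  have hg0c : Continuous g0 := by rw [hg0]; fun_prop
  set V1 : ℝ → ℝ := fun t => α + kop T g0 t with hV1
  have hV1d : ∀ t, HasDerivAt V1 (av g0 t / max (1 - t) (1 - T)) t := fun t =>
    (kop_hasDerivAt hT hg0c t).const_add α
  have hV1c : Continuous V1 := continuous_const.add (kop_cont hT hg0c)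
  have hV1V : ∀ t, 0 ≤ t → t ≤ T → V1 t = V t := fun t h0 ht => (hV t h0 ht).symm
  set g : ℝ → ℝ := fun s => lam * (1 - exp (V1 s)) with hg
  have hgc : Continuous g := by rw [hg]; fun_prop
  set g' : ℝ → ℝ := fun t => lam * (-(exp (V1 t) * (av g0 t / max (1 - t) (1 - T)))) with hg'
  have hgd : ∀ t, HasDerivAt g (g' t) t := fun t =>
    ((hV1d t).exp.const_sub 1).const_mul lam
  have hg'c : Continuous g' := by
    have := kop_integrand_cont hT hg0c
    rw [hg']; fun_prop
  set A2 : ℝ → ℝ := fun t => ∫ θ in (0:ℝ)..1, g' (θ * t) * θ with hA2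
  have hA2c : Continuous A2 := by
    apply intervalIntegral.continuous_parametric_intervalIntegral_of_continuous'
    simp only [Function.uncurry_def]
    fun_prop
  have hA : ∀ t, HasDerivAt (av g) (A2 t) t := fun t => av_hasDerivAt hgd hg'c t
  have hrel : ∀ t, av g t + t * A2 t = g t := by
    intro t
    have e1 : HasDerivAt (fun t => t * av g t) (1 * av g t + t * A2 t) t := (hasDerivAt_id t).mul (hA t)
    have e2 : HasDerivAt (fun t => t * av g t) (g t) t := by
      simp only [mul_av]
      exact intervalIntegral.integral_hasDerivAt_right (hgc.intervalIntegrable _ _)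
        hgc.stronglyMeasurable.stronglyMeasurableAtFilter hgc.continuousAt
    have := e1.unique e2
    linarith
  refine ⟨fun t => α + kop T g t, fun t => av g t / (1 - t),
    fun t => (A2 t * (1 - t) - av g t * (-1)) / (1 - t) ^ 2, ?_, ?_, ?_, ?_, ?_⟩
  · intro t h0 ht
    rw [hV t h0 ht]
    simp only
    congr 1
    apply kop_congr h0
    intro s hs0 hs
    simp only [hg, hg0]
    rw [hV1V s hs0 (hs.trans ht)]
  · intro t ht
    refine ((kop_hasDerivAt hT hgc t).const_add α).congr_deriv ?_
    rw [max_eq_left (by linarith)]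
  · intro t ht
    exact (hA t).div ((hasDerivAt_id t).const_sub 1) (by linarith)
  · have := av_cont hgc
    apply ContinuousOn.div (by fun_prop) (by fun_prop)
    intro t ht
    have : t < T := ht
    have : 0 < 1 - t := by linarith
    positivity
  · intro t h0 ht
    have e1 := hrel t
    have e2 : g t = lam * (1 - exp (V t)) := by simp only [hg]; rw [hV1V t h0 ht.le]
    rw [← e2, ← e1]
    have : 1 - t ≠ 0 := by linarith
    field_simp
    ring

lemma fd_fst {E : Type*} [NormedAddCommGroup E] [NormedSpace ℝ E] {w : ℝ × ℝ → E} {p : ℝ × ℝ}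
    (hw : DifferentiableAt ℝ w p) {c : E} (h : HasDerivAt (fun x => w (x, p.2)) c p.1) :
    fderiv ℝ w p (1, 0) = c := by
  have e1 : HasDerivAt (fun x : ℝ => (x, p.2)) ((1:ℝ), (0:ℝ)) p.1 :=
    (hasDerivAt_id p.1).prodMk (hasDerivAt_const _ _)
  exact (HasFDerivAt.comp_hasDerivAt (f := fun x : ℝ => (x, p.2)) p.1 hw.hasFDerivAt e1).unique h

lemma fd_snd {E : Type*} [NormedAddCommGroup E] [NormedSpace ℝ E] {w : ℝ × ℝ → E} {p : ℝ × ℝ}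
    (hw : DifferentiableAt ℝ w p) {c : E} (h : HasDerivAt (fun x => w (p.1, x)) c p.2) :
    fderiv ℝ w p (0, 1) = c := by
  have e1 : HasDerivAt (fun x : ℝ => (p.1, x)) ((0:ℝ), (1:ℝ)) p.2 :=
    (hasDerivAt_const _ _).prodMk (hasDerivAt_id p.2)
  exact (HasFDerivAt.comp_hasDerivAt (f := fun x : ℝ => (p.1, x)) p.2 hw.hasFDerivAt e1).unique h

def tau (y : ℝ × ℝ) : ℝ := (y.1 ^ 2 + y.2 ^ 2) / (1 + y.1 ^ 2 + y.2 ^ 2)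

lemma tau_contDiff : ContDiff ℝ 2 tau := by
  unfold tau
  apply ContDiff.div (by fun_prop) (by fun_prop)
  intro y; positivity

lemma tau_nonneg (y : ℝ × ℝ) : 0 ≤ tau y := by unfold tau; positivity

lemma tau_lt (y : ℝ × ℝ) : tau y < 1 := by
  unfold tau
  rw [div_lt_one (by positivity)]; linarith

lemma tau_fst (x b : ℝ) : HasDerivAt (fun x => tau (x, b)) (2 * x / (1 + x ^ 2 + b ^ 2) ^ 2) x := by
  have h : (1 + x ^ 2 + b ^ 2) ≠ 0 := by positivity
  have e1 : HasDerivAt (fun x : ℝ => x ^ 2) (2 * x) x := by simpa using hasDerivAt_pow 2 x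
  refine ((e1.add_const (b ^ 2)).div ((e1.const_add 1).add_const (b ^ 2)) h).congr_deriv ?_
  field_simp
  ring

lemma grad_fst (x b : ℝ) : HasDerivAt (fun x => 2 * x / (1 + x ^ 2 + b ^ 2) ^ 2)
    (2 * (1 - 3 * x ^ 2 + b ^ 2) / (1 + x ^ 2 + b ^ 2) ^ 3) x := by
  have h : (1 + x ^ 2 + b ^ 2) ^ 2 ≠ 0 := by positivity
  have e1 : HasDerivAt (fun x : ℝ => x ^ 2) (2 * x) x := by simpa using hasDerivAt_pow 2 x
  refine (((hasDerivAt_id x).const_mul 2).div (((e1.const_add 1).add_const (b ^ 2)).pow 2) h).congr_deriv ?_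
  simp only [id, Pi.pow_apply]
  have h : (1 + x ^ 2 + b ^ 2) ≠ 0 := by positivity
  field_simp
  push_cast
  ring

lemma tau_swap (a b : ℝ) : tau (a, b) = tau (b, a) := by unfold tau; simp only; ring_nf

lemma tau_snd (a x : ℝ) : HasDerivAt (fun x => tau (a, x)) (2 * x / (1 + x ^ 2 + a ^ 2) ^ 2) x := by
  simp only [tau_swap a]
  exact tau_fst x a

/-- The radial Laplacian. -/
lemma lap_radial {W D D2 : ℝ → ℝ} {T : ℝ}
    (h1 : ∀ t, t < T → HasDerivAt W (D t) t) (h2 : ∀ t, t < T → HasDerivAt D (D2 t) t)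
    (h3 : ContinuousOn D2 (Set.Iio T)) (y : ℝ × ℝ) (hy : tau y < T) :
    ContDiffAt ℝ 2 (fun z => W (tau z)) y ∧ lap (fun z => W (tau z)) y =
      4 / (1 + y.1 ^ 2 + y.2 ^ 2) ^ 2 *
        (tau y * (1 - tau y) * D2 (tau y) + (1 - 2 * tau y) * D (tau y)) := by
  have hWc : ContDiffOn ℝ 2 W (Set.Iio T) := by
    rw [show (2 : WithTop ℕ∞) = 1 + 1 by norm_num, contDiffOn_succ_iff_deriv_of_isOpen isOpen_Iio]
    refine ⟨fun t ht => (h1 t ht).differentiableAt.differentiableWithinAt, by simp, ?_⟩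
    have e1 : ContDiffOn ℝ 1 D (Set.Iio T) := by
      rw [show (1 : WithTop ℕ∞) = 0 + 1 by norm_num, contDiffOn_succ_iff_deriv_of_isOpen isOpen_Iio]
      refine ⟨fun t ht => (h2 t ht).differentiableAt.differentiableWithinAt, by simp, ?_⟩
      rw [contDiffOn_zero]
      exact h3.congr fun t ht => (h2 t ht).deriv
    exact e1.congr fun t ht => (h1 t ht).deriv
  set w : ℝ × ℝ → ℝ := fun z => W (tau z) with hw
  have hopen : IsOpen {z | tau z < T} := isOpen_lt tau_contDiff.continuous continuous_const
  have hcd : ∀ z, tau z < T → ContDiffAt ℝ 2 w z := by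
    intro z hz
    exact ContDiffAt.comp z (hWc.contDiffAt (Iio_mem_nhds hz)) tau_contDiff.contDiffAt
  refine ⟨hcd y hy, ?_⟩
  have hdiff : ∀ z, tau z < T → DifferentiableAt ℝ w z := fun z hz =>
    (hcd z hz).differentiableAt (by norm_num)
  have hdd : DifferentiableAt ℝ (fderiv ℝ w) y :=
    ((hcd y hy).fderiv_right (m := 1) (by norm_num)).differentiableAt (by norm_num)
  have ev : ∀ᶠ z in nhds y, tau z < T := hopen.mem_nhds hy
  have g1 : ∀ z, tau z < T → fderiv ℝ w z (1, 0) = D (tau z) * (2 * z.1 / (1 + z.1 ^ 2 + z.2 ^ 2) ^ 2) := by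
    intro z hz
    apply fd_fst (hdiff z hz)
    exact HasDerivAt.comp (h := fun x => tau (x, z.2)) z.1 (h1 (tau z) hz) (tau_fst z.1 z.2)
  have g2 : ∀ z, tau z < T → fderiv ℝ w z (0, 1) = D (tau z) * (2 * z.2 / (1 + z.2 ^ 2 + z.1 ^ 2) ^ 2) := by
    intro z hz
    apply fd_snd (hdiff z hz)
    exact HasDerivAt.comp (h := fun x => tau (z.1, x)) z.2 (h1 (tau z) hz) (tau_snd z.1 z.2)
  have d1 : fderiv ℝ (fun z => fderiv ℝ w z (1, 0)) y (1, 0) =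
      D2 (tau y) * (2 * y.1 / (1 + y.1 ^ 2 + y.2 ^ 2) ^ 2) * (2 * y.1 / (1 + y.1 ^ 2 + y.2 ^ 2) ^ 2) +
      D (tau y) * (2 * (1 - 3 * y.1 ^ 2 + y.2 ^ 2) / (1 + y.1 ^ 2 + y.2 ^ 2) ^ 3) := by
    apply fd_fst (hdd.clm_apply (differentiableAt_const _))
    have e1 := (HasDerivAt.comp (h := fun x => tau (x, y.2)) y.1 (h2 (tau y) hy) (tau_fst y.1 y.2)).mul
      (grad_fst y.1 y.2)
    refine e1.congr_of_eventuallyEq ?_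
    have : Filter.Tendsto (fun x : ℝ => (x, y.2)) (nhds y.1) (nhds y) :=
      Continuous.tendsto' (by fun_prop) _ _ rfl
    filter_upwards [this.eventually ev] with x hx
    exact g1 _ hx
  have d2 : fderiv ℝ (fun z => fderiv ℝ w z (0, 1)) y (0, 1) =
      D2 (tau y) * (2 * y.2 / (1 + y.2 ^ 2 + y.1 ^ 2) ^ 2) * (2 * y.2 / (1 + y.2 ^ 2 + y.1 ^ 2) ^ 2) +
      D (tau y) * (2 * (1 - 3 * y.2 ^ 2 + y.1 ^ 2) / (1 + y.2 ^ 2 + y.1 ^ 2) ^ 3) := by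
    apply fd_snd (hdd.clm_apply (differentiableAt_const _))
    have e1 := (HasDerivAt.comp (h := fun x => tau (y.1, x)) y.2 (h2 (tau y) hy) (tau_snd y.1 y.2)).mul
      (grad_fst y.2 y.1)
    refine e1.congr_of_eventuallyEq ?_
    have : Filter.Tendsto (fun x : ℝ => (y.1, x)) (nhds y.2) (nhds y) :=
      Continuous.tendsto' (by fun_prop) _ _ rfl
    filter_upwards [this.eventually ev] with x hx
    exact g2 _ hx
  have c1 : ∀ e : ℝ × ℝ, fderiv ℝ (fun z => fderiv ℝ w z e) y e = fderiv ℝ (fderiv ℝ w) y e e := by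
    intro e
    rw [fderiv_clm_apply hdd (differentiableAt_const _)]
    simp
  unfold lap
  rw [iteratedFDeriv_two_apply, iteratedFDeriv_two_apply]
  simp only [Matrix.cons_val_zero, Matrix.cons_val_one]
  rw [← c1, ← c1, d1, d2]
  have hp : (1 + y.1 ^ 2 + y.2 ^ 2) ≠ 0 := by positivity
  rw [show 1 + y.2 ^ 2 + y.1 ^ 2 = 1 + y.1 ^ 2 + y.2 ^ 2 by ring]
  have k1 : tau y * (1 - tau y) = (y.1 ^ 2 + y.2 ^ 2) / (1 + y.1 ^ 2 + y.2 ^ 2) ^ 2 := by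
    unfold tau; field_simp; ring
  have k2 : 1 - 2 * tau y = (1 - y.1 ^ 2 - y.2 ^ 2) / (1 + y.1 ^ 2 + y.2 ^ 2) := by
    unfold tau; field_simp; ring
  rw [k1, k2]
  field_simp
  ring

lemma chart_solution {lam α : ℝ} {V : ℝ → ℝ} (hVc : Continuous V)
    (hV : ∀ T t, T < 1 → 0 ≤ t → t ≤ T → V t = α + kop T (fun s => lam * (1 - exp (V s))) t) :
    ContDiff ℝ 2 (fun z => V (tau z)) ∧ ∀ y : ℝ × ℝ, lap (fun z => V (tau z)) y =
      4 * lam * (1 - exp (V (tau y))) / (1 + y.1 ^ 2 + y.2 ^ 2) ^ 2 := by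
  have key : ∀ y : ℝ × ℝ, ContDiffAt ℝ 2 (fun z => V (tau z)) y ∧ lap (fun z => V (tau z)) y =
      4 * lam * (1 - exp (V (tau y))) / (1 + y.1 ^ 2 + y.2 ^ 2) ^ 2 := by
    intro y
    obtain ⟨T, hyT, hT⟩ := exists_between (tau_lt y)
    obtain ⟨W, D, D2, hW, h1, h2, h3, h4⟩ := regularity hVc hT (fun t => hV T t hT)
    obtain ⟨r1, r2⟩ := lap_radial h1 h2 h3 y hyT
    have hopen : IsOpen {z | tau z < T} := isOpen_lt tau_contDiff.continuous continuous_const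
    have ev : (fun z => V (tau z)) =ᶠ[nhds y] fun z => W (tau z) := by
      filter_upwards [hopen.mem_nhds hyT] with z hz
      exact (hW _ (tau_nonneg z) (le_of_lt hz)).symm
    refine ⟨r1.congr_of_eventuallyEq ev, ?_⟩
    have : lap (fun z => V (tau z)) y = lap (fun z => W (tau z)) y := by
      unfold lap
      rw [Filter.EventuallyEq.eq_of_nhds (Filter.EventuallyEq.iteratedFDeriv ℝ ev 2)]
    rw [this, r2, h4 _ (tau_nonneg y) hyT]
    ring
  exact ⟨contDiff_iff_contDiffAt.2 fun y => (key y).1, fun y => (key y).2⟩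
/-- For every `4 < λ ≤ 8` with `λ ≠ 6`, there exists a nonzero solution of
the mean field equation on `S²` depending only on the coordinate `x₃`. -/
theorem exists_nonzero_axisym_solution (lam : ℝ)
    (hlam₁ : 4 < lam) (hlam₂ : lam ≤ 8) (hlam₃ : lam ≠ 6) :
    ∃ u : (Fin 3 → ℝ) → ℝ, IsMFSolution lam u ∧
      (∃ x ∈ sphere3, u x ≠ 0) ∧
      (∀ x ∈ sphere3, ∀ x' ∈ sphere3, x 2 = x' 2 → u x = u x') := by
  obtain ⟨α, v, hα, hvc, hv, hint⟩ := exists_shoot hlam₁ hlam₂ hlam₃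
  obtain ⟨V, hVc, hVs, hV⟩ := reflect hvc hv hint
  obtain ⟨c1, c2⟩ := chart_solution hVc hV
  have hS : ∀ y : ℝ × ℝ, V ((1 - stereoS y 2) / 2) = V (tau y) := by
    intro y
    congr 1
    have : 1 + y.1 ^ 2 + y.2 ^ 2 ≠ 0 := by positivity
    simp only [stereoS, tau, Matrix.cons_val]
    field_simp
    ring
  have hN : ∀ y : ℝ × ℝ, V ((1 - stereoN y 2) / 2) = V (tau y) := by
    intro y
    rw [← hVs (tau y)]
    congr 1
    have : 1 + y.1 ^ 2 + y.2 ^ 2 ≠ 0 := by positivity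
    simp only [stereoN, tau, Matrix.cons_val]
    field_simp
    ring
  refine ⟨fun x => V ((1 - x 2) / 2), ⟨?_, ?_, ?_, ?_, ?_⟩, ⟨![0, 0, 1], ?_, ?_⟩, ?_⟩
  · exact Continuous.continuousOn (by fun_prop)
  · simp only [hN]; exact c1
  · simp only [hS]; exact c1
  · simp only [hN]; exact c2
  · simp only [hS]; exact c2
  · simp [sphere3]
  · have := hV (1/2) 0 (by norm_num) le_rfl (by norm_num)
    rw [kop_zero, add_zero] at this
    simp [this, hα]
  · intro x _ x' _ h
    simp only [h]
end
end

section
/- There exists δ₀ > 0 such that for every λ with 0 < |λ − 6| < δ₀, any two solutions u₁, u₂ of the mean field equation Δu = λ(1−e^u) on S², each not identically zero and each depending only on the coordinate x₃ (i.e. u_i(x) = u_i(x') whenever x₃ = x'₃), must be equal: u₁ = u₂. -/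
open Real MeasureTheory

noncomputable section

/-! ### Integration on the interval -/

namespace MF

open Set Filter Topology

/-- integral over (-1,1) -/
def I (f : ℝ → ℝ) : ℝ := ∫ x in (-1:ℝ)..1, f x

/-- continuous and bounded on the open interval -/
structure Nice (f : ℝ → ℝ) : Prop where
  cont : ContinuousOn f (Ioo (-1) 1)
  bdd : ∃ K, ∀ x ∈ Ioo (-1:ℝ) 1, |f x| ≤ K

lemma Nice.ii {f : ℝ → ℝ} (h : Nice f) : IntervalIntegrable f volume (-1) 1 := by
  obtain ⟨K, hK⟩ := h.bdd
  rw [intervalIntegrable_iff_integrableOn_Ioo_of_le (by norm_num)]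
  refine IntegrableOn.of_bound (by simp)
    (h.cont.aestronglyMeasurable measurableSet_Ioo) K ?_
  filter_upwards [ae_restrict_mem measurableSet_Ioo] with x hx
  exact hK x hx

lemma Nice.add {f g : ℝ → ℝ} (hf : Nice f) (hg : Nice g) : Nice (fun x => f x + g x) := by
  obtain ⟨K, hK⟩ := hf.bdd
  obtain ⟨L, hL⟩ := hg.bdd
  exact ⟨hf.cont.add hg.cont, K + L, fun x hx => (abs_add_le _ _).trans (add_le_add (hK x hx) (hL x hx))⟩

lemma Nice.mul {f g : ℝ → ℝ} (hf : Nice f) (hg : Nice g) : Nice (fun x => f x * g x) := by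
  obtain ⟨K, hK⟩ := hf.bdd
  obtain ⟨L, hL⟩ := hg.bdd
  refine ⟨hf.cont.mul hg.cont, K * L, fun x hx => ?_⟩
  rw [abs_mul]
  exact mul_le_mul (hK x hx) (hL x hx) (abs_nonneg _) ((abs_nonneg _).trans (hK x hx))

lemma Nice.of_cont {f : ℝ → ℝ} (hf : Continuous f) : Nice f := by
  obtain ⟨K, hK⟩ := (isCompact_Icc (a := (-1:ℝ)) (b := 1)).exists_bound_of_continuousOn hf.continuousOn
  exact ⟨hf.continuousOn, K, fun x hx => hK x (Ioo_subset_Icc_self hx)⟩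

lemma Nice.const (c : ℝ) : Nice (fun _ => c) := .of_cont continuous_const

lemma Nice.cmul {f : ℝ → ℝ} (hf : Nice f) (c : ℝ) : Nice (fun x => c * f x) := (Nice.const c).mul hf

lemma Nice.sub {f g : ℝ → ℝ} (hf : Nice f) (hg : Nice g) : Nice (fun x => f x - g x) := by
  have := hf.add (hg.cmul (-1))
  convert this using 2; ring

lemma Nice.sq {f : ℝ → ℝ} (hf : Nice f) : Nice (fun x => f x ^ 2) := by
  have := hf.mul hf
  convert this using 2; ring

lemma Nice.abs {f : ℝ → ℝ} (hf : Nice f) : Nice (fun x => |f x|) := by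
  obtain ⟨K, hK⟩ := hf.bdd
  exact ⟨hf.cont.abs, K, fun x hx => by rw [abs_abs]; exact hK x hx⟩

lemma Nice.congr {f g : ℝ → ℝ} (hf : Nice f) (h : ∀ x ∈ Ioo (-1:ℝ) 1, f x = g x) : Nice g := by
  obtain ⟨K, hK⟩ := hf.bdd
  exact ⟨hf.cont.congr fun x hx => (h x hx).symm, K, fun x hx => h x hx ▸ hK x hx⟩

lemma I_congr {f g : ℝ → ℝ} (h : ∀ x ∈ Ioo (-1:ℝ) 1, f x = g x) : I f = I g := by
  unfold I
  rw [intervalIntegral.integral_of_le (by norm_num), intervalIntegral.integral_of_le (by norm_num),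
    integral_Ioc_eq_integral_Ioo, integral_Ioc_eq_integral_Ioo]
  exact setIntegral_congr_fun measurableSet_Ioo h

lemma I_mono {f g : ℝ → ℝ} (hf : Nice f) (hg : Nice g) (h : ∀ x ∈ Ioo (-1:ℝ) 1, f x ≤ g x) :
    I f ≤ I g := by
  unfold I
  exact intervalIntegral.integral_mono_on_of_le_Ioo (by norm_num) hf.ii hg.ii h

lemma I_nonneg {f : ℝ → ℝ} (h : ∀ x ∈ Ioo (-1:ℝ) 1, 0 ≤ f x) : 0 ≤ I f := by
  unfold I
  rw [intervalIntegral.integral_of_le (by norm_num), integral_Ioc_eq_integral_Ioo]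
  exact setIntegral_nonneg measurableSet_Ioo h

lemma I_add {f g : ℝ → ℝ} (hf : Nice f) (hg : Nice g) : I (fun x => f x + g x) = I f + I g :=
  intervalIntegral.integral_add hf.ii hg.ii

lemma I_cmul (c : ℝ) (f : ℝ → ℝ) : I (fun x => c * f x) = c * I f :=
  intervalIntegral.integral_const_mul _ _

lemma I_lin2 {f g : ℝ → ℝ} (hf : Nice f) (hg : Nice g) (a b : ℝ) :
    I (fun x => a * f x + b * g x) = a * I f + b * I g := by
  rw [I_add (hf.cmul a) (hg.cmul b), I_cmul, I_cmul]

lemma I_lin3 {f g h : ℝ → ℝ} (hf : Nice f) (hg : Nice g) (hh : Nice h) (a b c : ℝ) :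
    I (fun x => a * f x + b * g x + c * h x) = a * I f + b * I g + c * I h := by
  rw [I_add ((hf.cmul a).add (hg.cmul b)) (hh.cmul c), I_lin2 hf hg, I_cmul]

lemma I_lin4 {f g h k : ℝ → ℝ} (hf : Nice f) (hg : Nice g) (hh : Nice h) (hk : Nice k) (a b c d : ℝ) :
    I (fun x => a * f x + b * g x + c * h x + d * k x) = a * I f + b * I g + c * I h + d * I k := by
  rw [I_add (((hf.cmul a).add (hg.cmul b)).add (hh.cmul c)) (hk.cmul d), I_lin3 hf hg hh, I_cmul]

lemma I_abs_le {f : ℝ → ℝ} : |I f| ≤ I (fun x => |f x|) :=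
  intervalIntegral.abs_integral_le_integral_abs (by norm_num)

/-- Fundamental theorem, with a boundary term controlled by `1 - x^2`. -/
lemma ftc0 {B b : ℝ → ℝ} (hd : ∀ x ∈ Ioo (-1:ℝ) 1, HasDerivAt B (b x) x) (hb : Nice b) (C : ℝ)
    (hB : ∀ x ∈ Ioo (-1:ℝ) 1, |B x| ≤ C * (1 - x ^ 2)) : I b = 0 := by
  have hc : Continuous fun x : ℝ => C * (1 - x ^ 2) := by fun_prop
  have h1 : Tendsto B (𝓝[>] (-1)) (𝓝 0) := by
    apply squeeze_zero_norm' (a := fun x : ℝ => C * (1 - x ^ 2))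
    · filter_upwards [Ioo_mem_nhdsGT (show (-1:ℝ) < 1 by norm_num)] with x hx using hB x hx
    · have := hc.tendsto (-1)
      norm_num at this
      exact this.mono_left nhdsWithin_le_nhds
  have h2 : Tendsto B (𝓝[<] 1) (𝓝 0) := by
    apply squeeze_zero_norm' (a := fun x : ℝ => C * (1 - x ^ 2))
    · filter_upwards [Ioo_mem_nhdsLT (show (-1:ℝ) < 1 by norm_num)] with x hx using hB x hx
    · have := hc.tendsto 1
      norm_num at this
      exact this.mono_left nhdsWithin_le_nhds
  have := intervalIntegral.integral_eq_sub_of_hasDerivAt_of_tendsto (by norm_num) hd hb.ii h1 h2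
  simpa [I] using this

/-- Cauchy-Schwarz -/
lemma I_cs {f g : ℝ → ℝ} (hf : Nice f) (hg : Nice g) :
    I (fun x => f x * g x) ^ 2 ≤ I (fun x => f x ^ 2) * I (fun x => g x ^ 2) := by
  have key : ∀ t : ℝ, 0 ≤ I (fun x => g x ^ 2) * (t * t) + 2 * I (fun x => f x * g x) * t + I (fun x => f x ^ 2) := by
    intro t
    have h := I_nonneg (f := fun x => (f x + t * g x) ^ 2) (fun x _ => sq_nonneg _)
    have e := I_lin3 hf.sq (hf.mul hg) hg.sq 1 (2 * t) (t ^ 2)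
    rw [I_congr (g := fun x => (f x + t * g x) ^ 2) (fun x _ => by ring)] at e
    rw [e] at h
    linarith
  have := discrim_le_zero key
  unfold discrim at this
  nlinarith

def nrm (f : ℝ → ℝ) : ℝ := √(I (fun x => f x ^ 2))

lemma nrm_nonneg (f : ℝ → ℝ) : 0 ≤ nrm f := sqrt_nonneg _

lemma nrm_sq (f : ℝ → ℝ) : nrm f ^ 2 = I (fun x => f x ^ 2) :=
  sq_sqrt (I_nonneg fun _ _ => sq_nonneg _)

lemma I_cs' {f g : ℝ → ℝ} (hf : Nice f) (hg : Nice g) :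
    |I (fun x => f x * g x)| ≤ nrm f * nrm g := by
  apply abs_le_of_sq_le_sq _ (mul_nonneg (nrm_nonneg _) (nrm_nonneg _))
  rw [mul_pow, nrm_sq, nrm_sq]
  exact I_cs hf hg

/-- functions vanishing at both ends, with continuous derivative -/
structure Z (h p : ℝ → ℝ) : Prop where
  der : ∀ x, HasDerivAt h (p x) x
  cont : Continuous p
  left : h (-1) = 0
  right : h 1 = 0

lemma Z.cont0 {h p : ℝ → ℝ} (H : Z h p) : Continuous h :=
  continuous_iff_continuousAt.2 fun x => (H.der x).continuousAt

lemma Z.nice {h p : ℝ → ℝ} (H : Z h p) : Nice h := .of_cont H.cont0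
lemma Z.nice' {h p : ℝ → ℝ} (H : Z h p) : Nice p := .of_cont H.cont

lemma Z.lin {h p k r : ℝ → ℝ} (H : Z h p) (L : Z k r) (a b : ℝ) :
    Z (fun x => a * h x + b * k x) (fun x => a * p x + b * r x) where
  der x := ((H.der x).const_mul a).add ((L.der x).const_mul b)
  cont := by have := H.cont; have := L.cont; fun_prop
  left := by rw [H.left, L.left]; ring
  right := by rw [H.right, L.right]; ring

lemma qpos {x : ℝ} (hx : x ∈ Ioo (-1:ℝ) 1) : 0 < 1 - x ^ 2 := by
  nlinarith [hx.1, hx.2]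

lemma Z.bound {h p : ℝ → ℝ} (H : Z h p) (K : ℝ) (n : ℕ)
    (hp : ∀ x ∈ Icc (-1:ℝ) 1, |p x| ≤ K * (1 - x ^ 2) ^ n) :
    ∀ x ∈ Icc (-1:ℝ) 1, |h x| ≤ K * (1 - x ^ 2) ^ (n + 1) := by
  have hK : 0 ≤ K := by
    have := hp 0 (by norm_num)
    norm_num at this
    exact (abs_nonneg _).trans this
  intro x hx
  have hq : 0 ≤ 1 - x ^ 2 := by nlinarith [hx.1, hx.2]
  rcases le_total x 0 with h0 | h0
  · have := (convex_Icc (-1) x).norm_image_sub_le_of_norm_hasDerivWithin_le (f := h) (f' := p)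
      (C := K * (1 - x ^ 2) ^ n) (x := -1) (y := x)
      (fun t _ => (H.der t).hasDerivWithinAt)
      (fun t ht => (hp t ⟨ht.1, ht.2.trans hx.2⟩).trans (by
        have : 0 ≤ 1 - t ^ 2 := by nlinarith [ht.1, ht.2, hx.2]
        gcongr ?_ * ?_ ^ n
        nlinarith [ht.1, ht.2])) ⟨le_rfl, hx.1⟩ ⟨hx.1, le_rfl⟩
    rw [H.left, sub_zero, norm_eq_abs, norm_eq_abs, abs_of_nonneg (a := x - -1) (by linarith [hx.1])] at this
    refine this.trans ?_
    rw [pow_succ _ n, ← mul_assoc]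
    refine mul_le_mul_of_nonneg_left ?_ (by positivity)
    nlinarith [hx.1]
  · have := (convex_Icc x 1).norm_image_sub_le_of_norm_hasDerivWithin_le (f := h) (f' := p)
      (C := K * (1 - x ^ 2) ^ n) (x := 1) (y := x)
      (fun t _ => (H.der t).hasDerivWithinAt)
      (fun t ht => (hp t ⟨hx.1.trans ht.1, ht.2⟩).trans (by
        have : 0 ≤ 1 - t ^ 2 := by nlinarith [ht.1, ht.2, hx.2]
        gcongr ?_ * ?_ ^ n
        nlinarith [ht.1, ht.2])) ⟨hx.2, le_rfl⟩ ⟨le_rfl, hx.2⟩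
    rw [H.right, sub_zero, norm_eq_abs, norm_eq_abs, abs_of_nonpos (a := x - 1) (by linarith [hx.2])] at this
    refine this.trans ?_
    rw [pow_succ _ n, ← mul_assoc]
    refine mul_le_mul_of_nonneg_left ?_ (by positivity)
    nlinarith [hx.2]

lemma Z.exK {h p : ℝ → ℝ} (H : Z h p) : ∃ K, ∀ x ∈ Icc (-1:ℝ) 1, |p x| ≤ K * (1 - x ^ 2) ^ 0 := by
  obtain ⟨K, hK⟩ := (isCompact_Icc (a := (-1:ℝ)) (b := 1)).exists_bound_of_continuousOn H.cont.continuousOn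
  exact ⟨K, fun x hx => by simpa using hK x hx⟩

lemma nice_div {h : ℝ → ℝ} {K : ℝ} {n : ℕ} (hc : Continuous h)
    (hb : ∀ x ∈ Icc (-1:ℝ) 1, |h x| ≤ K * (1 - x ^ 2) ^ n) : Nice (fun x => h x / (1 - x ^ 2) ^ n) := by
  refine ⟨hc.continuousOn.div (by fun_prop) fun x hx => (pow_pos (qpos hx) n).ne', K, fun x hx => ?_⟩
  rw [abs_div, abs_of_pos (pow_pos (qpos hx) n), div_le_iff₀ (pow_pos (qpos hx) n)]
  exact hb x (Ioo_subset_Icc_self hx)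

lemma Z.niceq {h p : ℝ → ℝ} (H : Z h p) : Nice (fun x => h x / (1 - x ^ 2)) := by
  obtain ⟨K, hK⟩ := H.exK
  simpa using nice_div H.cont0 (H.bound K 0 hK)

lemma hasDerivAt_q (x : ℝ) : HasDerivAt (fun x : ℝ => 1 - x ^ 2) (-(2 * x)) x := by
  simpa using (hasDerivAt_pow 2 x).const_sub 1

lemma nice_id : Nice (fun x => x) := .of_cont continuous_id

/-- ftc0 with boundary term of the form `q * (nice)`. -/
lemma ftc1 {B b E : ℝ → ℝ} (hd : ∀ x ∈ Ioo (-1:ℝ) 1, HasDerivAt B (b x) x) (hb : Nice b)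
    (hE : Nice E) (hB : ∀ x ∈ Ioo (-1:ℝ) 1, B x = E x * (1 - x ^ 2)) : I b = 0 := by
  obtain ⟨C, hC⟩ := hE.bdd
  refine ftc0 hd hb C fun x hx => ?_
  rw [hB x hx, abs_mul, abs_of_pos (qpos hx)]
  exact mul_le_mul_of_nonneg_right (hC x hx) (qpos hx).le

/-- Hardy inequality -/
lemma hardy {h p : ℝ → ℝ} (H : Z h p) :
    I (fun x => (h x / (1 - x ^ 2)) ^ 2) ≤ I (fun x => p x ^ 2) := by
  have hq := H.niceq
  have hp := H.nice'
  set f := fun x => h x / (1 - x ^ 2) with hf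
  have hfx : ∀ x ∈ Ioo (-1:ℝ) 1, h x = f x * (1 - x ^ 2) := fun x hx => by
    rw [hf]; field_simp [(qpos hx).ne']
  have hb : Nice (fun x => (1 - x ^ 2) * f x ^ 2 + 2 * (x * (f x * p x)) + 2 * (x ^ 2 * f x ^ 2)) :=
    (((Nice.of_cont (by fun_prop : Continuous fun x : ℝ => 1 - x ^ 2)).mul hq.sq).add
      ((nice_id.mul (hq.mul hp)).cmul 2)).add ((nice_id.sq.mul hq.sq).cmul 2)
  have h0 := ftc1 (B := fun x => x * h x ^ 2 / (1 - x ^ 2)) (b := _) (E := fun x => x * f x ^ 2)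
    (fun x hx => by
      have hqx := (qpos hx).ne'
      refine (((hasDerivAt_id x).mul ((H.der x).pow 2)).div (hasDerivAt_q x) hqx).congr_deriv ?_
      simp only [Pi.mul_apply, Pi.pow_apply, id, hf]
      field_simp
      ring) hb (nice_id.mul hq.sq) (fun x hx => by
        rw [hfx x hx]; field_simp [(qpos hx).ne'])
  have h1 := I_nonneg (f := fun x => (p x + x * f x) ^ 2) (fun x _ => sq_nonneg _)
  have h2 := I_lin3 hp.sq hq.sq hb 1 (-1) 1
  rw [I_congr (g := fun x => (p x + x * f x) ^ 2) (fun x hx => by ring), h0] at h2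
  rw [h2] at h1
  linarith

/-- `L²` norm is bounded by that of derivative. -/
lemma Z.nrm_le {h p : ℝ → ℝ} (H : Z h p) : nrm h ≤ nrm p := by
  apply Real.sqrt_le_sqrt
  refine le_trans (I_mono H.nice.sq H.niceq.sq fun x hx => ?_) (hardy H)
  rw [div_pow, le_div_iff₀ (pow_pos (qpos hx) 2)]
  have : (1 - x ^ 2) ^ 2 ≤ 1 := pow_le_one₀ (qpos hx).le (by nlinarith)
  nlinarith [sq_nonneg (h x)]

lemma Z.nrmq_le {h p : ℝ → ℝ} (H : Z h p) : nrm (fun x => h x / (1 - x ^ 2)) ≤ nrm p :=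
  Real.sqrt_le_sqrt (hardy H)

/-- sup bound -/
lemma Z.sup {h p : ℝ → ℝ} (H : Z h p) : ∀ x ∈ Icc (-1:ℝ) 1, h x ^ 2 ≤ 2 * nrm p ^ 2 := by
  intro x hx
  have e : ∫ t in (-1:ℝ)..x, 2 * (h t * p t) = h x ^ 2 := by
    rw [intervalIntegral.integral_eq_sub_of_hasDerivAt (f := fun t => h t ^ 2)]
    · rw [H.left]; ring
    · intro t _
      exact ((H.der t).pow 2).congr_deriv (by simp; ring)
    · have := H.cont; have := H.cont0
      exact Continuous.intervalIntegrable (by fun_prop) _ _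
  have hc : Continuous (fun t => h t ^ 2 + p t ^ 2) := by
    have := H.cont; have := H.cont0; fun_prop
  have h1 : ∫ t in (-1:ℝ)..x, 2 * (h t * p t) ≤ ∫ t in (-1:ℝ)..x, (h t ^ 2 + p t ^ 2) := by
    apply intervalIntegral.integral_mono_on hx.1
    · have := H.cont; have := H.cont0
      exact Continuous.intervalIntegrable (by fun_prop) _ _
    · exact hc.intervalIntegrable _ _
    · intro t _; nlinarith [sq_nonneg (h t - p t)]
  have h2 : ∫ t in (-1:ℝ)..x, (h t ^ 2 + p t ^ 2) ≤ I (fun t => h t ^ 2 + p t ^ 2) := by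
    apply intervalIntegral.integral_mono_interval le_rfl hx.1 hx.2
    · exact Eventually.of_forall fun t => by simp; positivity
    · exact hc.intervalIntegrable _ _
  rw [I_add H.nice.sq H.nice'.sq, ← nrm_sq, ← nrm_sq] at h2
  have := H.nrm_le
  nlinarith [nrm_nonneg h]

end MF

namespace MF
open Set Filter Topology

lemma sqstep {B A Q E : ℝ → ℝ} (hd : ∀ x ∈ Ioo (-1:ℝ) 1, HasDerivAt B (Q x - A x) x)
    (hQ : Nice Q) (hA : Nice A) (hE : Nice E) (hB : ∀ x ∈ Ioo (-1:ℝ) 1, B x = E x * (1 - x ^ 2))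
    (hQ0 : ∀ x ∈ Ioo (-1:ℝ) 1, 0 ≤ Q x) : 0 ≤ I A := by
  have h0 := ftc1 hd (hQ.sub hA) hE hB
  have h1 := I_lin2 (hQ.sub hA) hA 1 1
  rw [I_congr (g := Q) (fun x _ => by ring), h0] at h1
  have := I_nonneg hQ0
  linarith

lemma nice_q : Nice (fun x => 1 - x ^ 2) := .of_cont (by fun_prop)

lemma prim_Z {r : ℝ → ℝ} (hr : Continuous r) (h : I r = 0) :
    Z (fun x => ∫ t in (-1:ℝ)..x, r t) r where
  der x := intervalIntegral.integral_hasDerivAt_right (hr.intervalIntegrable _ _)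
    (hr.stronglyMeasurableAtFilter _ _) hr.continuousAt
  cont := hr
  left := by simp
  right := h

/-- Spectral gap: `12` on the orthogonal complement of the first two modes. -/
lemma spectral {r p : ℝ → ℝ} (H : Z r p) (h1 : I r = 0) (h2 : I (fun x => x * r x) = 0) :
    12 * I (fun x => r x ^ 2 / (1 - x ^ 2)) ≤ I (fun x => p x ^ 2) := by
  have H1 := prim_Z H.cont0 h1
  set w1 := (fun x => ∫ t in (-1:ℝ)..x, r t) with hw1
  have h3 : I w1 = 0 := by
    have h0 := ftc1 (B := fun x => x * w1 x) (b := fun x => w1 x + x * r x)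
      (E := fun x => x * (w1 x / (1 - x ^ 2)))
      (fun x _ => ((hasDerivAt_id x).mul (H1.der x)).congr_deriv (by simp))
      (H1.nice.add (nice_id.mul H.nice)) (nice_id.mul H1.niceq)
      (fun x hx => by field_simp [(qpos hx).ne'])
    rw [I_add H1.nice (nice_id.mul H.nice), h2] at h0
    linarith
  have H2 := prim_Z H1.cont0 h3
  set w := (fun x => ∫ t in (-1:ℝ)..x, w1 t) with hw
  clear_value w1 w
  obtain ⟨K, hK⟩ := H.exK
  have hK1 := H.bound K 0 hK
  have hK2 := H1.bound K _ hK1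
  have hK3 := H2.bound K _ hK2
  have na := nice_div H.cont0 hK1
  have nb := nice_div H1.cont0 hK2
  have nc := nice_div H2.cont0 hK3
  norm_num at na nb nc
  set α := fun x => r x / (1 - x ^ 2) with hα
  set β := fun x => w1 x / (1 - x ^ 2) ^ 2 with hβ
  set γ := fun x => w x / (1 - x ^ 2) ^ 3 with hγ
  have np := H.nice'
  have A3 := nc.sq.mul (nice_q.mul nice_q.sq)
  have A2 := nb.sq.mul nice_q.sq
  have A1 := na.sq.mul nice_q
  have A0 := np.sq
  have e3 := sqstep (B := fun x => 6 * x * w x ^ 2 / (1 - x ^ 2) ^ 3)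
    (Q := fun x => (β x * (1 - x ^ 2) + 6 * (x * (γ x * (1 - x ^ 2)))) ^ 2)
    (A := fun x => 1 * (β x ^ 2 * (1 - x ^ 2) ^ 2) + (-6) * (γ x ^ 2 * ((1 - x ^ 2) * (1 - x ^ 2) ^ 2)))
    (E := fun x => 6 * (x * γ x ^ 2 * (1 - x ^ 2) ^ 2))
    (fun x hx => by
      have hqx := (qpos hx).ne'
      refine ((((hasDerivAt_id x).const_mul 6).mul ((H2.der x).pow 2)).div ((hasDerivAt_q x).pow 3) (pow_ne_zero 3 hqx)).congr_deriv ?_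
      simp only [Pi.mul_apply, Pi.pow_apply, id, hβ, hγ]
      field_simp
      ring) ((nb.mul nice_q).add ((nice_id.mul (nc.mul nice_q)).cmul 6)).sq
    ((A2.cmul 1).add (A3.cmul (-6))) (((nice_id.mul nc.sq).mul nice_q.sq).cmul 6)
    (fun x hx => by simp only [hγ]; field_simp [(qpos hx).ne']) (fun x _ => sq_nonneg _)
  have e2 := sqstep (B := fun x => 4 * x * w1 x ^ 2 / (1 - x ^ 2) ^ 2 + 12 * w x * w1 x / (1 - x ^ 2) ^ 2)
    (Q := fun x => (1 - x ^ 2) * (α x + 4 * (x * β x) + 6 * (γ x * (1 - x ^ 2))) ^ 2)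
    (A := fun x => 1 * (α x ^ 2 * (1 - x ^ 2)) + (-16) * (β x ^ 2 * (1 - x ^ 2) ^ 2) + 36 * (γ x ^ 2 * ((1 - x ^ 2) * (1 - x ^ 2) ^ 2)))
    (E := fun x => 4 * (x * β x ^ 2 * (1 - x ^ 2)) + 12 * (γ x * β x * (1 - x ^ 2) ^ 2))
    (fun x hx => by
      have hqx := (qpos hx).ne'
      refine (((((hasDerivAt_id x).const_mul 4).mul ((H1.der x).pow 2)).div ((hasDerivAt_q x).pow 2) (pow_ne_zero 2 hqx)).add
        ((((H2.der x).const_mul 12).mul (H1.der x)).div ((hasDerivAt_q x).pow 2) (pow_ne_zero 2 hqx))).congr_deriv ?_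
      simp only [Pi.mul_apply, Pi.pow_apply, id, hα, hβ, hγ]
      field_simp
      ring) (nice_q.mul ((na.add ((nice_id.mul nb).cmul 4)).add ((nc.mul nice_q).cmul 6)).sq)
    (((A1.cmul 1).add (A2.cmul (-16))).add (A3.cmul 36))
    ((((nice_id.mul nb.sq).mul nice_q).cmul 4).add (((nc.mul nb).mul nice_q.sq).cmul 12))
    (fun x hx => by simp only [hγ, hβ]; field_simp [(qpos hx).ne'])
    (fun x hx => mul_nonneg (qpos hx).le (sq_nonneg _))
  have e1 := sqstep (B := fun x => 2 * x * r x ^ 2 / (1 - x ^ 2) + 20 * w1 x * r x / (1 - x ^ 2))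
    (Q := fun x => (p x + 2 * (x * α x) + 10 * (β x * (1 - x ^ 2))) ^ 2)
    (A := fun x => 1 * p x ^ 2 + (-22) * (α x ^ 2 * (1 - x ^ 2)) + 100 * (β x ^ 2 * (1 - x ^ 2) ^ 2))
    (E := fun x => 2 * (x * α x ^ 2) + 20 * (β x * α x * (1 - x ^ 2)))
    (fun x hx => by
      have hqx := (qpos hx).ne'
      refine (((((hasDerivAt_id x).const_mul 2).mul ((H.der x).pow 2)).div (hasDerivAt_q x) hqx).add
        ((((H1.der x).const_mul 20).mul (H.der x)).div (hasDerivAt_q x) hqx)).congr_deriv ?_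
      simp only [Pi.mul_apply, Pi.pow_apply, id, hα, hβ, hγ]
      field_simp
      ring) ((np.add ((nice_id.mul na).cmul 2)).add ((nb.mul nice_q).cmul 10)).sq
    (((A0.cmul 1).add (A1.cmul (-22))).add (A2.cmul 100))
    (((nice_id.mul na.sq).cmul 2).add (((nb.mul na).mul nice_q).cmul 20))
    (fun x hx => by simp only [hα, hβ]; field_simp [(qpos hx).ne'])
    (fun x hx => sq_nonneg _)
  rw [I_lin2 A2 A3] at e3
  rw [I_lin3 A1 A2 A3] at e2
  rw [I_lin3 A0 A1 A2] at e1
  rw [I_congr (g := fun x => α x ^ 2 * (1 - x ^ 2)) (fun x hx => by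
    simp only [hα]; field_simp [(qpos hx).ne'])]
  linarith

end MF

namespace MF
open Set Filter Topology

def F (x : ℝ) : ℝ := x - x ^ 3
def F' (x : ℝ) : ℝ := 1 - 3 * x ^ 2

lemma hasDerivAt_F' (x : ℝ) : HasDerivAt F' (-(6 * x)) x := by
  have := ((hasDerivAt_pow 2 x).const_mul 3).const_sub 1
  refine this.congr_deriv (by simp; ring)

lemma ZF : Z F F' where
  der x := by
    refine ((hasDerivAt_id x).sub (hasDerivAt_pow 3 x)).congr_deriv ?_
    simp [F']
  cont := by unfold F'; fun_prop
  left := by norm_num [F]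
  right := by norm_num [F]

lemma I_xF : I (fun x => x * F x) = 4 / 15 := by
  have : (fun x => x * F x) = fun x => x ^ 2 - x ^ 4 := by funext x; simp [F]; ring
  rw [this, I, intervalIntegral.integral_sub (Continuous.intervalIntegrable (by fun_prop) _ _)
    (Continuous.intervalIntegrable (by fun_prop) _ _), integral_pow, integral_pow]
  norm_num

lemma I_F : I F = 0 := by
  have : F = fun x => x ^ 1 - x ^ 3 := by funext x; simp [F]
  rw [this, I, intervalIntegral.integral_sub (Continuous.intervalIntegrable (by fun_prop) _ _)
    (Continuous.intervalIntegrable (by fun_prop) _ _), integral_pow, integral_pow]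
  norm_num

lemma I_x2 : I (fun x => x ^ 2) = 2 / 3 := by
  rw [I, integral_pow]
  norm_num

lemma I_F2 : I (fun x => F x ^ 2) = 16 / 105 := by
  have e := I_lin3 (f := fun x => x ^ 2) (g := fun x => x ^ 4) (h := fun x => x ^ 6) (.of_cont (by fun_prop))
    (.of_cont (by fun_prop)) (.of_cont (by fun_prop)) 1 (-2) 1
  rw [I_congr (g := fun x => F x ^ 2) (fun x _ => by simp only [F]; ring)] at e
  rw [e, I, I, I, integral_pow, integral_pow, integral_pow]
  norm_num

lemma I_Fp2 : I (fun x => F' x ^ 2) = 8 / 5 := by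
  have e := I_lin3 (f := fun x => x ^ 0) (g := fun x => x ^ 2) (h := fun x => x ^ 4) (.of_cont (by fun_prop))
    (.of_cont (by fun_prop)) (.of_cont (by fun_prop)) 1 (-6) 9
  rw [I_congr (g := fun x => F' x ^ 2) (fun x _ => by simp only [F']; ring)] at e
  rw [e, I, I, I, integral_pow, integral_pow, integral_pow]
  norm_num

structure Lin (lam : ℝ) (S s D p : ℝ → ℝ) : Prop where
  zS : Z S s
  zD : Z D p
  ode : ∀ x ∈ Ioo (-1:ℝ) 1,
    HasDerivAt p ((s x * D x + S x * p x - lam * D x) / (1 - x ^ 2)) x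

variable {lam : ℝ} {S s D p : ℝ → ℝ}

lemma Lin.niceN (H : Lin lam S s D p) : Nice (fun x => s x * D x + S x * p x) :=
  (H.zS.nice'.mul H.zD.nice).add (H.zS.nice.mul H.zD.nice')

lemma Lin.niceSD (H : Lin lam S s D p) : Nice (fun x => S x * D x) := H.zS.nice.mul H.zD.nice

lemma Lin.int0 (H : Lin lam S s D p) (hl : lam ≠ 2) : I D = 0 := by
  have nD := H.zD.nice
  have a := ftc1 (B := fun x => S x * D x) (b := fun x => s x * D x + S x * p x)
    (E := fun x => S x * (D x / (1 - x ^ 2))) (fun x _ => (H.zS.der x).mul (H.zD.der x)) H.niceN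
    (H.zS.nice.mul H.zD.niceq) (fun x hx => by field_simp [(qpos hx).ne'])
  have b := ftc1 (B := fun x => (1 - x ^ 2) * p x + 2 * x * D x)
    (b := fun x => 1 * (s x * D x + S x * p x) + (2 - lam) * D x)
    (E := fun x => p x + 2 * (x * (D x / (1 - x ^ 2)))) (fun x hx => by
      refine (((hasDerivAt_q x).mul (H.ode x hx)).add
        (((hasDerivAt_id x).const_mul 2).mul (H.zD.der x))).congr_deriv ?_
      have := (qpos hx).ne'
      simp only [id]
      field_simp
      ring) ((H.niceN.cmul 1).add (nD.cmul _))
    (H.zD.nice'.add ((nice_id.mul H.zD.niceq).cmul 2)) (fun x hx => by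
      have := (qpos hx).ne'
      field_simp)
  rw [I_lin2 H.niceN nD, a] at b
  have : (2 - lam) * I D = 0 := by linarith
  exact (mul_eq_zero.1 this).resolve_left (sub_ne_zero.2 hl.symm)

lemma Lin.int1 (H : Lin lam S s D p) :
    I (fun x => S x * D x) = (6 - lam) * I (fun x => x * D x) := by
  have nD := nice_id.mul H.zD.nice
  have nN := nice_id.mul H.niceN
  have a := ftc1 (B := fun x => x * (S x * D x)) (b := fun x => 1 * (S x * D x) + 1 * (x * (s x * D x + S x * p x)))
    (E := fun x => x * (S x * (D x / (1 - x ^ 2))))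
    (fun x _ => ((hasDerivAt_id x).mul ((H.zS.der x).mul (H.zD.der x))).congr_deriv (by simp))
    ((H.niceSD.cmul 1).add (nN.cmul 1))
    (nice_id.mul (H.zS.nice.mul H.zD.niceq)) (fun x hx => by field_simp [(qpos hx).ne'])
  have b := ftc1 (B := fun x => x * (1 - x ^ 2) * p x - F' x * D x)
    (b := fun x => 1 * (x * (s x * D x + S x * p x)) + (6 - lam) * (x * D x))
    (E := fun x => x * p x - F' x * (D x / (1 - x ^ 2))) (fun x hx => by
      refine ((((hasDerivAt_id x).mul (hasDerivAt_q x)).mul (H.ode x hx)).sub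
        ((hasDerivAt_F' x).mul (H.zD.der x))).congr_deriv ?_
      have := (qpos hx).ne'
      simp only [id, F', Pi.mul_apply]
      field_simp
      ring) ((nN.cmul 1).add (nD.cmul _))
    ((nice_id.mul H.zD.nice').sub (ZF.nice'.mul H.zD.niceq)) (fun x hx => by
      have := (qpos hx).ne'
      field_simp)
  rw [I_lin2 nN nD] at b
  rw [I_lin2 H.niceSD nN] at a
  linarith

/-- coefficient of the second mode -/
def cf (D : ℝ → ℝ) : ℝ := 15 / 4 * I (fun x => x * D x)

def rem (D : ℝ → ℝ) (x : ℝ) : ℝ := 1 * D x + (-cf D) * F x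
def rem' (D p : ℝ → ℝ) (x : ℝ) : ℝ := 1 * p x + (-cf D) * F' x

lemma Z.rem (H : Z D p) : Z (rem D) (rem' D p) := H.lin ZF 1 (-cf D)

lemma I_rem (H : Z D p) (h : I D = 0) : I (rem D) = 0 := by
  unfold MF.rem
  rw [I_lin2 H.nice ZF.nice, h, I_F]; ring

lemma I_xrem (H : Z D p) : I (fun x => x * rem D x) = 0 := by
  have := I_lin2 (nice_id.mul H.nice) (nice_id.mul ZF.nice) 1 (-cf D)
  rw [I_congr (g := fun x => x * rem D x) (fun x _ => by simp only [MF.rem]; ring), I_xF] at this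
  rw [this, cf]; ring

lemma nrm_decomp (H : Z D p) : nrm p ^ 2 = 8 / 5 * cf D ^ 2 + nrm (rem' D p) ^ 2 := by
  have R := H.rem
  have h0 : I (fun x => F' x * rem' D p x) = 0 := by
    have := ftc1 (B := fun x => F' x * rem D x) (b := fun x => (-6) * (x * rem D x) + 1 * (F' x * rem' D p x))
      (E := fun x => F' x * (rem D x / (1 - x ^ 2)))
      (fun x _ => ((hasDerivAt_F' x).mul (R.der x)).congr_deriv (by ring))
      (((nice_id.mul R.nice).cmul _).add ((ZF.nice'.mul R.nice').cmul 1))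
      (ZF.nice'.mul R.niceq) (fun x hx => by field_simp [(qpos hx).ne'])
    rw [I_lin2 (nice_id.mul R.nice) (ZF.nice'.mul R.nice'), I_xrem H] at this
    linarith
  have := I_lin3 ZF.nice'.sq (ZF.nice'.mul R.nice') R.nice'.sq (cf D ^ 2) (2 * cf D) 1
  rw [h0, I_Fp2, I_congr (g := fun x => p x ^ 2) (fun x _ => by simp only [rem']; ring)] at this
  rw [nrm_sq, nrm_sq, this]; ring

lemma nrm_mul_le {f g : ℝ → ℝ} (hf : Nice f) (hg : Nice g) {M : ℝ} (hM : 0 ≤ M)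
    (h : ∀ x ∈ Icc (-1:ℝ) 1, |f x| ≤ M) : nrm (fun x => f x * g x) ≤ M * nrm g := by
  rw [nrm, nrm, ← Real.sqrt_sq hM, ← Real.sqrt_mul (sq_nonneg M), ← I_cmul]
  apply Real.sqrt_le_sqrt
  refine I_mono (hf.mul hg).sq (hg.sq.cmul _) fun x hx => ?_
  rw [mul_pow]
  refine mul_le_mul_of_nonneg_right ?_ (sq_nonneg _)
  exact sq_le_sq' (neg_le_of_abs_le (h x (Ioo_subset_Icc_self hx))) (le_of_abs_le (h x (Ioo_subset_Icc_self hx)))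

lemma Lin.energy (H : Lin lam S s D p) (hl5 : 5 ≤ lam) (hl : lam ≤ 7) {MS MD : ℝ}
    (hMS : ∀ x ∈ Icc (-1:ℝ) 1, |S x| ≤ MS) (hMD : ∀ x ∈ Icc (-1:ℝ) 1, |D x| ≤ MD) :
    nrm (rem' D p) ≤ 12 / 5 * (MS * nrm p + MD * nrm s) := by
  have hMS0 : 0 ≤ MS := (abs_nonneg _).trans (hMS 0 (by norm_num))
  have hMD0 : 0 ≤ MD := (abs_nonneg _).trans (hMD 0 (by norm_num))
  have R := H.zD.rem
  have hsp := spectral R (I_rem H.zD (H.int0 (by linarith))) (I_xrem H.zD)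
  have h12 := I_xrem H.zD
  set d := cf D with hd
  have nN := (H.niceN.mul R.niceq)
  have nr : Nice (fun x => rem D x ^ 2 / (1 - x ^ 2)) := (R.nice.mul R.niceq).congr fun x hx => by ring
  have nb := ((((nN.cmul 1).add (nr.cmul (-lam))).add (R.nice'.sq.cmul 1)).add
      ((nice_id.mul R.nice).cmul ((6 - lam) * d)))
  have a := ftc1 (B := fun x => rem' D p x * rem D x)
    (E := fun x => rem' D p x * (rem D x / (1 - x ^ 2)))
    (fun x hx => by
      have h1 : HasDerivAt (rem' D p) (1 * ((s x * D x + S x * p x - lam * D x) / (1 - x ^ 2)) + (-d) * (-(6 * x))) x :=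
        ((H.ode x hx).const_mul 1).add ((hasDerivAt_F' x).const_mul (-d))
      refine (h1.mul (R.der x)).congr_deriv ?_
      have e : D x = rem D x + d * (x * (1 - x ^ 2)) := by simp only [MF.rem, F, ← hd]; ring
      have : lam * D x / (1 - x ^ 2) = lam * (rem D x / (1 - x ^ 2)) + lam * d * x := by
        rw [e]; have := (qpos hx).ne'; field_simp
      rw [sub_div, this]
      ring) nb
    (R.nice'.mul R.niceq) (fun x hx => by field_simp [(qpos hx).ne'])
  rw [I_lin4 nN nr R.nice'.sq (nice_id.mul R.nice), h12] at a
  have n1 := (H.zS.nice'.mul H.zD.nice)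
  have n2 := (H.zS.nice.mul H.zD.nice')
  have hN := I_lin2 ((H.zD.nice.mul H.zS.nice').mul R.niceq) (n2.mul R.niceq) 1 1
  rw [I_congr (g := fun x => (s x * D x + S x * p x) * (rem D x / (1 - x ^ 2))) (fun x _ => by ring)] at hN
  have c1 := I_cs' (H.zD.nice.mul H.zS.nice') R.niceq
  have c2 := I_cs' n2 R.niceq
  have m1 := nrm_mul_le H.zD.nice H.zS.nice' hMD0 hMD
  have m2 := nrm_mul_le H.zS.nice H.zD.nice' hMS0 hMS
  have hq := R.nrmq_le
  rw [← nrm_sq] at hsp a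
  set ρ := nrm (rem' D p)
  have hρ : 0 ≤ ρ := nrm_nonneg _
  have k1 := c1.trans (mul_le_mul m1 hq (nrm_nonneg _) (mul_nonneg hMD0 (nrm_nonneg _)))
  have k2 := c2.trans (mul_le_mul m2 hq (nrm_nonneg _) (mul_nonneg hMS0 (nrm_nonneg _)))
  have J0 : 0 ≤ I (fun x => rem D x ^ 2 / (1 - x ^ 2)) :=
    I_nonneg fun x hx => div_nonneg (sq_nonneg _) (qpos hx).le
  have l1 := (abs_le.1 k1).1
  have l2 := (abs_le.1 k2).1
  have l3 : lam * I (fun x => rem D x ^ 2 / (1 - x ^ 2)) ≤ 7 / 12 * ρ ^ 2 := by nlinarith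
  have l4 : 5 / 12 * ρ ^ 2 ≤ (MS * nrm p + MD * nrm s) * ρ := by nlinarith
  rcases hρ.eq_or_lt with h0 | h0
  · rw [← h0]
    have := nrm_nonneg p; have := nrm_nonneg s
    positivity
  · have : 5 / 12 * ρ ≤ MS * nrm p + MD * nrm s := by
      by_contra hcon
      push Not at hcon
      nlinarith
    linarith

end MF

namespace MF
open Set Filter Topology

lemma Z.zero {h p : ℝ → ℝ} (H : Z h p) (h0 : nrm p = 0) : ∀ x ∈ Icc (-1:ℝ) 1, p x = 0 := by
  have h1 : ∀ x ∈ Icc (-1:ℝ) 1, h x = 0 := fun x hx => by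
    have := H.sup x hx
    rw [h0] at this
    exact pow_eq_zero_iff (two_ne_zero) |>.1 (le_antisymm (by simpa using this) (sq_nonneg _))
  have h2 : EqOn p (fun _ => 0) (Ioo (-1) 1) := fun x hx => by
    have e : h =ᶠ[𝓝 x] fun _ => 0 := by
      filter_upwards [Ioo_mem_nhds hx.1 hx.2] with y hy using h1 y (Ioo_subset_Icc_self hy)
    exact (H.der x).unique ((hasDerivAt_const x (0:ℝ)).congr_of_eventuallyEq e)
  have := h2.closure H.cont continuous_const
  rw [closure_Ioo (by norm_num)] at this
  exact this

structure Sol (lam : ℝ) (G g : ℝ → ℝ) : Prop where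
  z : Z G g
  ode : ∀ x ∈ Ioo (-1:ℝ) 1, HasDerivAt g (G x * (g x - lam) / (1 - x ^ 2)) x
  le : ∀ x ∈ Icc (-1:ℝ) 1, g x ≤ lam

variable {lam : ℝ} {G g G₁ g₁ G₂ g₂ D p : ℝ → ℝ}

lemma Sol.lin1 (H : Sol lam G g) : Lin lam (fun x => 1 / 2 * G x + 0 * G x) (fun x => 1 / 2 * g x + 0 * g x) G g where
  zS := H.z.lin H.z _ _
  zD := H.z
  ode x hx := (H.ode x hx).congr_deriv (by ring)

lemma Sol.lin2 (H : Sol lam G₁ g₁) (L : Sol lam G₂ g₂) :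
    Lin lam (fun x => 1 / 2 * G₁ x + 1 / 2 * G₂ x) (fun x => 1 / 2 * g₁ x + 1 / 2 * g₂ x)
      (fun x => 1 * G₁ x + (-1) * G₂ x) (fun x => 1 * g₁ x + (-1) * g₂ x) where
  zS := H.z.lin L.z _ _
  zD := H.z.lin L.z _ _
  ode x hx := (((H.ode x hx).const_mul 1).add ((L.ode x hx).const_mul (-1))).congr_deriv (by ring)

lemma small_aux (z : Z G g) (hg : ∀ x ∈ Icc (-1:ℝ) 1, g x ≤ 7) (hn : nrm G ^ 2 ≤ 1 / 1000000) :
    ∀ x ∈ Icc (-1:ℝ) 1, G x ≤ 1 / 24 := by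
  have hanti : AntitoneOn (fun x => G x - 7 * x) (Icc (-1) 1) := by
    apply antitoneOn_of_hasDerivWithinAt_nonpos (convex_Icc _ _) (f' := fun x => g x - 7 * 1)
    · have := z.cont0; fun_prop
    · intro x _
      exact ((z.der x).sub ((hasDerivAt_id x).const_mul 7)).hasDerivWithinAt
    · intro x hx
      have := hg x (interior_subset hx)
      linarith
  intro m hm
  by_contra! hc
  have h1 := hanti (by norm_num : (-1:ℝ) ∈ Icc (-1:ℝ) 1) hm hm.1
  simp only [z.left] at h1
  have hm' : -1 ≤ m - 1 / 336 := by linarith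
  have hle : m - 1 / 336 ≤ m := by linarith
  have hc2 : Continuous fun t => G t ^ 2 := by have := z.cont0; fun_prop
  have h2 : ∫ t in (m - 1 / 336)..m, G t ^ 2 ≤ I (fun t => G t ^ 2) := by
    apply intervalIntegral.integral_mono_interval hm' hle hm.2
    · exact Eventually.of_forall fun t => by simp; positivity
    · exact hc2.intervalIntegrable _ _
  have h3 : ∫ t in (m - 1 / 336)..m, (1 / 48 : ℝ) ^ 2 ≤ ∫ t in (m - 1 / 336)..m, G t ^ 2 := by
    apply intervalIntegral.integral_mono_on hle
    · simp
    · exact hc2.intervalIntegrable _ _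
    · intro t ht
      have := hanti (show t ∈ Icc (-1:ℝ) 1 from ⟨hm'.trans ht.1, ht.2.trans hm.2⟩) hm ht.2
      simp only at this
      have : 1 / 48 ≤ G t := by linarith [ht.1]
      gcongr
  rw [intervalIntegral.integral_const] at h3
  rw [nrm_sq] at hn
  norm_num at h3
  linarith

lemma small (z : Z G g) (hg : ∀ x ∈ Icc (-1:ℝ) 1, g x ≤ 7) (hn : nrm G ^ 2 ≤ 1 / 1000000) :
    ∀ x ∈ Icc (-1:ℝ) 1, |G x| ≤ 1 / 24 := by
  have z' : Z (fun x => -G (-x)) (fun x => g (-x)) := {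
    der := fun x => by
      have := ((z.der (-x)).comp x (hasDerivAt_neg x)).neg
      exact this.congr_deriv (by ring)
    cont := by have := z.cont; fun_prop
    left := by simp [z.right]
    right := by simp [z.left] }
  have hn' : nrm (fun x => -G (-x)) = nrm G := by
    unfold nrm I
    congr 1
    have := intervalIntegral.integral_comp_neg (a := -1) (b := 1) (fun x => G x ^ 2)
    simpa using this
  intro x hx
  rw [abs_le]
  have hx' : -x ∈ Icc (-1:ℝ) 1 := ⟨by linarith [hx.2], by linarith [hx.1]⟩
  have h1 := small_aux z' (fun x hx => hg _ ⟨by linarith [hx.2], by linarith [hx.1]⟩) (by rw [hn']; exact hn) (-x) hx'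
  have h2 := small_aux z hg hn x hx
  simp only [neg_neg] at h1
  exact ⟨by linarith, h2⟩

lemma nrm_F : nrm F ≤ 2 / 5 := by
  apply Real.sqrt_le_iff.2
  rw [I_F2]; norm_num

lemma bil (H : Z G g) (L : Z D p) : |I (fun x => G x * D x) - 16 / 105 * cf G * cf D| ≤
    2 / 5 * (|cf G| * nrm (rem' D p) + |cf D| * nrm (rem' G g)) + nrm (rem' G g) * nrm (rem' D p) := by
  have e := I_lin4 ZF.nice.sq (ZF.nice.mul L.rem.nice) (ZF.nice.mul H.rem.nice) (H.rem.nice.mul L.rem.nice)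
    (cf G * cf D) (cf G) (cf D) 1
  rw [I_congr (g := fun x => G x * D x) (fun x _ => by simp only [MF.rem]; ring), I_F2] at e
  have h1 : |I (fun x => F x * rem D x)| ≤ 2 / 5 * nrm (rem' D p) := (I_cs' ZF.nice L.rem.nice).trans
    (mul_le_mul nrm_F L.rem.nrm_le (nrm_nonneg _) (by norm_num))
  have h2 : |I (fun x => F x * rem G x)| ≤ 2 / 5 * nrm (rem' G g) := (I_cs' ZF.nice H.rem.nice).trans
    (mul_le_mul nrm_F H.rem.nrm_le (nrm_nonneg _) (by norm_num))
  have h3 : |I (fun x => rem G x * rem D x)| ≤ nrm (rem' G g) * nrm (rem' D p) :=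
    (I_cs' H.rem.nice L.rem.nice).trans
    (mul_le_mul H.rem.nrm_le L.rem.nrm_le (nrm_nonneg _) (nrm_nonneg _))
  have e2 : I (fun x => G x * D x) - 16 / 105 * cf G * cf D =
    cf G * I (fun x => F x * rem D x) + cf D * I (fun x => F x * rem G x) + I (fun x => rem G x * rem D x) := by
    rw [e]; ring
  rw [e2]
  refine (abs_add_three _ _ _).trans ?_
  rw [abs_mul, abs_mul]
  have := mul_le_mul_of_nonneg_left h1 (abs_nonneg (cf G))
  have := mul_le_mul_of_nonneg_left h2 (abs_nonneg (cf D))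
  linarith

/-- Absorption: -/
lemma absorb {n ρ d : ℝ} (hn : 0 ≤ n) (hρ : 0 ≤ ρ) (h : n ^ 2 = 8 / 5 * d ^ 2 + ρ ^ 2) (h2 : ρ ≤ n / 10) :
    n ≤ 3 / 2 * |d| ∧ n ^ 2 ≤ 2 * d ^ 2 := by
  have h3 : n ^ 2 ≤ 2 * d ^ 2 := by nlinarith [sq_nonneg d]
  refine ⟨?_, h3⟩
  apply le_of_sq_le_sq _ (by positivity)
  rw [mul_pow, sq_abs]; nlinarith [sq_nonneg d]

lemma Z.sup' {h p : ℝ → ℝ} (H : Z h p) : ∀ x ∈ Icc (-1:ℝ) 1, |h x| ≤ 3 / 2 * nrm p := by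
  intro x hx
  have := H.sup x hx
  have := nrm_nonneg p
  apply abs_le_of_sq_le_sq _ (by positivity)
  nlinarith

lemma Sol.est (H : Sol lam G g) (hl : |lam - 6| ≤ 1 / 100000) :
    |cf G| ≤ 5 * |lam - 6| ∧ nrm g ≤ 3 / 2 * |cf G| ∧ nrm (rem' G g) ≤ 9 * cf G ^ 2 ∧
    (cf G ≠ 0 → |cf G - 7 / 2 * (6 - lam)| ≤ 1500 * (lam - 6) ^ 2) := by
  have L := H.lin1
  have hlam := abs_le.1 hl
  have i1 := L.int1
  have nx := nice_id.mul H.z.nice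
  rw [I_congr (g := fun x => (1 / 2) * G x ^ 2) (fun x _ => by ring), I_cmul, ← nrm_sq] at i1
  have cs := I_cs nice_id H.z.nice
  rw [I_x2, ← nrm_sq] at cs
  set J := I (fun x => x * G x) with hJ
  have hcf : cf G = 15 / 4 * J := rfl
  set N := nrm G with hN
  have hJ2 : J ^ 2 ≤ (4 / 3 * |lam - 6|) ^ 2 := by
    rw [mul_pow, sq_abs]
    have : J * J ≤ (16 / 9 * (lam - 6) ^ 2) := by
      by_contra! hc
      have h1 : J ^ 2 ≤ 4 / 3 * ((6 - lam) * J) := by linarith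
      nlinarith [sq_nonneg (J - 4 / 3 * (6 - lam))]
    nlinarith
  have hJ3 : |J| ≤ 4 / 3 * |lam - 6| := abs_le_of_sq_le_sq hJ2 (by positivity)
  have ha : |cf G| ≤ 5 * |lam - 6| := by
    rw [hcf, abs_mul, abs_of_pos (by norm_num : (0:ℝ) < 15 / 4)]; linarith
  have hN2 : N ^ 2 ≤ 1 / 1000000 := by
    have : (6 - lam) * J ≤ |lam - 6| * |J| := by
      rw [← abs_mul, ← abs_neg]
      exact (le_of_eq (by ring)).trans (le_abs_self (-((lam - 6) * J)))
    have : |lam - 6| * |J| ≤ 1 / 100000 * (4 / 3 * (1 / 100000)) := by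
      apply mul_le_mul hl _ (abs_nonneg _) (by norm_num)
      linarith
    linarith
  have hM := small H.z (fun x hx => (H.le x hx).trans (by linarith)) hN2
  have hs : nrm (fun x => 1 / 2 * g x + 0 * g x) = 1 / 2 * nrm g := by
    unfold nrm
    rw [I_congr (g := fun x => (1 / 2) ^ 2 * g x ^ 2) (fun x _ => by ring), I_cmul,
      Real.sqrt_mul (by norm_num), Real.sqrt_sq (by norm_num)]
  have en : ∀ M, (∀ x ∈ Icc (-1:ℝ) 1, |G x| ≤ M) → nrm (rem' G g) ≤ 12 / 5 * (M * nrm g) := by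
    intro M hM
    have := L.energy (MS := M / 2) (by linarith) (by linarith) (fun x hx => by
      have := hM x hx
      rw [show 1 / 2 * G x + 0 * G x = 1 / 2 * G x by ring, abs_mul, abs_of_pos (by norm_num : (0:ℝ) < 1 / 2)]
      linarith) hM
    rw [hs] at this
    linarith
  obtain ⟨hn1, hn2⟩ := absorb (nrm_nonneg g) (nrm_nonneg _) (nrm_decomp H.z) ((en _ hM).trans (by linarith))
  have e2 := en _ H.z.sup'
  have hρ : nrm (rem' G g) ≤ 9 * cf G ^ 2 := by nlinarith
  refine ⟨ha, hn1, hρ, fun h0 => ?_⟩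
  have hb := bil H.z H.z
  rw [I_congr (g := fun x => G x ^ 2) (fun x _ => by ring), ← nrm_sq, ← hN] at hb
  set a := cf G
  set ρ := nrm (rem' G g)
  have hρ0 : 0 ≤ ρ := nrm_nonneg _
  have hA : 0 < |a| := abs_pos.2 h0
  have hA2 : a ^ 2 = |a| ^ 2 := (sq_abs a).symm
  have hA1 : |a| ≤ 1 / 10000 := by linarith
  have k1 : N ^ 2 - 16 / 105 * a * a = a * (8 / 15 * (6 - lam) - 16 / 105 * a) := by
    have : J = 4 / 15 * a := by rw [hcf]; ring
    rw [this] at i1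
    linear_combination 2 * i1
  rw [k1, abs_mul] at hb
  have k2 : 2 / 5 * (|a| * ρ + |a| * ρ) + ρ * ρ ≤ |a| * (8 * |a| ^ 2) := by
    rw [hA2] at hρ
    have : ρ * ρ ≤ (9 * |a| ^ 2) * (9 * |a| ^ 2) := mul_le_mul hρ hρ hρ0 (by positivity)
    have h5 : |a| * ρ ≤ |a| * (9 * |a| ^ 2) := mul_le_mul_of_nonneg_left hρ hA.le
    have h6 : |a| ^ 4 ≤ 1 / 10000 * |a| ^ 3 := by
      rw [pow_succ' _ 3]
      exact mul_le_mul_of_nonneg_right hA1 (by positivity)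
    nlinarith
  have k3 := le_of_mul_le_mul_left (hb.trans k2) hA
  have k4 : 8 / 15 * (6 - lam) - 16 / 105 * a = -(16 / 105) * (a - 7 / 2 * (6 - lam)) := by ring
  rw [k4, abs_mul, abs_neg, abs_of_pos (by norm_num : (0:ℝ) < 16 / 105)] at k3
  have k5 : |a| ^ 2 ≤ (5 * |lam - 6|) ^ 2 := pow_le_pow_left₀ hA.le ha 2
  rw [mul_pow, sq_abs (lam - 6)] at k5
  linarith

set_option maxHeartbeats 1000000 in
theorem Sol.unique (H : Sol lam G₁ g₁) (K : Sol lam G₂ g₂) (hl0 : 0 < |lam - 6|) (hl : |lam - 6| ≤ 1 / 100000)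
    (h1 : ∃ x ∈ Icc (-1:ℝ) 1, g₁ x ≠ 0) (h2 : ∃ x ∈ Icc (-1:ℝ) 1, g₂ x ≠ 0) :
    ∀ x ∈ Icc (-1:ℝ) 1, g₁ x = g₂ x := by
  obtain ⟨a1, n1, r1, c1⟩ := H.est hl
  obtain ⟨a2, n2, r2, c2⟩ := K.est hl
  have ne : ∀ {G g : ℝ → ℝ}, Sol lam G g → nrm g ≤ 3 / 2 * |cf G| → (∃ x ∈ Icc (-1:ℝ) 1, g x ≠ 0) → cf G ≠ 0 := by
    intro G g H n ⟨x, hx, h⟩ h0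
    rw [h0, abs_zero, mul_zero] at n
    exact h (H.z.zero (le_antisymm n (nrm_nonneg _)) x hx)
  replace c1 := c1 (ne H n1 h1)
  replace c2 := c2 (ne K n2 h2)
  have L := H.lin2 K
  have hlam := abs_le.1 hl
  set D : ℝ → ℝ := fun x => 1 * G₁ x + (-1) * G₂ x with hD
  set p : ℝ → ℝ := fun x => 1 * g₁ x + (-1) * g₂ x with hp
  set e := |lam - 6| with he
  have he2 : (lam - 6) ^ 2 = e ^ 2 := (sq_abs _).symm
  -- norm of s
  have hs : nrm (fun x => 1 / 2 * g₁ x + 1 / 2 * g₂ x) ≤ 15 / 2 * e := by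
    apply Real.sqrt_le_iff.2 ⟨by positivity, ?_⟩
    have i := I_mono (L.zS.nice'.sq) ((H.z.nice'.sq.cmul (1 / 2)).add (K.z.nice'.sq.cmul (1 / 2))) (fun x _ => by
      nlinarith [sq_nonneg (g₁ x - g₂ x)])
    rw [I_lin2 H.z.nice'.sq K.z.nice'.sq, ← nrm_sq g₁, ← nrm_sq g₂] at i
    have j1 := pow_le_pow_left₀ (nrm_nonneg _) (n1.trans (by linarith : _ ≤ 15 / 2 * e)) 2
    have j2 := pow_le_pow_left₀ (nrm_nonneg _) (n2.trans (by linarith : _ ≤ 15 / 2 * e)) 2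
    refine i.trans ?_
    linarith
  have en := L.energy (by linarith) (by linarith) L.zS.sup' L.zD.sup'
  set n := nrm p
  set ρ := nrm (rem' D p)
  have hn0 : 0 ≤ n := nrm_nonneg _
  have hρ0 : 0 ≤ ρ := nrm_nonneg _
  have en2 : ρ ≤ 60 * e * n := by
    have := mul_le_mul_of_nonneg_right hs hn0
    have : 0 ≤ e * n := by positivity
    linarith
  obtain ⟨m1, m2⟩ := absorb hn0 hρ0 (nrm_decomp L.zD) (by
    have := mul_le_mul_of_nonneg_right hl hn0
    linarith)
  set d := cf D with hd
  have hρ : ρ ≤ 90 * e * |d| := by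
    have := mul_le_mul_of_nonneg_left m1 hl0.le
    linarith
  have i1 := L.int1
  have hJ : I (fun x => x * D x) = 4 / 15 * d := by rw [hd, cf]; ring
  have i2 := I_lin2 (H.z.nice.mul L.zD.nice) (K.z.nice.mul L.zD.nice) (1 / 2) (1 / 2)
  rw [I_congr (g := fun x => (1 / 2 * G₁ x + 1 / 2 * G₂ x) * D x) (fun x _ => by ring), i1, hJ] at i2
  have b1 := bil H.z L.zD
  have b2 := bil K.z L.zD
  have hR : ∀ {G g : ℝ → ℝ}, |cf G| ≤ 5 * e → nrm (rem' G g) ≤ 9 * cf G ^ 2 →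
      |cf G - 7 / 2 * (6 - lam)| ≤ 1500 * (lam - 6) ^ 2 →
      |I (fun x => G x * D x) - 16 / 105 * cf G * d| ≤
        2 / 5 * (|cf G| * ρ + |d| * nrm (rem' G g)) + nrm (rem' G g) * ρ →
      |I (fun x => G x * D x) - 8 / 15 * (6 - lam) * d| ≤ 1000 * e ^ 2 * |d| := by
    intro G g a r c b
    have hd0 := abs_nonneg d
    have r' : nrm (rem' G g) ≤ 225 * e ^ 2 := by
      have := pow_le_pow_left₀ (abs_nonneg _) a 2
      rw [sq_abs, mul_pow] at this
      linarith
    have t1 : |cf G| * ρ ≤ (5 * e) * (90 * e * |d|) := mul_le_mul a hρ hρ0 (by positivity)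
    have t2 : |d| * nrm (rem' G g) ≤ |d| * (225 * e ^ 2) := mul_le_mul_of_nonneg_left r' hd0
    have t3 : nrm (rem' G g) * ρ ≤ (225 * e ^ 2) * (90 * e * |d|) := mul_le_mul r' hρ hρ0 (by positivity)
    have t4 : e * (e ^ 2 * |d|) ≤ 1 / 100000 * (e ^ 2 * |d|) := mul_le_mul_of_nonneg_right hl (by positivity)
    have t5 : |16 / 105 * cf G * d - 8 / 15 * (6 - lam) * d| ≤ 16 / 105 * (1500 * e ^ 2) * |d| := by
      have : 16 / 105 * cf G * d - 8 / 15 * (6 - lam) * d = 16 / 105 * (cf G - 7 / 2 * (6 - lam)) * d := by ring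
      rw [this, abs_mul, abs_mul, abs_of_pos (by norm_num : (0:ℝ) < 16 / 105)]
      rw [he2] at c
      gcongr
    have := abs_sub_le (I (fun x => G x * D x)) (16 / 105 * cf G * d) (8 / 15 * (6 - lam) * d)
    have t6 : 0 ≤ e ^ 2 * |d| := by positivity
    linarith
  have f1 := hR a1 r1 c1 b1
  have f2 := hR a2 r2 c2 b2
  have hd0 : d = 0 := by
    by_contra hne
    have hpos := abs_pos.2 hne
    have k : |(6 - lam) * d| = e * |d| := by rw [abs_mul, he, abs_sub_comm]
    have k1 : |4 / 15 * ((6 - lam) * d)| ≤ 1000 * e ^ 2 * |d| := by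
      rw [abs_le] at f1 f2 ⊢
      constructor <;> linarith [f1.1, f1.2, f2.1, f2.2]
    rw [abs_mul, k, abs_of_pos (by norm_num : (0:ℝ) < 4 / 15)] at k1
    have : 0 < e * |d| := mul_pos hl0 hpos
    have := mul_le_mul_of_nonneg_right hl this.le
    linarith
  rw [hd0, abs_zero, mul_zero] at m1
  intro x hx
  have := L.zD.zero (le_antisymm m1 hn0) x hx
  simp only [hp] at this
  linarith

end MF

namespace MF
open Set Filter Topology

section radial

variable {W : ℝ × ℝ → ℝ}

/-- radial derivative along the first axis -/
def rad (W : ℝ × ℝ → ℝ) (t : ℝ) : ℝ := fderiv ℝ W (t, 0) (1, 0)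

lemma hasDerivAt_axis (hW : ContDiff ℝ 2 W) (t : ℝ) : HasDerivAt (fun t => W (t, 0)) (rad W t) t := by
  have h1 : HasFDerivAt W (fderiv ℝ W (t, 0)) (t, 0) :=
    (hW.differentiable (by norm_num) _).hasFDerivAt
  exact h1.comp_hasDerivAt t ((hasDerivAt_id t).prodMk (hasDerivAt_const t (0:ℝ)))

lemma diff_fderiv (hW : ContDiff ℝ 2 W) : Differentiable ℝ (fderiv ℝ W) :=
  (hW.fderiv_right (m := 1) (by norm_num)).differentiable (by norm_num)

lemma rad_cont (hW : ContDiff ℝ 2 W) : Continuous (rad W) := by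
  have := (diff_fderiv hW).continuous
  unfold rad
  fun_prop

lemma angular (hW : ContDiff ℝ 2 W)
    (hr : ∀ y z : ℝ × ℝ, y.1 ^ 2 + y.2 ^ 2 = z.1 ^ 2 + z.2 ^ 2 → W y = W z) (a b : ℝ) :
    fderiv ℝ W (a, b) (-b, a) = 0 := by
  have h1 : HasFDerivAt W (fderiv ℝ W (a, b)) (a, b) :=
    (hW.differentiable (by norm_num) _).hasFDerivAt
  have c1 : HasDerivAt (fun θ : ℝ => a * cos θ - b * sin θ) (-b) 0 := by
    refine (((hasDerivAt_cos 0).const_mul a).sub ((hasDerivAt_sin 0).const_mul b)).congr_deriv (by simp)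
  have c2 : HasDerivAt (fun θ : ℝ => a * sin θ + b * cos θ) a 0 := by
    refine (((hasDerivAt_sin 0).const_mul a).add ((hasDerivAt_cos 0).const_mul b)).congr_deriv (by simp)
  have h2 := HasFDerivAt.comp_hasDerivAt_of_eq (0:ℝ) h1 (c1.prodMk c2) (by simp)
  have h3 : (W ∘ fun θ : ℝ => (a * cos θ - b * sin θ, a * sin θ + b * cos θ)) = fun _ => W (a, b) := by
    funext θ
    apply hr
    simp only
    linear_combination (a ^ 2 + b ^ 2) * sin_sq_add_cos_sq θ
  rw [h3] at h2
  exact h2.unique (hasDerivAt_const _ _)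

lemma radial_lap (hW : ContDiff ℝ 2 W)
    (hr : ∀ y z : ℝ × ℝ, y.1 ^ 2 + y.2 ^ 2 = z.1 ^ 2 + z.2 ^ 2 → W y = W z) (t : ℝ) :
    HasDerivAt (fun t => t * rad W t) (t * lap W (t, 0)) t := by
  have h1 : HasFDerivAt (fderiv ℝ W) (fderiv ℝ (fderiv ℝ W) (t, 0)) (t, 0) :=
    (diff_fderiv hW _).hasFDerivAt
  have hx : HasDerivAt (fun t : ℝ => (t, (0:ℝ))) (1, 0) t := (hasDerivAt_id t).prodMk (hasDerivAt_const t (0:ℝ))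
  have hy : HasDerivAt (fun s : ℝ => (t, s)) (0, 1) 0 := (hasDerivAt_const (0:ℝ) t).prodMk (hasDerivAt_id 0)
  have d1 : HasDerivAt (fun t => fderiv ℝ W (t, 0)) (fderiv ℝ (fderiv ℝ W) (t, 0) (1, 0)) t :=
    h1.comp_hasDerivAt t hx
  have d2 : HasDerivAt (fun s => fderiv ℝ W (t, s)) (fderiv ℝ (fderiv ℝ W) (t, 0) (0, 1)) 0 :=
    HasFDerivAt.comp_hasDerivAt_of_eq (0:ℝ) h1 hy rfl
  have e1 : HasDerivAt (rad W) (fderiv ℝ (fderiv ℝ W) (t, 0) (1, 0) (1, 0)) t :=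
    (d1.clm_apply (hasDerivAt_const t ((1:ℝ), (0:ℝ)))).congr_deriv (by simp)
  have e2 : HasDerivAt (fun s => fderiv ℝ W (t, s) (1, 0)) (fderiv ℝ (fderiv ℝ W) (t, 0) (0, 1) (1, 0)) 0 :=
    (d2.clm_apply (hasDerivAt_const 0 ((1:ℝ), (0:ℝ)))).congr_deriv (by simp)
  have e3 : HasDerivAt (fun s => fderiv ℝ W (t, s) (0, 1)) (fderiv ℝ (fderiv ℝ W) (t, 0) (0, 1) (0, 1)) 0 :=
    (d2.clm_apply (hasDerivAt_const 0 ((0:ℝ), (1:ℝ)))).congr_deriv (by simp)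
  have e4 : (fun s => -(s * fderiv ℝ W (t, s) (1, 0)) + t * fderiv ℝ W (t, s) (0, 1)) = fun _ => 0 := by
    funext s
    have := angular hW hr t s
    have k : ((-s, t) : ℝ × ℝ) = (-s) • ((1:ℝ), (0:ℝ)) + t • ((0:ℝ), (1:ℝ)) := by simp
    rw [k, map_add, map_smul, map_smul, smul_eq_mul, smul_eq_mul] at this
    linarith
  have e5 := (((hasDerivAt_id (0:ℝ)).mul e2).neg).add (e3.const_mul t)
  have e6 := e5.unique (by
    have : HasDerivAt (fun _ : ℝ => (0:ℝ)) 0 0 := hasDerivAt_const _ _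
    rw [← e4] at this
    exact this)
  simp only [id] at e6
  refine ((hasDerivAt_id t).mul e1).congr_deriv ?_
  rw [lap, iteratedFDeriv_two_apply, iteratedFDeriv_two_apply]
  simp only [id, rad, Matrix.cons_val_zero, Matrix.cons_val_one]
  linarith

end radial

/-- the radius corresponding to the height `x` -/
def rho (x : ℝ) : ℝ := √((1 + x) / (1 - x))

lemma rho_sq {x : ℝ} (hx : x ∈ Ioo (-1:ℝ) 1) : rho x ^ 2 = (1 + x) / (1 - x) :=
  sq_sqrt (div_nonneg (by linarith [hx.1]) (by linarith [hx.2]))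

lemma rho_pos {x : ℝ} (hx : x ∈ Ioo (-1:ℝ) 1) : 0 < rho x :=
  sqrt_pos.2 (div_pos (by linarith [hx.1]) (by linarith [hx.2]))

lemma rho_neg {x : ℝ} : rho (-x) = 1 / rho x := by
  unfold rho
  rw [one_div, ← Real.sqrt_inv, inv_div]
  congr 1
  ring

lemma hasDerivAt_rho {x : ℝ} (hx : x ∈ Ioo (-1:ℝ) 1) : HasDerivAt rho (rho x / (1 - x ^ 2)) x := by
  have h1 : (1 - x) ≠ 0 := by linarith [hx.2]
  have h2 : (1 + x) ≠ 0 := by linarith [hx.1]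
  have h3 : HasDerivAt (fun x : ℝ => (1 + x) / (1 - x)) (2 / (1 - x) ^ 2) x := by
    refine (((hasDerivAt_id x).const_add 1).div ((hasDerivAt_id x).const_sub 1) h1).congr_deriv ?_
    simp only [id]; ring
  refine (h3.sqrt (div_ne_zero h2 h1)).congr_deriv ?_
  have hp := (rho_pos hx).ne'
  have hs := rho_sq hx
  change 2 / (1 - x) ^ 2 / (2 * rho x) = _
  have hq : 1 - x ^ 2 = (1 - x) * (1 + x) := by ring
  rw [hq]
  field_simp
  rw [hs]
  field_simp

lemma rho_tendsto : Tendsto rho (𝓝[>] (-1)) (𝓝 0) := by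
  have h : ContinuousAt rho (-1) := by
    unfold rho
    refine ContinuousAt.sqrt (ContinuousAt.div (by fun_prop) (by fun_prop) (by norm_num))
  have := h.tendsto
  have e : rho (-1) = 0 := by norm_num [rho]
  rw [e] at this
  exact this.mono_left nhdsWithin_le_nhds

def pt (x : ℝ) : Fin 3 → ℝ := ![√(1 - (max (-1) (min 1 x)) ^ 2), 0, max (-1) (min 1 x)]

lemma pt_mem (x : ℝ) : pt x ∈ sphere3 := by
  have h1 : -1 ≤ max (-1) (min 1 x) := le_max_left _ _
  have h2 : max (-1) (min 1 x) ≤ 1 := max_le (by norm_num) (min_le_left _ _)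
  have : √(1 - (max (-1) (min 1 x)) ^ 2) ^ 2 = 1 - (max (-1) (min 1 x)) ^ 2 := sq_sqrt (by nlinarith)
  simp only [pt, sphere3, Set.mem_ofPred_eq, Matrix.cons_val_zero, Matrix.cons_val_one, Matrix.cons_val]
  rw [this]; ring

lemma pt_cont : Continuous pt := by
  unfold pt
  refine continuous_pi fun i => ?_
  fin_cases i <;> simp <;> fun_prop

lemma pt_two {x : ℝ} (hx : x ∈ Icc (-1:ℝ) 1) : pt x 2 = x := by
  simp [pt, hx.1, hx.2]

lemma N_mem (y : ℝ × ℝ) : stereoN y ∈ sphere3 := by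
  have : 1 + y.1 ^ 2 + y.2 ^ 2 ≠ 0 := by positivity
  simp only [stereoN, sphere3, Set.mem_ofPred_eq, Matrix.cons_val_zero, Matrix.cons_val_one, Matrix.cons_val]
  field_simp; ring

lemma S_mem (y : ℝ × ℝ) : stereoS y ∈ sphere3 := by
  have : 1 + y.1 ^ 2 + y.2 ^ 2 ≠ 0 := by positivity
  simp only [stereoS, sphere3, Set.mem_ofPred_eq, Matrix.cons_val_zero, Matrix.cons_val_one, Matrix.cons_val]
  field_simp; ring

lemma N_two (y : ℝ × ℝ) : stereoN y 2 = (y.1 ^ 2 + y.2 ^ 2 - 1) / (1 + y.1 ^ 2 + y.2 ^ 2) := by simp [stereoN]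
lemma S_two (y : ℝ × ℝ) : stereoS y 2 = (1 - y.1 ^ 2 - y.2 ^ 2) / (1 + y.1 ^ 2 + y.2 ^ 2) := by simp [stereoS]

lemma N_rho {x : ℝ} (hx : x ∈ Ioo (-1:ℝ) 1) : stereoN (rho x, 0) 2 = x := by
  rw [N_two]
  simp only [rho_sq hx]
  have : 1 - x ≠ 0 := by linarith [hx.2]
  rw [div_eq_iff (by
    have := rho_sq hx ▸ sq_nonneg (rho x)
    positivity)]
  field_simp
  ring

theorem toSol {lam : ℝ} (hl : 0 < lam) {u : (Fin 3 → ℝ) → ℝ} (hu : IsMFSolution lam u)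
    (hs : ∀ x ∈ sphere3, ∀ x' ∈ sphere3, x 2 = x' 2 → u x = u x') :
    ∃ G, Sol lam G (fun x => lam * (1 - exp (u (pt x)))) := by
  obtain ⟨hc, hN, hS, eN, eS⟩ := hu
  have hNr : ∀ y z : ℝ × ℝ, y.1 ^ 2 + y.2 ^ 2 = z.1 ^ 2 + z.2 ^ 2 → u (stereoN y) = u (stereoN z) := by
    intro y z h
    apply hs _ (N_mem _) _ (N_mem _)
    rw [N_two, N_two, add_assoc, h, add_assoc]
  have hSr : ∀ y z : ℝ × ℝ, y.1 ^ 2 + y.2 ^ 2 = z.1 ^ 2 + z.2 ^ 2 → u (stereoS y) = u (stereoS z) := by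
    intro y z h
    apply hs _ (S_mem _) _ (S_mem _)
    rw [S_two, S_two, add_assoc, h, add_assoc, sub_sub, h, sub_sub]
  have kN := radial_lap hN hNr
  have aN := hasDerivAt_axis hN
  have aS := hasDerivAt_axis hS
  have cN := rad_cont hN
  have cS := rad_cont hS
  set WN := fun y => u (stereoN y) with hWN
  set WS := fun y => u (stereoS y) with hWS
  set v := fun x => u (pt x) with hv
  have hvc : Continuous v := hc.comp_continuous pt_cont pt_mem
  have hvN : ∀ x ∈ Ioo (-1:ℝ) 1, v x = WN (rho x, 0) := fun x hx =>
    hs _ (pt_mem _) _ (N_mem _) (by rw [pt_two (Ioo_subset_Icc_self hx), N_rho hx])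
  -- derivative of v
  have hvd : ∀ x ∈ Ioo (-1:ℝ) 1, HasDerivAt v (rho x * rad WN (rho x) / (1 - x ^ 2)) x := by
    intro x hx
    have h1 := (aN (rho x)).comp x (hasDerivAt_rho hx)
    refine (h1.congr_of_eventuallyEq ?_).congr_deriv (by ring)
    filter_upwards [Ioo_mem_nhds hx.1 hx.2] with y hy using hvN y hy
  set g := fun x => lam * (1 - exp (v x)) with hg
  have hgc : Continuous g := by fun_prop
  have hkd : ∀ x ∈ Ioo (-1:ℝ) 1, HasDerivAt (fun x => rho x * rad WN (rho x)) (g x) x := by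
    intro x hx
    refine ((kN (rho x)).comp x (hasDerivAt_rho hx)).congr_deriv ?_
    rw [eN, hg]
    have e := hvN x hx
    simp only [hWN] at e
    simp only
    rw [← e]
    have h1 : 1 - x ≠ 0 := by linarith [hx.2]
    have h2 : 1 + x ≠ 0 := by linarith [hx.1]
    have h3 : 1 - x ^ 2 = (1 - x) * (1 + x) := by ring
    have h4 : (1 + rho x ^ 2 + 0 ^ 2) = 2 / (1 - x) := by rw [rho_sq hx]; field_simp; ring
    rw [h4, h3]
    have h5 : ∀ E : ℝ, rho x * (4 * lam * E / (2 / (1 - x)) ^ 2) * (rho x / ((1 - x) * (1 + x)))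
      = rho x ^ 2 * (lam * E * (1 - x) / (1 + x)) := by
      intro E; field_simp; ring
    rw [h5, rho_sq hx]
    field_simp
  have lim1 : Tendsto (fun x => rho x * rad WN (rho x)) (𝓝[>] (-1)) (𝓝 0) := by
    have : Continuous fun t => t * rad WN t := by fun_prop
    have := (this.tendsto 0).comp rho_tendsto
    simp only [zero_mul] at this
    exact this
  have lim2 : Tendsto (fun x => rho x * rad WN (rho x)) (𝓝[<] 1) (𝓝 0) := by
    have h0 : Continuous fun t => -(t * rad WS t) := by fun_prop
    have h1 : Tendsto (fun x : ℝ => -x) (𝓝[<] 1) (𝓝[>] (-1)) := tendsto_neg_nhdsLT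
    have h2 := ((h0.tendsto 0).comp (rho_tendsto.comp h1))
    simp only [zero_mul, neg_zero] at h2
    refine h2.congr' ?_
    filter_upwards [Ioo_mem_nhdsLT (show (-1:ℝ) < 1 by norm_num)] with x hx
    simp only [Function.comp]
    rw [rho_neg]
    have hp := rho_pos hx
    generalize rho x = t at hp
    have e : (fun t => WN (t, 0)) =ᶠ[𝓝 t] fun t => WS (t⁻¹, 0) := by
      filter_upwards [lt_mem_nhds hp] with s hs0
      apply hs _ (N_mem _) _ (S_mem _)
      rw [N_two, S_two]
      simp only
      field_simp
      ring
    have d1 := aN t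
    have d2 := (aS t⁻¹).comp t (hasDerivAt_inv hp.ne')
    have := d1.unique (d2.congr_of_eventuallyEq e)
    rw [this]
    simp only [one_div]
    field_simp
  have G1 : I g = 0 := by
    have := intervalIntegral.integral_eq_sub_of_hasDerivAt_of_tendsto (by norm_num) hkd
      (hgc.intervalIntegrable _ _) lim1 lim2
    simpa [I] using this
  have Gx : ∀ x ∈ Ioo (-1:ℝ) 1, ∫ t in (-1:ℝ)..x, g t = rho x * rad WN (rho x) := by
    intro x hx
    have := intervalIntegral.integral_eq_sub_of_hasDerivAt_of_tendsto hx.1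
      (fun y hy => hkd y ⟨hy.1, hy.2.trans hx.2⟩)
      (hgc.intervalIntegrable _ _) lim1 ((hkd x hx).continuousAt.tendsto.mono_left nhdsWithin_le_nhds)
    simpa using this
  refine ⟨fun x => ∫ t in (-1:ℝ)..x, g t, prim_Z hgc G1, fun x hx => ?_, fun x _ => ?_⟩
  · simp only [Gx x hx]
    refine (((hvd x hx).exp.const_sub 1).const_mul lam).congr_deriv ?_
    simp only [hg]
    ring
  · have := exp_pos (v x)
    simp only [hg]
    nlinarith

end MF

/-- There is `δ₀ > 0` such that for `0 < |λ - 6| < δ₀`, any two nonzero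
solutions of the mean field equation on `S²` depending only on `x₃` coincide on `S²`. -/
theorem uniqueness_nonzero_axisym_solution_near_six :
    ∃ δ₀ > (0 : ℝ), ∀ lam : ℝ, 0 < |lam - 6| → |lam - 6| < δ₀ →
      ∀ u₁ u₂ : (Fin 3 → ℝ) → ℝ,
        IsMFSolution lam u₁ → IsMFSolution lam u₂ →
        (∃ x ∈ sphere3, u₁ x ≠ 0) → (∃ x ∈ sphere3, u₂ x ≠ 0) →
        (∀ x ∈ sphere3, ∀ x' ∈ sphere3, x 2 = x' 2 → u₁ x = u₁ x') →
        (∀ x ∈ sphere3, ∀ x' ∈ sphere3, x 2 = x' 2 → u₂ x = u₂ x') →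
        ∀ x ∈ sphere3, u₁ x = u₂ x := by
  refine ⟨1 / 100000, by norm_num, fun lam h0 h1 u₁ u₂ hu₁ hu₂ n₁ n₂ s₁ s₂ x hx => ?_⟩
  have hl : 0 < lam := by linarith [(abs_lt.1 h1).1]
  obtain ⟨G₁, S₁⟩ := MF.toSol hl hu₁ s₁
  obtain ⟨G₂, S₂⟩ := MF.toSol hl hu₂ s₂
  have hI : ∀ y ∈ sphere3, y 2 ∈ Set.Icc (-1:ℝ) 1 := by
    intro y hy
    have hy' : y 0 ^ 2 + y 1 ^ 2 + y 2 ^ 2 = 1 := hy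
    constructor <;> nlinarith [sq_nonneg (y 0), sq_nonneg (y 1)]
  have hpt : ∀ u : (Fin 3 → ℝ) → ℝ,
      (∀ x ∈ sphere3, ∀ x' ∈ sphere3, x 2 = x' 2 → u x = u x') →
      ∀ y ∈ sphere3, u (MF.pt (y 2)) = u y := fun u s y hy =>
    s _ (MF.pt_mem _) _ hy (MF.pt_two (hI y hy))
  have hne : ∀ u : (Fin 3 → ℝ) → ℝ,
      (∀ x ∈ sphere3, ∀ x' ∈ sphere3, x 2 = x' 2 → u x = u x') →
      (∃ x ∈ sphere3, u x ≠ 0) →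
      ∃ t ∈ Set.Icc (-1:ℝ) 1, lam * (1 - Real.exp (u (MF.pt t))) ≠ 0 := by
    rintro u s ⟨y, hy, h⟩
    refine ⟨y 2, hI y hy, ?_⟩
    rw [hpt u s y hy]
    refine mul_ne_zero hl.ne' fun h2 => h ?_
    exact Real.exp_eq_one_iff _ |>.1 (by linarith)
  have key := S₁.unique S₂ h0 h1.le (hne u₁ s₁ n₁) (hne u₂ s₂ n₂) (x 2) (hI x hx)
  rw [hpt u₁ s₁ x hx, hpt u₂ s₂ x hx] at key
  have := mul_left_cancel₀ hl.ne' key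
  exact Real.exp_injective (by linarith)
end
end

section
/- Let 0 < α < 1 and let u be a solution of the mean field equation Δu = λ(1−e^u) on S² with λ = 2/α. Define v : ℝ² → ℝ by v(y) = ū(y) − 2 ln(1+|y|²) + ln(8/α), where ū(y) = u(Π⁻¹(y)). Then v is twice continuously differentiable, Δv(y) + e^{v(y)} = 8(1−α)/(α(1+|y|²)²) > 0 for all y ∈ ℝ², and ∫_{ℝ²} e^{v(y)} dy = 8π/α. -/
open Real MeasureTheory

noncomputable section

open Filter Topology Set

lemma second_eq (f : ℝ × ℝ → ℝ) (hf : ContDiff ℝ 2 f) (y v : ℝ × ℝ) :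
    iteratedFDeriv ℝ 2 f y ![v, v] = fderiv ℝ (fun z => fderiv ℝ f z v) y v := by
  rw [iteratedFDeriv_two_apply]
  have hd : DifferentiableAt ℝ (fderiv ℝ f) y :=
    ((hf.fderiv_right (m := 1) (by norm_num)).differentiable (by norm_num)) y
  rw [fderiv_clm_apply hd (differentiableAt_const v)]
  simp

lemma contDiff_dir (f : ℝ × ℝ → ℝ) (hf : ContDiff ℝ 2 f) (v : ℝ × ℝ) :
    ContDiff ℝ 1 (fun z => fderiv ℝ f z v) :=
  (hf.fderiv_right (m := 1) (by norm_num)).clm_apply contDiff_const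

lemma cont_second (f : ℝ × ℝ → ℝ) (hf : ContDiff ℝ 2 f) (v : ℝ × ℝ) :
    Continuous (fun z => iteratedFDeriv ℝ 2 f z ![v, v]) := by
  simp_rw [second_eq f hf]
  exact ((contDiff_dir f hf v).continuous_fderiv (by norm_num)).clm_apply continuous_const

lemma cont_lap (f : ℝ × ℝ → ℝ) (hf : ContDiff ℝ 2 f) : Continuous (lap f) :=
  (cont_second f hf _).add (cont_second f hf _)

lemma compSupp_second (f : ℝ × ℝ → ℝ) (hf : HasCompactSupport f) (v : ℝ × ℝ) :
    HasCompactSupport (fun z => iteratedFDeriv ℝ 2 f z ![v, v]) := by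
  have := hf.iteratedFDeriv (𝕜 := ℝ) 2
  exact this.comp_left (g := fun L => L ![v, v]) (by simp)

lemma compSupp_lap (f : ℝ × ℝ → ℝ) (hf : HasCompactSupport f) : HasCompactSupport (lap f) :=
  (compSupp_second f hf _).add (compSupp_second f hf _)

lemma ibp_dir (f g : ℝ × ℝ → ℝ) (hf : ContDiff ℝ 2 f) (hg : ContDiff ℝ 2 g)
    (hc : HasCompactSupport g) (v : ℝ × ℝ) :
    ∫ y, iteratedFDeriv ℝ 2 f y ![v, v] * g y = ∫ y, f y * iteratedFDeriv ℝ 2 g y ![v, v] := by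
  have hc1 : HasCompactSupport (fun z => fderiv ℝ g z v) :=
    (hc.fderiv ℝ).comp_left (g := fun L : ℝ × ℝ →L[ℝ] ℝ => L v) (by simp)
  have hc2 := compSupp_second g hc v
  have c2f := cont_second f hf v
  have c2g := cont_second g hg v
  simp_rw [second_eq f hf, second_eq g hg] at *
  have d1f := contDiff_dir f hf v
  have d1g := contDiff_dir g hg v
  have i1 : Integrable (fun y => fderiv ℝ f y v * fderiv ℝ g y v) :=
    (d1f.continuous.mul d1g.continuous).integrable_of_hasCompactSupport hc1.mul_left
  rw [integral_mul_fderiv_eq_neg_fderiv_mul_of_integrable (f := f)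
    (g := fun z => fderiv ℝ g z v) i1
    ((hf.continuous.mul c2g).integrable_of_hasCompactSupport hc2.mul_left)
    ((hf.continuous.mul d1g.continuous).integrable_of_hasCompactSupport hc1.mul_left)
    (fun x _ => hf.differentiable (by norm_num) x) (fun x _ => d1g.differentiable (by norm_num) x)]
  rw [integral_mul_fderiv_eq_neg_fderiv_mul_of_integrable (f := fun z => fderiv ℝ f z v)
    (g := g)
    ((c2f.mul hg.continuous).integrable_of_hasCompactSupport hc.mul_left) i1
    ((d1f.continuous.mul hg.continuous).integrable_of_hasCompactSupport hc.mul_left)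
    (fun x _ => d1f.differentiable (by norm_num) x) (fun x _ => hg.differentiable (by norm_num) x)]
  simp

lemma ibp_lap (f g : ℝ × ℝ → ℝ) (hf : ContDiff ℝ 2 f) (hg : ContDiff ℝ 2 g)
    (hc : HasCompactSupport g) :
    ∫ y, lap f y * g y = ∫ y, f y * lap g y := by
  simp only [lap, add_mul, mul_add]
  rw [integral_add, integral_add, ibp_dir f g hf hg hc, ibp_dir f g hf hg hc]
  · exact (hf.continuous.mul (cont_second g hg _)).integrable_of_hasCompactSupport
      (compSupp_second g hc _).mul_left
  · exact (hf.continuous.mul (cont_second g hg _)).integrable_of_hasCompactSupport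
      (compSupp_second g hc _).mul_left
  · exact ((cont_second f hf _).mul hg.continuous).integrable_of_hasCompactSupport hc.mul_left
  · exact ((cont_second f hf _).mul hg.continuous).integrable_of_hasCompactSupport hc.mul_left

lemma lap_scale (f : ℝ × ℝ → ℝ) (hf : ContDiff ℝ 2 f) (a : ℝ) (y : ℝ × ℝ) :
    lap (fun z => f (a • z)) y = a ^ 2 * lap f (a • y) := by
  simp only [lap]
  rw [iteratedFDeriv_comp_const_smul (i := 2) a hf]
  simp [mul_add]

lemma int_lap_zero (g : ℝ × ℝ → ℝ) (hg : ContDiff ℝ 2 g) (M : ℝ) (hM : ∀ y, |g y| ≤ M)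
    (hlim : ∀ z : ℝ × ℝ, z ≠ 0 → Tendsto (fun n : ℕ => g (((n : ℝ) + 1) • z)) atTop (𝓝 0))
    (hInt : Integrable (lap g)) : ∫ y, lap g y = 0 := by
  let φ : ContDiffBump (0 : ℝ × ℝ) := ⟨1, 2, by norm_num, by norm_num⟩
  have hφ : ContDiff ℝ 2 φ := φ.contDiff
  have hφc : HasCompactSupport φ := φ.hasCompactSupport
  have hcl := cont_lap φ hφ
  have hicl : Integrable (lap φ) :=
    hcl.integrable_of_hasCompactSupport (compSupp_lap φ hφc)
  have key : ∀ n : ℕ, ∫ y, lap g y * φ (((n : ℝ) + 1)⁻¹ • y)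
      = ∫ z, g (((n : ℝ) + 1) • z) * lap φ z := by
    intro n
    have hn : (0 : ℝ) < (n : ℝ) + 1 := by positivity
    have hs : ContDiff ℝ 2 (fun y : ℝ × ℝ => φ (((n : ℝ) + 1)⁻¹ • y)) :=
      hφ.comp (contDiff_const_smul _)
    rw [ibp_lap g (fun y => φ (((n : ℝ) + 1)⁻¹ • y)) hg hs
      (hφc.comp_smul (inv_ne_zero hn.ne'))]
    simp_rw [lap_scale φ hφ]
    have h := Measure.integral_comp_inv_smul (volume : Measure (ℝ × ℝ))
      (fun z => g (((n : ℝ) + 1) • z) * lap φ z) ((n : ℝ) + 1)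
    have hfr : Module.finrank ℝ (ℝ × ℝ) = 2 := by simp
    rw [hfr, abs_of_pos (by positivity), smul_eq_mul] at h
    have h2 : ∀ y : ℝ × ℝ, g y * ((((n : ℝ) + 1)⁻¹) ^ 2 * lap φ (((n : ℝ) + 1)⁻¹ • y))
      = (((n : ℝ) + 1)⁻¹) ^ 2 *
        (g (((n : ℝ) + 1) • ((n : ℝ) + 1)⁻¹ • y) * lap φ (((n : ℝ) + 1)⁻¹ • y)) := by
      intro y
      rw [smul_inv_smul₀ hn.ne']
      ring
    simp_rw [h2]
    rw [integral_const_mul, h, ← mul_assoc, ← mul_pow, inv_mul_cancel₀ hn.ne']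
    simp
  have t1 : Tendsto (fun n : ℕ => ∫ y, lap g y * φ (((n : ℝ) + 1)⁻¹ • y)) atTop
      (𝓝 (∫ y, lap g y)) := by
    apply tendsto_integral_of_dominated_convergence (fun y => ‖lap g y‖)
    · intro n
      exact ((cont_lap g hg).mul
        (hφ.continuous.comp (continuous_const_smul _))).aestronglyMeasurable
    · exact hInt.norm
    · intro n
      refine ae_of_all _ fun y => ?_
      rw [norm_mul]
      have : ‖φ (((n : ℝ) + 1)⁻¹ • y)‖ ≤ 1 := by
        rw [Real.norm_of_nonneg φ.nonneg]; exact φ.le_one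
      exact mul_le_of_le_one_right (norm_nonneg _) this
    · refine ae_of_all _ fun y => ?_
      have h0 : Tendsto (fun n : ℕ => ((n : ℝ) + 1)⁻¹ • y) atTop (𝓝 ((0 : ℝ) • y)) := by
        apply Tendsto.smul_const
        simpa using tendsto_one_div_add_atTop_nhds_zero_nat (𝕜 := ℝ)
      rw [zero_smul] at h0
      have h1 := (hφ.continuous.tendsto 0).comp h0
      have h2 : φ (0 : ℝ × ℝ) = 1 := φ.one_of_mem_closedBall (by simp [φ])
      rw [h2] at h1
      simpa using h1.const_mul (lap g y)
  have t2 : Tendsto (fun n : ℕ => ∫ z, g (((n : ℝ) + 1) • z) * lap φ z) atTop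
      (𝓝 (∫ _z : ℝ × ℝ, (0 : ℝ))) := by
    apply tendsto_integral_of_dominated_convergence (fun y => M * ‖lap φ y‖)
    · intro n
      exact ((hg.continuous.comp (continuous_const_smul _)).mul hcl).aestronglyMeasurable
    · exact hicl.norm.const_mul _
    · intro n
      refine ae_of_all _ fun y => ?_
      rw [norm_mul]
      exact mul_le_mul_of_nonneg_right (hM _) (norm_nonneg _)
    · have : ∀ᵐ z : ℝ × ℝ, z ≠ 0 := by
        simp [ae_iff]
      filter_upwards [this] with z hz
      simpa using (hlim z hz).mul_const (lap φ z)
  simp_rw [key] at t1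
  simpa using tendsto_nhds_unique t1 t2

lemma integral_conf : ∫ y : ℝ × ℝ, 1 / (1 + y.1 ^ 2 + y.2 ^ 2) ^ 2 = π := by
  rw [← integral_comp_polarCoord_symm]
  have e : ∀ p : ℝ × ℝ, p.1 • (1 / (1 + (polarCoord.symm p).1 ^ 2 + (polarCoord.symm p).2 ^ 2) ^ 2)
      = (p.1 / (1 + p.1 ^ 2) ^ 2) * 1 := by
    intro p
    have : 1 + (polarCoord.symm p).1 ^ 2 + (polarCoord.symm p).2 ^ 2 = 1 + p.1 ^ 2 := by
      simp only [polarCoord_symm_apply]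
      linear_combination p.1 ^ 2 * (Real.sin_sq_add_cos_sq p.2)
    rw [this, smul_eq_mul]; ring
  simp_rw [e]
  have ht : polarCoord.target = Ioi (0 : ℝ) ×ˢ Ioo (-π) π := rfl
  rw [ht, Measure.volume_eq_prod,
    setIntegral_prod_mul (fun r : ℝ => r / (1 + r ^ 2) ^ 2) (fun _ : ℝ => (1 : ℝ))]
  have h1 : ∫ r in Ioi (0 : ℝ), r / (1 + r ^ 2) ^ 2 = 1 / 2 := by
    have hd : ∀ x ∈ Ici (0 : ℝ), HasDerivAt (fun r : ℝ => -(1 / 2) * (1 + r ^ 2)⁻¹)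
        (x / (1 + x ^ 2) ^ 2) x := by
      intro x _
      have hx : 1 + x ^ 2 ≠ 0 := by positivity
      have := (((hasDerivAt_pow 2 x).const_add 1).inv hx).const_mul (-(1 / 2 : ℝ))
      refine HasDerivAt.congr_deriv this ?_
      simp
      ring
    have hlim : Tendsto (fun r : ℝ => -(1 / 2) * (1 + r ^ 2)⁻¹) atTop (𝓝 0) := by
      have : Tendsto (fun r : ℝ => 1 + r ^ 2) atTop atTop :=
        tendsto_atTop_add_const_left _ _ (tendsto_pow_atTop (by norm_num))
      simpa using this.inv_tendsto_atTop.const_mul (-(1 / 2 : ℝ))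
    rw [integral_Ioi_of_hasDerivAt_of_tendsto' hd
      (integrableOn_Ioi_deriv_of_nonneg' hd (fun x hx => by
        have : 0 < x := hx
        positivity) hlim) hlim]
    norm_num
  rw [h1]
  simp [Real.pi_pos.le]
  ring

lemma integrable_conf : Integrable (fun y : ℝ × ℝ => 1 / (1 + y.1 ^ 2 + y.2 ^ 2) ^ 2) :=
  Integrable.of_integral_ne_zero (by rw [integral_conf]; exact Real.pi_ne_zero)

lemma contDiff_log : ContDiff ℝ 2 (fun y : ℝ × ℝ => Real.log (1 + y.1 ^ 2 + y.2 ^ 2)) := by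
  apply ContDiff.log
  · fun_prop
  · intro x; positivity

lemma hasF (z : ℝ × ℝ) : HasFDerivAt (fun y : ℝ × ℝ => 1 + y.1 ^ 2 + y.2 ^ 2)
    ((2 * z.1) • ContinuousLinearMap.fst ℝ ℝ ℝ + (2 * z.2) • ContinuousLinearMap.snd ℝ ℝ ℝ) z := by
  have h1 : HasFDerivAt (fun y : ℝ × ℝ => y.1) (ContinuousLinearMap.fst ℝ ℝ ℝ) z := hasFDerivAt_fst
  have h2 : HasFDerivAt (fun y : ℝ × ℝ => y.2) (ContinuousLinearMap.snd ℝ ℝ ℝ) z := hasFDerivAt_snd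
  have := ((h1.pow 2).const_add 1).add (h2.pow 2)
  exact HasFDerivAt.congr_fderiv this (by ext <;> simp)

lemma lap_log (y : ℝ × ℝ) :
    lap (fun z : ℝ × ℝ => Real.log (1 + z.1 ^ 2 + z.2 ^ 2)) y
      = 4 / (1 + y.1 ^ 2 + y.2 ^ 2) ^ 2 := by
  have hp : ∀ z : ℝ × ℝ, 1 + z.1 ^ 2 + z.2 ^ 2 ≠ 0 := fun z => by positivity
  have d1 : ∀ z v : ℝ × ℝ, fderiv ℝ (fun z : ℝ × ℝ => Real.log (1 + z.1 ^ 2 + z.2 ^ 2)) z v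
      = (1 + z.1 ^ 2 + z.2 ^ 2)⁻¹ * (2 * z.1 * v.1 + 2 * z.2 * v.2) := by
    intro z v
    rw [((hasF z).log (hp z)).fderiv]
    simp
    ring
  have d2 : ∀ z v : ℝ × ℝ, fderiv ℝ (fun z : ℝ × ℝ =>
      (1 + z.1 ^ 2 + z.2 ^ 2)⁻¹ * (2 * z.1 * v.1 + 2 * z.2 * v.2)) z v
      = (1 + z.1 ^ 2 + z.2 ^ 2)⁻¹ * (2 * v.1 * v.1 + 2 * v.2 * v.2)
        - (2 * z.1 * v.1 + 2 * z.2 * v.2) ^ 2 / (1 + z.1 ^ 2 + z.2 ^ 2) ^ 2 := by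
    intro z v
    have hi := (hasDerivAt_inv (hp z)).comp_hasFDerivAt z (hasF z)
    have h1 : HasFDerivAt (fun y : ℝ × ℝ => 2 * y.1 * v.1 + 2 * y.2 * v.2)
        ((2 * v.1) • ContinuousLinearMap.fst ℝ ℝ ℝ + (2 * v.2) • ContinuousLinearMap.snd ℝ ℝ ℝ)
        z := by
      have := ((2 * v.1) • ContinuousLinearMap.fst ℝ ℝ ℝ
        + (2 * v.2) • ContinuousLinearMap.snd ℝ ℝ ℝ).hasFDerivAt (x := z)
      convert this using 1
      ext y
      simp
      ring
    have : HasFDerivAt (fun z : ℝ × ℝ =>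
      (1 + z.1 ^ 2 + z.2 ^ 2)⁻¹ * (2 * z.1 * v.1 + 2 * z.2 * v.2)) _ z := hi.mul h1
    rw [HasFDerivAt.fderiv this]
    simp
    ring
  simp only [lap]
  rw [second_eq _ contDiff_log, second_eq _ contDiff_log]
  rw [funext fun z => d1 z (1, 0), funext fun z => d1 z (0, 1), d2, d2]
  have := hp y
  field_simp
  ring

lemma stereoN_mem (y : ℝ × ℝ) : stereoN y ∈ sphere3 := by
  have : 1 + y.1 ^ 2 + y.2 ^ 2 ≠ 0 := by positivity
  simp only [sphere3, stereoN, mem_ofPred_eq, Matrix.cons_val]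
  field_simp
  ring

lemma sphere3_compact : IsCompact sphere3 := by
  apply Metric.isCompact_of_isClosed_isBounded
  · exact isClosed_eq (by fun_prop) (by fun_prop)
  · refine (Metric.isBounded_closedBall (x := (0 : Fin 3 → ℝ)) (r := 1)).subset ?_
    intro x hx
    have hx' : x 0 ^ 2 + x 1 ^ 2 + x 2 ^ 2 = 1 := hx
    rw [mem_closedBall_zero_iff, pi_norm_le_iff_of_nonneg zero_le_one]
    intro i
    rw [Real.norm_eq_abs, ← sq_le_one_iff_abs_le_one]
    fin_cases i <;> simp only [Fin.mk_one, Fin.zero_eta, Fin.reduceFinMk] <;> nlinarith [sq_nonneg (x 0), sq_nonneg (x 1), sq_nonneg (x 2)]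

lemma stereo_inv (z : ℝ × ℝ) (hz : z ≠ 0) (t : ℝ) (ht : t ≠ 0) :
    stereoN (t • z) = stereoS (t⁻¹ • ((z.1 ^ 2 + z.2 ^ 2)⁻¹ • z)) := by
  have hs : z.1 ^ 2 + z.2 ^ 2 ≠ 0 := by
    intro h
    apply hz
    ext
    · simp; nlinarith [sq_nonneg z.1, sq_nonneg z.2]
    · simp; nlinarith [sq_nonneg z.1, sq_nonneg z.2]
  obtain ⟨a, b⟩ := z
  simp only [stereoN, stereoS, Prod.smul_mk, smul_eq_mul] at *
  have h1 : 1 + (t * a) ^ 2 + (t * b) ^ 2 ≠ 0 := by positivity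
  have h2 : 1 + (t⁻¹ * ((a ^ 2 + b ^ 2)⁻¹ * a)) ^ 2 + (t⁻¹ * ((a ^ 2 + b ^ 2)⁻¹ * b)) ^ 2
      = (1 + (t * a) ^ 2 + (t * b) ^ 2) / (t ^ 2 * (a ^ 2 + b ^ 2)) := by
    field_simp
    ring
  have h3 : 1 - (t⁻¹ * ((a ^ 2 + b ^ 2)⁻¹ * a)) ^ 2 - (t⁻¹ * ((a ^ 2 + b ^ 2)⁻¹ * b)) ^ 2
      = ((t * a) ^ 2 + (t * b) ^ 2 - 1) / (t ^ 2 * (a ^ 2 + b ^ 2)) := by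
    field_simp
    ring
  rw [h2, h3]
  congr 1
  · field_simp
  congr 1
  · field_simp
  congr 1
  · field_simp

/-- For a solution `u` of the mean field equation with `λ = 2/α`, `0 < α < 1`,
the function `v(y) = ū(y) − 2 ln(1+|y|²) + ln(8/α)` is C², satisfies
`Δv + e^v = 8(1-α)/(α(1+|y|²)²) > 0`, and `∫_{ℝ²} e^v = 8π/α`. -/
theorem planar_reduction_of_solution (α : ℝ) (hα₀ : 0 < α) (hα₁ : α < 1)
    (u : (Fin 3 → ℝ) → ℝ) (hu : IsMFSolution (2 / α) u) :
    ContDiff ℝ 2 (fun y : ℝ × ℝ =>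
      u (stereoN y) - 2 * Real.log (1 + y.1 ^ 2 + y.2 ^ 2) + Real.log (8 / α)) ∧
    (∀ y : ℝ × ℝ,
      lap (fun z : ℝ × ℝ =>
          u (stereoN z) - 2 * Real.log (1 + z.1 ^ 2 + z.2 ^ 2) + Real.log (8 / α)) y
        + Real.exp (u (stereoN y) - 2 * Real.log (1 + y.1 ^ 2 + y.2 ^ 2) + Real.log (8 / α))
        = 8 * (1 - α) / (α * (1 + y.1 ^ 2 + y.2 ^ 2) ^ 2)) ∧
    (∀ y : ℝ × ℝ, 0 < 8 * (1 - α) / (α * (1 + y.1 ^ 2 + y.2 ^ 2) ^ 2)) ∧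
    (∫ y : ℝ × ℝ,
        Real.exp (u (stereoN y) - 2 * Real.log (1 + y.1 ^ 2 + y.2 ^ 2) + Real.log (8 / α)))
      = 8 * Real.pi / α := by
  obtain ⟨hc, hN, hS, hLN, -⟩ := hu
  have hα : α ≠ 0 := hα₀.ne'
  have hp : ∀ z : ℝ × ℝ, 0 < 1 + z.1 ^ 2 + z.2 ^ 2 := fun z => by positivity
  have hexp : ∀ y : ℝ × ℝ,
      Real.exp (u (stereoN y) - 2 * Real.log (1 + y.1 ^ 2 + y.2 ^ 2) + Real.log (8 / α))
      = 8 / α * Real.exp (u (stereoN y)) / (1 + y.1 ^ 2 + y.2 ^ 2) ^ 2 := by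
    intro y
    have h2 : 2 * Real.log (1 + y.1 ^ 2 + y.2 ^ 2) = Real.log ((1 + y.1 ^ 2 + y.2 ^ 2) ^ 2) := by
      rw [Real.log_pow]; norm_num
    rw [h2, Real.exp_add, Real.exp_sub, Real.exp_log (by have := hp y; positivity),
      Real.exp_log (by positivity)]
    ring
  have hlog2 : ContDiff ℝ 2 (fun y : ℝ × ℝ => 2 * Real.log (1 + y.1 ^ 2 + y.2 ^ 2)) :=
    contDiff_const.mul contDiff_log
  have hlap2 : ∀ y, lap (fun y : ℝ × ℝ => 2 * Real.log (1 + y.1 ^ 2 + y.2 ^ 2)) y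
      = 8 / (1 + y.1 ^ 2 + y.2 ^ 2) ^ 2 := by
    intro y
    have h := iteratedFDeriv_const_smul_apply' (a := (2 : ℝ)) (i := 2) (x := y)
      (contDiff_log.contDiffAt)
    have h4 := lap_log y
    simp only [lap, smul_eq_mul] at h h4 ⊢
    rw [h]
    simp only [ContinuousMultilinearMap.smul_apply, smul_eq_mul]
    rw [← mul_add, h4]
    ring
  have hconst : ∀ (f : ℝ × ℝ → ℝ) (_ : ContDiff ℝ 2 f) (c : ℝ) (y : ℝ × ℝ),
      lap (fun z => f z + c) y = lap f y := by
    intro f hf c y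
    simp only [lap]
    rw [fun_iteratedFDeriv_add_apply (i := 2) hf.contDiffAt contDiff_const.contDiffAt,
      iteratedFDeriv_const_of_ne (by norm_num)]
    simp
  have hlapv : ∀ y, lap (fun z : ℝ × ℝ =>
          u (stereoN z) - 2 * Real.log (1 + z.1 ^ 2 + z.2 ^ 2) + Real.log (8 / α)) y
      = lap (fun z => u (stereoN z)) y - 8 / (1 + y.1 ^ 2 + y.2 ^ 2) ^ 2 := by
    intro y
    rw [hconst _ (hN.sub hlog2), ← hlap2 y]
    simp only [lap]
    rw [fun_iteratedFDeriv_sub_apply (i := 2) hN.contDiffAt hlog2.contDiffAt]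
    simp only [ContinuousMultilinearMap.sub_apply]
    ring
  refine ⟨(hN.sub hlog2).add contDiff_const, ?_, ?_, ?_⟩
  · intro y
    rw [hlapv, hLN, hexp]
    have := (hp y).ne'
    field_simp
    ring
  · intro y
    have := hp y
    have : 0 < 1 - α := by linarith
    positivity
  · obtain ⟨M, hM⟩ := sphere3_compact.exists_bound_of_continuousOn hc
    have hMN : ∀ y, |u (stereoN y)| ≤ M := fun y => hM _ (stereoN_mem y)
    have hInt : Integrable (lap (fun z => u (stereoN z))) := by
      refine (integrable_conf.const_mul (8 / α * (1 + Real.exp M))).mono'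
        (cont_lap _ hN).aestronglyMeasurable (ae_of_all _ fun y => ?_)
      have hy := hp y
      have h1 : |1 - Real.exp (u (stereoN y))| ≤ 1 + Real.exp M := by
        have h2 : Real.exp (u (stereoN y)) ≤ Real.exp M :=
          Real.exp_le_exp.2 (le_of_abs_le (hMN y))
        have h3 := Real.exp_pos (u (stereoN y))
        rw [abs_le]; constructor <;> linarith
      rw [hLN, Real.norm_eq_abs, abs_div, abs_mul, abs_of_pos (show 0 < 4 * (2 / α) by positivity),
        abs_of_pos (show 0 < (1 + y.1 ^ 2 + y.2 ^ 2) ^ 2 by positivity), mul_one_div]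
      have : 4 * (2 / α) = 8 / α := by ring
      rw [this]
      gcongr
    have hz : ∫ y, lap (fun z => u (stereoN z)) y = 0 := by
      have hl := hconst _ hN (-u (stereoS 0))
      have hl' : lap (fun z => u (stereoN z) + -u (stereoS 0)) = lap (fun z => u (stereoN z)) :=
        funext hl
      rw [← hl']
      refine int_lap_zero _ (hN.add contDiff_const) (M + |u (stereoS 0)|) ?_ ?_ (hl' ▸ hInt)
      · intro y
        refine (abs_add_le _ _).trans ?_
        rw [abs_neg]
        linarith [hMN y]
      · intro z hz
        have h0 : Tendsto (fun n : ℕ => ((n : ℝ) + 1)⁻¹ • ((z.1 ^ 2 + z.2 ^ 2)⁻¹ • z)) atTop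
            (𝓝 ((0 : ℝ) • ((z.1 ^ 2 + z.2 ^ 2)⁻¹ • z))) := by
          apply Tendsto.smul_const
          simpa using tendsto_one_div_add_atTop_nhds_zero_nat (𝕜 := ℝ)
        rw [zero_smul] at h0
        have h1 := (hS.continuous.tendsto 0).comp h0
        have h2 := h1.add_const (-u (stereoS 0))
        rw [add_neg_cancel] at h2
        refine h2.congr fun n => ?_
        rw [stereo_inv z hz _ (by positivity)]
        rfl
    have hfin : ∀ y : ℝ × ℝ,
        Real.exp (u (stereoN y) - 2 * Real.log (1 + y.1 ^ 2 + y.2 ^ 2) + Real.log (8 / α))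
        = 8 / α * (1 / (1 + y.1 ^ 2 + y.2 ^ 2) ^ 2) - lap (fun z => u (stereoN z)) y := by
      intro y
      rw [hexp, hLN]
      ring
    simp_rw [hfin]
    rw [integral_sub (integrable_conf.const_mul _) hInt, hz, integral_const_mul, integral_conf]
    ring
end
end
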